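/- arXiv:1405.5276 — 13 statements merged into one kernel-verified Lean document; each statement's English description precedes it below -/
import Mathlib

section
/- Let F be a field, V an n-dimensional F-vector space with n ≥ 2, and let m, k, j be integers with 1 ≤ m < n, 1 ≤ k < n and max{0, m + k − n} ≤ j ≤ min{m, k}. Then the following are equivalent: (a) for every pair of distinct m-dimensional subspaces U₁, U₂ of V there exists a k-dimensional subspace W of V with dim(U₁ ∩ W) = j and dim(U₂ ∩ W) = j; (b) 2j ≤ k + max{0, 2m − n}. -/
open Module

namespace Submodule

/-- A vector space is not the union of two proper subspaces. -/
theorem exists_notMem_and_notMem_of_ne_top {R M : Type*} [Ring R] [AddCommGroup M] [Module R M]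
    {A B : Submodule R M} (hA : A ≠ ⊤) (hB : B ≠ ⊤) : ∃ v, v ∉ A ∧ v ∉ B := by
  obtain ⟨x, -, hx⟩ := SetLike.exists_of_lt hA.lt_top
  obtain ⟨y, -, hy⟩ := SetLike.exists_of_lt hB.lt_top
  by_cases hxB : x ∈ B
  · by_cases hyA : y ∈ A
    · exact ⟨x + y, fun h => hx ((A.add_mem_iff_left hyA).1 h),
        fun h => hy ((B.add_mem_iff_right hxB).1 h)⟩
    · exact ⟨y, hyA, hy⟩
  · exact ⟨x, hx, hxB⟩

/-- If `W₁ ≤ U₁` and `W₂ ≤ U₂` meet `U₁ ⊓ U₂` in the same subspace, then `W₁ ⊔ W₂` meets `U₁`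
exactly in `W₁`. -/
theorem inf_sup_eq_of_inf_eq {R M : Type*} [Ring R] [AddCommGroup M] [Module R M]
    {U₁ U₂ W₁ W₂ I : Submodule R M} (h₁ : W₁ ≤ U₁) (h₂ : W₂ ≤ U₂)
    (hI₁ : U₁ ⊓ U₂ ⊓ W₁ = I) (hI₂ : U₁ ⊓ U₂ ⊓ W₂ = I) : U₁ ⊓ (W₁ ⊔ W₂) = W₁ := by
  have h : U₁ ⊓ W₂ = I := by rw [← hI₂, inf_assoc, inf_eq_right.2 h₂]
  rw [inf_comm, sup_inf_assoc_of_le W₂ h₁, inf_comm, h, sup_eq_left, ← hI₁]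
  exact inf_le_right

variable {F V : Type*} [Field F] [AddCommGroup V] [Module F V] [FiniteDimensional F V]

/-- Between two nested subspaces there are subspaces of every intermediate dimension. -/
theorem exists_le_le_finrank_eq {A B : Submodule F V} (hAB : A ≤ B) {d : ℕ}
    (hA : finrank F A ≤ d) (hB : d ≤ finrank F B) :
    ∃ W : Submodule F V, A ≤ W ∧ W ≤ B ∧ finrank F W = d := by
  induction d, hA using Nat.le_induction with
  | base => exact ⟨A, le_rfl, hAB, rfl⟩
  | succ d _ ih =>
    obtain ⟨W, hAW, hWB, hW⟩ := ih (by omega)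
    have hlt : W < B := lt_of_le_of_ne hWB (by rintro rfl; omega)
    obtain ⟨v, hvB, hvW⟩ := SetLike.exists_of_lt hlt
    refine ⟨W ⊔ span F {v}, hAW.trans le_sup_left,
      sup_le hWB ((span_singleton_le_iff_mem v B).2 hvB), ?_⟩
    rw [finrank_sup_span_singleton hvW, hW]

/-- Adjoining a vector outside `U ⊔ W` to `W` does not change the dimension of `U ⊓ W`. -/
theorem finrank_inf_sup_span_singleton {U W : Submodule F V} {v : V} (hv : v ∉ U ⊔ W) :
    finrank F ↥(U ⊓ (W ⊔ span F {v})) = finrank F ↥(U ⊓ W) := by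
  have hvW : v ∉ W := fun h => hv (le_sup_right (a := U) h)
  have h₁ := finrank_sup_add_finrank_inf_eq U W
  have h₂ := finrank_sup_add_finrank_inf_eq U (W ⊔ span F {v})
  rw [← sup_assoc, finrank_sup_span_singleton hv, finrank_sup_span_singleton hvW] at h₂
  omega

/-- A subspace meeting two `m`-dimensional subspaces in dimension `j` can be enlarged to dimension
`k` without changing these two dimensions, as long as `m + k ≤ dim V + j`. -/
theorem exists_finrank_eq_and_finrank_inf_eq {U₁ U₂ W₀ : Submodule F V} {m j k : ℕ}
    (hU₁ : finrank F U₁ = m) (hU₂ : finrank F U₂ = m)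
    (h₁ : finrank F ↥(U₁ ⊓ W₀) = j) (h₂ : finrank F ↥(U₂ ⊓ W₀) = j)
    (hk : finrank F W₀ ≤ k) (hmk : m + k ≤ finrank F V + j) :
    ∃ W : Submodule F V, finrank F W = k ∧
      finrank F ↥(U₁ ⊓ W) = j ∧ finrank F ↥(U₂ ⊓ W) = j := by
  induction k, hk using Nat.le_induction with
  | base => exact ⟨W₀, rfl, h₁, h₂⟩
  | succ k _ ih =>
    obtain ⟨W, hW, hW₁, hW₂⟩ := ih (by omega)
    have ne_top : ∀ U : Submodule F V, finrank F U = m → finrank F ↥(U ⊓ W) = j → U ⊔ W ≠ ⊤ := by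
      intro U hU hUW htop
      have h := finrank_sup_add_finrank_inf_eq U W
      rw [htop, finrank_top] at h
      omega
    obtain ⟨v, hv₁, hv₂⟩ :=
      exists_notMem_and_notMem_of_ne_top (ne_top U₁ hU₁ hW₁) (ne_top U₂ hU₂ hW₂)
    refine ⟨W ⊔ span F {v}, ?_, ?_, ?_⟩
    · rw [finrank_sup_span_singleton fun h => hv₁ (le_sup_right (a := U₁) h), hW]
    · rw [finrank_inf_sup_span_singleton hv₁, hW₁]
    · rw [finrank_inf_sup_span_singleton hv₂, hW₂]

/-- Two `m`-dimensional subspaces admit a subspace of dimension `2j - min(j, dim (U₁ ⊓ U₂))`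
meeting both in dimension `j`. -/
theorem exists_finrank_add_min_eq_and_finrank_inf_eq {U₁ U₂ : Submodule F V} {m j : ℕ}
    (hU₁ : finrank F U₁ = m) (hU₂ : finrank F U₂ = m) (hj : j ≤ m) :
    ∃ W : Submodule F V, finrank F W + min j (finrank F ↥(U₁ ⊓ U₂)) = 2 * j ∧
      finrank F ↥(U₁ ⊓ W) = j ∧ finrank F ↥(U₂ ⊓ W) = j := by
  rcases le_total j (finrank F ↥(U₁ ⊓ U₂)) with h | h
  · obtain ⟨W, -, hW, hWj⟩ := exists_le_le_finrank_eq (bot_le (a := U₁ ⊓ U₂))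
      (by rw [finrank_bot]; exact Nat.zero_le j) h
    refine ⟨W, by rw [min_eq_left h]; omega, ?_, ?_⟩
    · rwa [inf_eq_right.2 (hW.trans inf_le_left)]
    · rwa [inf_eq_right.2 (hW.trans inf_le_right)]
  · obtain ⟨W₁, hI₁, hW₁, hj₁⟩ := exists_le_le_finrank_eq (inf_le_left : U₁ ⊓ U₂ ≤ U₁) h
      (hj.trans_eq hU₁.symm)
    obtain ⟨W₂, hI₂, hW₂, hj₂⟩ := exists_le_le_finrank_eq (inf_le_right : U₁ ⊓ U₂ ≤ U₂) h
      (hj.trans_eq hU₂.symm)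
    have hinf : W₁ ⊓ W₂ = U₁ ⊓ U₂ := le_antisymm (inf_le_inf hW₁ hW₂) (le_inf hI₁ hI₂)
    refine ⟨W₁ ⊔ W₂, ?_, ?_, ?_⟩
    · have := finrank_sup_add_finrank_inf_eq W₁ W₂
      rw [hinf] at this
      rw [min_eq_right h]
      omega
    · rw [inf_sup_eq_of_inf_eq hW₁ hW₂ (inf_eq_left.2 hI₁) (inf_eq_left.2 hI₂), hj₁]
    · rw [sup_comm, inf_sup_eq_of_inf_eq hW₂ hW₁ (I := U₁ ⊓ U₂) (by rwa [inf_comm U₂, inf_eq_left])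
        (by rwa [inf_comm U₂, inf_eq_left]), hj₂]

/-- There are two `m`-dimensional subspaces in general position. -/
theorem exists_finrank_eq_and_finrank_inf_eq_two_mul_sub {m : ℕ} (hm : m ≤ finrank F V) :
    ∃ U₁ U₂ : Submodule F V, finrank F U₁ = m ∧ finrank F U₂ = m ∧
      finrank F ↥(U₁ ⊓ U₂) = 2 * m - finrank F V := by
  obtain ⟨U₁, -, -, hU₁⟩ := exists_le_le_finrank_eq (bot_le (a := (⊤ : Submodule F V)))
    (d := m) (by simp) (by simpa using hm)
  obtain ⟨C, hC⟩ := U₁.exists_isCompl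
  have hdim := finrank_add_eq_of_isCompl hC
  rcases le_total m (finrank F C) with h | h
  · obtain ⟨U₂, -, hU₂C, hU₂⟩ := exists_le_le_finrank_eq (bot_le (a := C)) (by simp) h
    refine ⟨U₁, U₂, hU₁, hU₂, ?_⟩
    rw [(hC.disjoint.mono_right hU₂C).eq_bot, finrank_bot]
    omega
  · obtain ⟨U₂, hCU₂, -, hU₂⟩ := exists_le_le_finrank_eq (le_top (a := C)) h (by simpa using hm)
    refine ⟨U₁, U₂, hU₁, hU₂, ?_⟩
    have := finrank_sup_add_finrank_inf_eq U₁ U₂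
    rw [(hC.codisjoint.mono_right hCU₂).eq_top, finrank_top] at this
    omega

/-- A subspace `W` has dimension at least that of the sum of `U₁ ⊓ W` and `U₂ ⊓ W`. -/
theorem finrank_inf_add_finrank_inf_le (U₁ U₂ W : Submodule F V) :
    finrank F ↥(U₁ ⊓ W) + finrank F ↥(U₂ ⊓ W) ≤ finrank F W + finrank F ↥(U₁ ⊓ U₂) := by
  rw [← finrank_sup_add_finrank_inf_eq]
  exact add_le_add (finrank_mono (sup_le inf_le_right inf_le_right))
    (finrank_mono (inf_le_inf inf_le_left inf_le_left))

end Submodule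

theorem collinear_complete_proj_mkj_iff
    {F V : Type*} [Field F] [AddCommGroup V] [Module F V] [FiniteDimensional F V]
    (n m k j : ℕ) (hn : finrank F V = n) (hn2 : 2 ≤ n)
    (hm1 : 1 ≤ m) (hmn : m < n) (hk1 : 1 ≤ k) (hkn : k < n)
    (hjl : m + k - n ≤ j) (hju : j ≤ min m k) :
    (∀ U₁ U₂ : Submodule F V, finrank F U₁ = m → finrank F U₂ = m → U₁ ≠ U₂ →
      ∃ W : Submodule F V, finrank F W = k ∧
        finrank F ↥(U₁ ⊓ W) = j ∧ finrank F ↥(U₂ ⊓ W) = j) ↔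
      2 * j ≤ k + (2 * m - n) := by
  have hjm : j ≤ m := hju.trans (min_le_left m k)
  have hjk : j ≤ k := hju.trans (min_le_right m k)
  constructor
  · intro h
    obtain ⟨U₁, U₂, hU₁, hU₂, hU⟩ :=
      Submodule.exists_finrank_eq_and_finrank_inf_eq_two_mul_sub (F := F) (V := V) (m := m)
        (by omega)
    have hne : U₁ ≠ U₂ := by
      rintro rfl
      rw [inf_idem] at hU
      omega
    obtain ⟨W, hW, hW₁, hW₂⟩ := h U₁ U₂ hU₁ hU₂ hne
    have := Submodule.finrank_inf_add_finrank_inf_le U₁ U₂ W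
    omega
  · intro h U₁ U₂ hU₁ hU₂ _
    obtain ⟨W₀, hW₀, h₁, h₂⟩ :=
      Submodule.exists_finrank_add_min_eq_and_finrank_inf_eq hU₁ hU₂ hjm
    have hsum := Submodule.finrank_sup_add_finrank_inf_eq U₁ U₂
    have hle := Submodule.finrank_le (U₁ ⊔ U₂)
    exact Submodule.exists_finrank_eq_and_finrank_inf_eq hU₁ hU₂ h₁ h₂ (by omega) (by omega)
end

section
/- Let F be a field, V an n-dimensional F-vector space with n ≥ 2, and let U, W be subspaces of V with dim U = m, dim W = k and dim(U ∩ W) = j, where 1 ≤ m < n and 1 ≤ k < n. Then the following are equivalent: (a) every g ∈ GL(V) can be written as g = a ∘ b ∘ c where a, b, c ∈ GL(V) satisfy a(U) = U, c(U) = U and b(W) = W; (b) 2j ≤ k + max{0, 2m − n}. -/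
open Module

namespace Submodule

variable {F V V' : Type*} [Field F] [AddCommGroup V] [Module F V] [AddCommGroup V'] [Module F V']

theorem exists_linearEquiv_extending_of_isCompl {p q : Submodule F V} {p' q' : Submodule F V'}
    (h : IsCompl p q) (h' : IsCompl p' q') (e₁ : p ≃ₗ[F] p') (e₂ : q ≃ₗ[F] q') :
    ∃ g : V ≃ₗ[F] V', (∀ x : p, g x = e₁ x) ∧ ∀ x : q, g x = e₂ x := by
  refine ⟨(prodEquivOfIsCompl p q h).symm ≪≫ₗ e₁.prodCongr e₂ ≪≫ₗ prodEquivOfIsCompl p' q' h',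
    fun x => ?_, fun x => ?_⟩
  · simp
  · simp

theorem map_eq_of_forall_apply_eq {p : Submodule F V} {p' : Submodule F V'} {g : V ≃ₗ[F] V'}
    {e : p ≃ₗ[F] p'} (h : ∀ x : p, g x = e x) : p.map (g : V →ₗ[F] V') = p' := by
  ext y
  constructor
  · rintro ⟨x, hx, rfl⟩
    simpa using h ⟨x, hx⟩ ▸ (e ⟨x, hx⟩).2
  · intro hy
    exact ⟨e.symm ⟨y, hy⟩, (e.symm ⟨y, hy⟩).2, by simp [h]⟩

theorem exists_linearEquiv_map_eq [FiniteDimensional F V] [FiniteDimensional F V']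
    (hV : finrank F V = finrank F V') {p : Submodule F V} {p' : Submodule F V'}
    (hp : finrank F p = finrank F p') : ∃ g : V ≃ₗ[F] V', p.map (g : V →ₗ[F] V') = p' := by
  obtain ⟨q, hq⟩ := p.exists_isCompl
  obtain ⟨q', hq'⟩ := p'.exists_isCompl
  have h := finrank_add_eq_of_isCompl hq
  have h' := finrank_add_eq_of_isCompl hq'
  obtain ⟨g, hg, -⟩ := exists_linearEquiv_extending_of_isCompl hq hq'
    (LinearEquiv.ofFinrankEq p p' hp) (LinearEquiv.ofFinrankEq q q' (by omega))
  exact ⟨g, map_eq_of_forall_apply_eq hg⟩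

theorem exists_finrank_eq [FiniteDimensional F V] {t : ℕ} (ht : t ≤ finrank F V) :
    ∃ K : Submodule F V, finrank F K = t := by
  obtain ⟨v, hv⟩ := exists_linearIndependent_of_le_finrank ht
  exact ⟨span F (Set.range v), by simpa using finrank_span_eq_card hv⟩

theorem exists_le_finrank_eq [FiniteDimensional F V] {A : Submodule F V} {t : ℕ}
    (ht : t ≤ finrank F A) : ∃ K ≤ A, finrank F K = t := by
  obtain ⟨K, hK⟩ := exists_finrank_eq ht
  exact ⟨K.map A.subtype, map_subtype_le A K, by rwa [finrank_map_subtype_eq]⟩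

theorem finrank_map_mkQ_add [FiniteDimensional F V] {K A : Submodule F V} (h : K ≤ A) :
    finrank F (A.map K.mkQ) + finrank F K = finrank F A := by
  have := (K.mkQ.domRestrict A).finrank_range_add_finrank_ker
  rw [LinearMap.range_domRestrict, LinearMap.ker_domRestrict, ker_mkQ] at this
  rwa [(comapSubtypeEquivOfLe h).finrank_eq] at this

theorem exists_ge_finrank_eq [FiniteDimensional F V] {A : Submodule F V} {t : ℕ}
    (hA : finrank F A ≤ t) (ht : t ≤ finrank F V) :
    ∃ K, A ≤ K ∧ finrank F K = t := by
  have h := A.finrank_quotient_add_finrank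
  obtain ⟨K, hK⟩ := exists_finrank_eq (F := F) (V := V ⧸ A) (t := t - finrank F A) (by omega)
  refine ⟨K.comap A.mkQ, le_comap_mkQ A K, ?_⟩
  have h' := finrank_map_mkQ_add (le_comap_mkQ A K)
  rw [map_comap_eq_of_surjective A.mkQ_surjective] at h'
  omega

theorem exists_linearEquiv_map_le [FiniteDimensional F V] [FiniteDimensional F V']
    (hV : finrank F V = finrank F V') {p : Submodule F V} {p' : Submodule F V'}
    (hp : finrank F p ≤ finrank F p') : ∃ g : V ≃ₗ[F] V', p.map (g : V →ₗ[F] V') ≤ p' := by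
  obtain ⟨q, hq, hqp⟩ := exists_le_finrank_eq hp
  obtain ⟨g, hg⟩ := exists_linearEquiv_map_eq hV hqp.symm
  exact ⟨g, hg ▸ hq⟩

theorem exists_linearMap_map_le_finrank_range_eq [FiniteDimensional F V] [FiniteDimensional F V']
    (A : Submodule F V) (C : Submodule F V') {d : ℕ} (hd : d ≤ finrank F V)
    (hd' : d ≤ finrank F V') (h : d + finrank F A ≤ finrank F V + finrank F C) :
    ∃ f : V →ₗ[F] V', A.map f ≤ C ∧ finrank F (LinearMap.range f) = d := by
  obtain ⟨K, hK, hKA⟩ : ∃ K : Submodule F V, finrank F K = finrank F V - d ∧ (K ≤ A ∨ A ≤ K) := by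
    rcases le_total (finrank F V - d) (finrank F A) with h | h
    · obtain ⟨K, hK, hK'⟩ := exists_le_finrank_eq h
      exact ⟨K, hK', .inl hK⟩
    · obtain ⟨K, hK, hK'⟩ := exists_ge_finrank_eq h (Nat.sub_le _ _)
      exact ⟨K, hK', .inr hK⟩
  obtain ⟨R, hR, hRC⟩ : ∃ R : Submodule F V', finrank F R = d ∧ (R ≤ C ∨ C ≤ R) := by
    rcases le_total d (finrank F C) with h | h
    · obtain ⟨K, hK, hK'⟩ := exists_le_finrank_eq h
      exact ⟨K, hK', .inl hK⟩
    · obtain ⟨K, hK, hK'⟩ := exists_ge_finrank_eq h hd'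
      exact ⟨K, hK', .inr hK⟩
  have hQ := K.finrank_quotient_add_finrank
  have hS : finrank F (A.map K.mkQ) ≤ finrank F (C.comap R.subtype) := by
    rcases hRC with hRC | hRC
    · rw [comap_subtype_eq_top.2 hRC, finrank_top]
      exact (finrank_le _).trans (by omega)
    · rw [(comapSubtypeEquivOfLe hRC).finrank_eq]
      rcases hKA with hKA | hKA
      · have := finrank_map_mkQ_add hKA
        omega
      · rw [eq_bot_iff.2 (map_le_iff_le_comap.2 (by simpa using hKA)), finrank_bot]
        exact Nat.zero_le _
  obtain ⟨e, he⟩ := exists_linearEquiv_map_le (by omega) hS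
  refine ⟨R.subtype ∘ₗ (e : V ⧸ K →ₗ[F] R) ∘ₗ K.mkQ, ?_, ?_⟩
  · rw [map_comp, map_comp, map_le_iff_le_comap]
    exact he
  · rw [LinearMap.range_comp, LinearMap.range_eq_top.2 (by simpa using e.surjective.comp K.mkQ_surjective),
      map_subtype_top, hR]

theorem exists_le_isCompl_inf_sup_eq (U X : Submodule F V) :
    ∃ C E : Submodule F V, C ≤ E ∧ IsCompl U E ∧ Disjoint (U ⊓ X) C ∧ U ⊓ X ⊔ C = X := by
  obtain ⟨C, hd, hs⟩ := IsModularLattice.exists_disjoint_and_sup_eq (inf_le_right : U ⊓ X ≤ X)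
  have hUC : Disjoint C U := by
    rw [disjoint_iff_inf_le]
    intro x hx
    exact disjoint_iff_inf_le.1 hd ⟨⟨hx.2, hs ▸ mem_sup_right hx.1⟩, hx.1⟩
  obtain ⟨E, hE, hE'⟩ := hUC.exists_isCompl
  exact ⟨C, E, hE, hE'.symm, hd, hs⟩

theorem finrank_sup_of_disjoint [FiniteDimensional F V] {p q : Submodule F V}
    (h : Disjoint p q) : finrank F ↥(p ⊔ q) = finrank F p + finrank F q := by
  rw [← finrank_sup_add_finrank_inf_eq, h.eq_bot, finrank_bot, add_zero]

theorem map_eq_of_forall_apply_eq_of_le {p q : Submodule F V} {p' q' : Submodule F V'}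
    {g : V ≃ₗ[F] V'} {e : p ≃ₗ[F] p'} (h : ∀ x : p, g x = e x) (hq : q ≤ p) (hq' : q' ≤ p')
    (he : (q.comap p.subtype).map (e : p →ₗ[F] p') = q'.comap p'.subtype) :
    q.map (g : V →ₗ[F] V') = q' := by
  have hc : (g : V →ₗ[F] V') ∘ₗ p.subtype = p'.subtype ∘ₗ (e : p →ₗ[F] p') := LinearMap.ext h
  rw [← inf_eq_right.2 hq, ← map_comap_subtype, ← map_comp, hc, map_comp, he, map_comap_subtype,
    inf_eq_right.2 hq']

/-- A pair of subspaces is determined up to a linear automorphism by its dimensions. -/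
theorem exists_linearEquiv_map_eq_map_eq [FiniteDimensional F V] {U X U' X' : Submodule F V}
    (hU : finrank F U = finrank F U') (hX : finrank F X = finrank F X')
    (hUX : finrank F ↥(U ⊓ X) = finrank F ↥(U' ⊓ X')) :
    ∃ g : V ≃ₗ[F] V, U.map (g : V →ₗ[F] V) = U' ∧ X.map (g : V →ₗ[F] V) = X' := by
  obtain ⟨C, E, hCE, hUE, hd, hs⟩ := exists_le_isCompl_inf_sup_eq U X
  obtain ⟨C', E', hCE', hUE', hd', hs'⟩ := exists_le_isCompl_inf_sup_eq U' X'
  have hC := finrank_sup_of_disjoint hd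
  have hC' := finrank_sup_of_disjoint hd'
  rw [hs] at hC
  rw [hs'] at hC'
  have hE := finrank_add_eq_of_isCompl hUE
  have hE' := finrank_add_eq_of_isCompl hUE'
  obtain ⟨e₁, he₁⟩ := exists_linearEquiv_map_eq hU (p := (U ⊓ X).comap U.subtype)
    (p' := (U' ⊓ X').comap U'.subtype) (by
      rwa [(comapSubtypeEquivOfLe inf_le_left).finrank_eq,
        (comapSubtypeEquivOfLe inf_le_left).finrank_eq])
  obtain ⟨e₂, he₂⟩ := exists_linearEquiv_map_eq (V := E) (V' := E') (by omega)
    (p := C.comap E.subtype) (p' := C'.comap E'.subtype) (by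
      rw [(comapSubtypeEquivOfLe hCE).finrank_eq, (comapSubtypeEquivOfLe hCE').finrank_eq]
      omega)
  obtain ⟨g, hg₁, hg₂⟩ := exists_linearEquiv_extending_of_isCompl hUE hUE' e₁ e₂
  refine ⟨g, map_eq_of_forall_apply_eq hg₁, ?_⟩
  rw [← hs, ← hs', map_sup, map_eq_of_forall_apply_eq_of_le hg₁ inf_le_left inf_le_left he₁,
    map_eq_of_forall_apply_eq_of_le hg₂ hCE hCE' he₂]

/-- For complementary subspaces `U` and `E`, the unipotent automorphism `u + e ↦ u + (f u + e)`
moves `U` to the graph of `f`. -/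
theorem exists_linearEquiv_apply_eq_add {U E : Submodule F V} (h : IsCompl U E) (f : U →ₗ[F] E) :
    ∃ b : V ≃ₗ[F] V, (∀ u : U, b u = u + f u) ∧ ∀ e : E, b e = e := by
  let N : V →ₗ[F] V := E.subtype ∘ₗ f ∘ₗ U.projectionOnto E h
  have hU (u : U) : N u = f u := by simp [N]
  have hE (e : E) : N e = 0 := by simp [N]
  have hN (v : V) : N (N v) = 0 := hE (f (U.projectionOnto E h v))
  refine ⟨LinearEquiv.ofLinearMap (LinearMap.id + N) (LinearMap.id - N) ?_ ?_, fun u => ?_,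
    fun e => ?_⟩
  · ext v
    simp [hN]
  · ext v
    simp [hN]
  · simp [hU]
  · simp [hE]

/-- The stabiliser of `W` moves `U` to subspaces meeting `U` in every codimension `d` allowed by
the dimensions of `U`, `W` and `U ⊓ W`. -/
theorem exists_linearEquiv_map_eq_finrank_inf_map [FiniteDimensional F V] (U W : Submodule F V)
    {d : ℕ} (hd : d ≤ finrank F U) (hd' : finrank F U + d ≤ finrank F V)
    (h : d + 2 * finrank F ↥(U ⊓ W) ≤ finrank F U + finrank F W) :
    ∃ b : V ≃ₗ[F] V, W.map (b : V →ₗ[F] V) = W ∧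
      finrank F ↥(U ⊓ U.map (b : V →ₗ[F] V)) + d = finrank F U := by
  obtain ⟨C, E, hCE, hUE, hdisj, hs⟩ := exists_le_isCompl_inf_sup_eq U W
  have hC := finrank_sup_of_disjoint hdisj
  rw [hs] at hC
  have hE := finrank_add_eq_of_isCompl hUE
  obtain ⟨f, hf, hfd⟩ := exists_linearMap_map_le_finrank_range_eq ((U ⊓ W).comap U.subtype)
    (C.comap E.subtype) hd (by omega) (by
      rw [(comapSubtypeEquivOfLe inf_le_left).finrank_eq, (comapSubtypeEquivOfLe hCE).finrank_eq]
      omega)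
  obtain ⟨b, hbU, hbE⟩ := exists_linearEquiv_apply_eq_add hUE f
  refine ⟨b, eq_of_le_of_finrank_eq ?_ (b.finrank_map_eq W), ?_⟩
  · have hCW : C ≤ W := hs ▸ le_sup_right
    conv_lhs => rw [← hs, map_sup]
    refine sup_le ?_ ?_
    · rintro _ ⟨u, hu, rfl⟩
      have hfu : (f ⟨u, hu.1⟩ : V) ∈ C := hf (mem_map_of_mem (p := (U ⊓ W).comap U.subtype) hu)
      simpa [hbU ⟨u, hu.1⟩] using W.add_mem hu.2 (hCW hfu)
    · rintro _ ⟨c, hc, rfl⟩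
      simpa [hbE ⟨c, hCE hc⟩] using hCW hc
  · have hker : U ⊓ U.map (b : V →ₗ[F] V) = (LinearMap.ker f).map U.subtype := by
      ext x
      constructor
      · rintro ⟨hx, u, hu, rfl⟩
        have hbu : b u = u + f ⟨u, hu⟩ := hbU ⟨u, hu⟩
        have hfU : (f ⟨u, hu⟩ : V) ∈ U := by
          have := U.sub_mem hx hu
          simpa [hbu] using this
        have hf0 : f ⟨u, hu⟩ = 0 := Subtype.ext (disjoint_def.1 hUE.disjoint _ hfU (f ⟨u, hu⟩).2)
        exact ⟨⟨u, hu⟩, hf0, by simp [hbu, hf0]⟩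
      · rintro ⟨u, hu, rfl⟩
        exact ⟨u.2, u, u.2, by simpa [LinearMap.mem_ker.1 hu] using hbU u⟩
    have := f.finrank_range_add_finrank_ker
    rw [hker, finrank_map_subtype_eq]
    omega

end Submodule

open Submodule in
theorem GL_triple_factorisation_parabolic_iff
    {F V : Type*} [Field F] [AddCommGroup V] [Module F V] [FiniteDimensional F V]
    (n m k j : ℕ) (hn : finrank F V = n) (hn2 : 2 ≤ n)
    (hm1 : 1 ≤ m) (hmn : m < n) (hk1 : 1 ≤ k) (hkn : k < n)
    (U W : Submodule F V) (hU : finrank F U = m) (hW : finrank F W = k)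
    (hUW : finrank F ↥(U ⊓ W) = j) :
    (∀ g : V ≃ₗ[F] V, ∃ a b c : V ≃ₗ[F] V,
        U.map (a : V →ₗ[F] V) = U ∧ U.map (c : V →ₗ[F] V) = U ∧
        W.map (b : V →ₗ[F] V) = W ∧ ∀ v : V, g v = a (b (c v))) ↔
      2 * j ≤ k + (2 * m - n) := by
  constructor
  · intro H
    obtain ⟨g, -, hg⟩ := exists_linearEquiv_map_eq_finrank_inf_map U (⊥ : Submodule F V)
      (d := min m (n - m)) (by omega) (by omega) (by rw [inf_bot_eq, finrank_bot]; omega)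
    obtain ⟨a, b, c, ha, hc, hb, habc⟩ := H g
    have hgU : U.map (g : V →ₗ[F] V) = (U.map (b : V →ₗ[F] V)).map (a : V →ₗ[F] V) := by
      have hcomp : (g : V →ₗ[F] V) = (a : V →ₗ[F] V) ∘ₗ (b : V →ₗ[F] V) ∘ₗ (c : V →ₗ[F] V) :=
        LinearMap.ext habc
      rw [hcomp, map_comp, map_comp, hc]
    have hinf : finrank F ↥(U ⊓ U.map (g : V →ₗ[F] V)) =
        finrank F ↥(U ⊓ U.map (b : V →ₗ[F] V)) := by
      rw [← a.finrank_map_eq (U ⊓ U.map (b : V →ₗ[F] V)), Submodule.map_inf _ a.injective, ha, hgU]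
    have h₁ := finrank_sup_add_finrank_inf_eq (U ⊓ W) ((U ⊓ W).map (b : V →ₗ[F] V))
    have h₂ : U ⊓ W ⊔ (U ⊓ W).map (b : V →ₗ[F] V) ≤ W :=
      sup_le inf_le_right ((map_mono inf_le_right).trans hb.le)
    have h₃ : U ⊓ W ⊓ (U ⊓ W).map (b : V →ₗ[F] V) ≤ U ⊓ U.map (b : V →ₗ[F] V) :=
      inf_le_inf inf_le_left (map_mono inf_le_left)
    have h₄ := finrank_mono h₂
    have h₅ := finrank_mono h₃
    rw [b.finrank_map_eq] at h₁
    omega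
  · intro h g
    have hsum := finrank_sup_add_finrank_inf_eq U (U.map (g : V →ₗ[F] V))
    have hle := finrank_le (U ⊔ U.map (g : V →ₗ[F] V))
    have hinf := finrank_mono (inf_le_left : U ⊓ U.map (g : V →ₗ[F] V) ≤ U)
    have hj := finrank_mono (inf_le_left : U ⊓ W ≤ U)
    have hj' := finrank_mono (inf_le_right : U ⊓ W ≤ W)
    rw [g.finrank_map_eq] at hsum
    obtain ⟨b, hb, hbd⟩ := exists_linearEquiv_map_eq_finrank_inf_map U W
      (d := m - finrank F ↥(U ⊓ U.map (g : V →ₗ[F] V))) (by omega) (by omega) (by omega)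
    obtain ⟨a, ha, hab⟩ := exists_linearEquiv_map_eq_map_eq (U := U) (U' := U)
      (X := U.map (b : V →ₗ[F] V)) (X' := U.map (g : V →ₗ[F] V)) rfl
      (by rw [b.finrank_map_eq, g.finrank_map_eq]) (by omega)
    refine ⟨a, b, g ≪≫ₗ a.symm ≪≫ₗ b.symm, ha,
      eq_of_le_of_finrank_eq ?_ (LinearEquiv.finrank_map_eq _ U), hb, fun v => by simp⟩
    rintro _ ⟨u, hu, rfl⟩
    obtain ⟨_, ⟨u', hu', rfl⟩, huu'⟩ := hab.ge (mem_map_of_mem hu)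
    have hgu : g u = a (b u') := huu'.symm
    simpa [hgu] using hu'
end

section
/- Let F be a finite field with |F| = q, let k ≥ 1, let V be a 2k-dimensional F-vector space, and let m, k1, k2 be integers with 0 ≤ k1 ≤ k2 ≤ k, k1 + k2 ≤ m ≤ k + k1 and m < 2k. Then Proj^{m,k}_{(k1,k2)}(V) is collinearly complete if and only if 3·k2 ≤ k + 1 + m + k1 and (q, m, k, k1, k2) ≠ (2, 1, 1, 0, 0). -/
open Module

/-- `{V₁, V₂}` is a bisection of `V` into two `k`-dimensional subspaces. -/
def IsBisection {F V : Type*} [Field F] [AddCommGroup V] [Module F V]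
    (k : ℕ) (V₁ V₂ : Submodule F V) : Prop :=
  finrank F V₁ = k ∧ finrank F V₂ = k ∧ V₁ ⊓ V₂ = ⊥ ∧ V₁ ⊔ V₂ = ⊤

/-- The unordered pair of intersection dimensions of `U` with `V₁, V₂` is `(k₁, k₂)`. -/
def Incident {F V : Type*} [Field F] [AddCommGroup V] [Module F V]
    (k₁ k₂ : ℕ) (U V₁ V₂ : Submodule F V) : Prop :=
  (finrank F ↥(U ⊓ V₁) = k₁ ∧ finrank F ↥(U ⊓ V₂) = k₂) ∨
  (finrank F ↥(U ⊓ V₁) = k₂ ∧ finrank F ↥(U ⊓ V₂) = k₁)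

/-- Collinear completeness of the geometry `Proj^{m,k}_{(k₁,k₂)}(V)`. -/
def CollinearlyComplete (F V : Type*) [Field F] [AddCommGroup V] [Module F V]
    (m k k₁ k₂ : ℕ) : Prop :=
  ∀ U₁ U₂ : Submodule F V, finrank F U₁ = m → finrank F U₂ = m → U₁ ≠ U₂ →
    ∃ V₁ V₂ : Submodule F V, IsBisection k V₁ V₂ ∧
      Incident k₁ k₂ U₁ V₁ V₂ ∧ Incident k₁ k₂ U₂ V₁ V₂

section LinearAlgebra

variable {F V W : Type*} [Field F] [AddCommGroup V] [Module F V] [AddCommGroup W] [Module F W]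

theorem exists_linearEquiv_extending_of_isCompl {A B : Submodule F V} {A' B' : Submodule F W}
    (h : IsCompl A B) (h' : IsCompl A' B') (f : A ≃ₗ[F] A') (g : B ≃ₗ[F] B') :
    ∃ e : V ≃ₗ[F] W, (∀ x : A, e x = f x) ∧ ∀ x : B, e x = g x := by
  refine ⟨(A.prodEquivOfIsCompl B h).symm ≪≫ₗ (f.prodCongr g) ≪≫ₗ A'.prodEquivOfIsCompl B' h',
    ?_, ?_⟩ <;> intro x <;> simp

theorem map_eq_of_forall_apply_eq {A : Submodule F V} {A' : Submodule F W}
    (f : A ≃ₗ[F] A') (e : V ≃ₗ[F] W) (h : ∀ x : A, e x = f x) :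
    A.map (e : V →ₗ[F] W) = A' := by
  ext y
  constructor
  · rintro ⟨x, hx, rfl⟩
    have := h ⟨x, hx⟩
    simp only [LinearEquiv.coe_coe] at this ⊢
    rw [this]
    exact (f ⟨x, hx⟩).2
  · intro hy
    exact ⟨f.symm ⟨y, hy⟩, (f.symm ⟨y, hy⟩).2, by simp [h]⟩

theorem finrank_inf_map_equiv (e : V ≃ₗ[F] W) (A B : Submodule F V) :
    finrank F ↥(A.map (e : V →ₗ[F] W) ⊓ B.map (e : V →ₗ[F] W)) = finrank F ↥(A ⊓ B) := by
  rw [← Submodule.map_inf _ e.injective]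
  exact e.finrank_map_eq _

theorem exists_le_finrank_eq (A : Submodule F V) {n : ℕ} (hn : n ≤ finrank F A) :
    ∃ B ≤ A, finrank F B = n := by
  obtain ⟨v, hv⟩ := exists_linearIndependent_of_le_finrank hn
  refine ⟨Submodule.span F (Set.range fun i => (v i : V)), ?_, ?_⟩
  · rw [Submodule.span_le]
    rintro _ ⟨i, rfl⟩
    exact (v i).2
  · have := hv.map' A.subtype A.ker_subtype
    exact (finrank_span_eq_card this).trans (Fintype.card_fin n)

variable [FiniteDimensional F V] [FiniteDimensional F W]

theorem exists_linearEquiv_map_eq {A : Submodule F V} {A' : Submodule F W}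
    (hVW : finrank F V = finrank F W) (hA : finrank F A = finrank F A') :
    ∃ e : V ≃ₗ[F] W, A.map (e : V →ₗ[F] W) = A' := by
  obtain ⟨B, hB⟩ := A.exists_isCompl
  obtain ⟨B', hB'⟩ := A'.exists_isCompl
  have h1 := Submodule.finrank_add_eq_of_isCompl hB
  have h2 := Submodule.finrank_add_eq_of_isCompl hB'
  let f := LinearEquiv.ofFinrankEq A A' hA
  let g : B ≃ₗ[F] B' := LinearEquiv.ofFinrankEq B B' (by omega)
  obtain ⟨e, he, -⟩ := exists_linearEquiv_extending_of_isCompl hB hB' f g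
  exact ⟨e, map_eq_of_forall_apply_eq f e he⟩

theorem exists_isCompl_and_sup_eq (U₁ U₂ : Submodule F V) :
    ∃ S Q : Submodule F V, IsCompl U₁ S ∧ Q ≤ S ∧ U₁ ⊓ U₂ ⊔ Q = U₂ ∧
      finrank F ↥(U₁ ⊓ U₂) + finrank F Q = finrank F U₂ := by
  obtain ⟨C, hC⟩ := (U₁ ⊓ U₂).exists_isCompl
  have hd : U₁ ⊓ U₂ ⊓ (C ⊓ U₂) = ⊥ := (hC.disjoint.mono_right inf_le_left).eq_bot
  have hc : U₁ ⊓ U₂ ⊔ C ⊓ U₂ = U₂ := by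
    rw [← sup_inf_assoc_of_le C inf_le_right, hC.sup_eq_top, top_inf_eq]
  set Q := C ⊓ U₂
  have hQU : Q ≤ U₂ := inf_le_right
  have hdis : Disjoint U₁ Q := by
    rw [disjoint_iff, ← hd, inf_assoc, inf_eq_right.2 hQU]
  obtain ⟨S, hS, hc'⟩ := hdis.symm.exists_isCompl
  refine ⟨S, Q, hc'.symm, hS, hc, ?_⟩
  have := Submodule.finrank_sup_add_finrank_inf_eq (U₁ ⊓ U₂) Q
  rw [hd, hc, finrank_bot] at this
  omega

theorem exists_linearEquiv_map_pair_eq {U₁ U₂ : Submodule F V} {U₁' U₂' : Submodule F W}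
    (hVW : finrank F V = finrank F W) (h₁ : finrank F U₁ = finrank F U₁')
    (h₂ : finrank F U₂ = finrank F U₂')
    (h₁₂ : finrank F ↥(U₁ ⊓ U₂) = finrank F ↥(U₁' ⊓ U₂')) :
    ∃ e : V ≃ₗ[F] W, U₁.map (e : V →ₗ[F] W) = U₁' ∧ U₂.map (e : V →ₗ[F] W) = U₂' := by
  obtain ⟨S, Q, hS, hQS, hQ, hQf⟩ := exists_isCompl_and_sup_eq U₁ U₂
  obtain ⟨S', Q', hS', hQS', hQ', hQf'⟩ := exists_isCompl_and_sup_eq U₁' U₂'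
  have hf := Submodule.finrank_add_eq_of_isCompl hS
  have hf' := Submodule.finrank_add_eq_of_isCompl hS'
  obtain ⟨f, hfm⟩ := exists_linearEquiv_map_eq (A := (U₁ ⊓ U₂).comap U₁.subtype)
    (A' := (U₁' ⊓ U₂').comap U₁'.subtype) h₁ (by
      rw [(Submodule.comapSubtypeEquivOfLe inf_le_left).finrank_eq,
        (Submodule.comapSubtypeEquivOfLe inf_le_left).finrank_eq, h₁₂])
  obtain ⟨g, hgm⟩ := exists_linearEquiv_map_eq (A := Q.comap S.subtype)
    (A' := Q'.comap S'.subtype) (by omega) (by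
      rw [(Submodule.comapSubtypeEquivOfLe hQS).finrank_eq,
        (Submodule.comapSubtypeEquivOfLe hQS').finrank_eq]
      omega)
  obtain ⟨e, he₁, he₂⟩ := exists_linearEquiv_extending_of_isCompl hS hS' f g
  have key : ∀ {A T : Submodule F V} {A' T' : Submodule F W} (f : A ≃ₗ[F] A')
      (_ : ∀ x : A, e x = f x) (_ : T ≤ A) (_ : T' ≤ A')
      (_ : (T.comap A.subtype).map (f : A →ₗ[F] A') = T'.comap A'.subtype),
      T.map (e : V →ₗ[F] W) = T' := by
    intro A T A' T' f he hT hT' hm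
    have h1 : (e : V →ₗ[F] W) ∘ₗ A.subtype = A'.subtype ∘ₗ (f : A →ₗ[F] A') :=
      LinearMap.ext he
    have := congrArg (Submodule.map A'.subtype) hm
    rw [← Submodule.map_comp, ← h1, Submodule.map_comp, Submodule.map_comap_subtype,
      Submodule.map_comap_subtype, inf_eq_right.2 hT, inf_eq_right.2 hT'] at this
    exact this
  refine ⟨e, map_eq_of_forall_apply_eq f e he₁, ?_⟩
  rw [← hQ, Submodule.map_sup, key f he₁ inf_le_left inf_le_left hfm, key g he₂ hQS hQS' hgm, hQ']

theorem exists_pair_finrank_eq {m t : ℕ} (ht : t ≤ m) (hm : 2 * m ≤ finrank F V + t) :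
    ∃ U₁ U₂ : Submodule F V, finrank F U₁ = m ∧ finrank F U₂ = m ∧
      finrank F ↥(U₁ ⊓ U₂) = t := by
  obtain ⟨U₁, -, hU₁⟩ := exists_le_finrank_eq (⊤ : Submodule F V) (n := m)
    (by rw [finrank_top]; omega)
  obtain ⟨T, hT, hTf⟩ := exists_le_finrank_eq U₁ (n := t) (by omega)
  obtain ⟨S, hS⟩ := U₁.exists_isCompl
  have hf := Submodule.finrank_add_eq_of_isCompl hS
  obtain ⟨Q, hQ, hQf⟩ := exists_le_finrank_eq S (n := m - t) (by omega)
  have hd : U₁ ⊓ Q = ⊥ := (hS.disjoint.mono_right hQ).eq_bot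
  have hi : U₁ ⊓ (T ⊔ Q) = T := by
    rw [inf_comm, sup_inf_assoc_of_le Q hT, inf_comm, hd, sup_bot_eq]
  refine ⟨U₁, T ⊔ Q, hU₁, ?_, by rw [hi, hTf]⟩
  have := Submodule.finrank_sup_add_finrank_inf_eq T Q
  rw [(hS.disjoint.mono hT hQ).eq_bot, finrank_bot] at this
  omega

end LinearAlgebra

section Descent

variable {F V : Type*} [Field F] [AddCommGroup V] [Module F V]

theorem exists_mem_notMem_and_functional [FiniteDimensional F V] {X Y S : Submodule F V}
    (hXY : Disjoint X Y) (hX : 2 ≤ finrank F X) {p : V} (hp : p ∉ Y) (hS : ¬ X ≤ S) :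
    ∃ x ∈ X, x ∉ S ∧ ∃ φ : Dual F V, Y ≤ LinearMap.ker φ ∧ φ x = 0 ∧ φ p ≠ 0 := by
  suffices h : ∃ x ∈ X, x ∉ S ∧ p ∉ Y ⊔ F ∙ x by
    obtain ⟨x, hx, hxS, hpx⟩ := h
    obtain ⟨φ, hφ, hle⟩ := Submodule.exists_le_ker_of_notMem hpx
    exact ⟨x, hx, hxS, φ, le_sup_left.trans hle,
      hle (Submodule.mem_sup_right (Submodule.mem_span_singleton_self x)), hφ⟩
  by_contra! H
  obtain ⟨x, hx, hxS⟩ := SetLike.not_le_iff_exists.1 hS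
  have hlt : ¬ X ≤ F ∙ x := fun h => by
    have h1 := Submodule.finrank_mono h
    have h2 := finrank_span_le_card (R := F) ({x} : Set V)
    simp at h2
    omega
  obtain ⟨z, hz, hzx⟩ := SetLike.not_le_iff_exists.1 hlt
  obtain ⟨w, hw, hwS, hwx⟩ : ∃ w ∈ X, w ∉ S ∧ w ∉ F ∙ x := by
    by_cases hzS : z ∈ S
    · refine ⟨z + x, X.add_mem hz hx, fun h => hxS ?_, fun h => hzx ?_⟩
      · simpa using S.sub_mem h hzS
      · simpa using Submodule.sub_mem _ h (Submodule.mem_span_singleton_self x)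
    · exact ⟨z, hz, hzS, hzx⟩
  obtain ⟨y, hy, a, ha, hya⟩ := Submodule.mem_sup.1 (H x hx hxS)
  obtain ⟨y', hy', b, hb, hyb⟩ := Submodule.mem_sup.1 (H w hw hwS)
  obtain ⟨c, rfl⟩ := Submodule.mem_span_singleton.1 ha
  obtain ⟨d, rfl⟩ := Submodule.mem_span_singleton.1 hb
  have heq : d • w = c • x := by
    have h1 : d • w - c • x = y - y' := by
      rw [sub_eq_sub_iff_add_eq_add, hya, add_comm, hyb]
    have h2 : d • w - c • x ∈ X := X.sub_mem (X.smul_mem _ hw) (X.smul_mem _ hx)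
    have h3 : d • w - c • x ∈ Y := h1 ▸ Y.sub_mem hy hy'
    exact sub_eq_zero.1 (Submodule.disjoint_def.1 hXY _ h2 h3)
  have hd : d ≠ 0 := by
    rintro rfl
    apply hp
    rw [← hyb]
    simpa using hy'
  exact hwx (Submodule.mem_span_singleton.2 ⟨d⁻¹ * c, by rw [mul_smul, ← heq, inv_smul_smul₀ hd]⟩)

theorem inf_map_transvection {U₁ U₂ : Submodule F V} {φ : Dual F V} {x : V} (hφ : φ x = 0)
    (hx : x ∉ U₁ ⊔ U₂) :
    U₁ ⊓ U₂.map (LinearEquiv.transvection hφ : V →ₗ[F] V) = U₁ ⊓ U₂ ⊓ LinearMap.ker φ := by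
  ext v
  simp only [Submodule.mem_inf, Submodule.mem_map, LinearEquiv.coe_coe, LinearMap.mem_ker,
    LinearEquiv.transvection.apply]
  constructor
  · rintro ⟨hv, u, hu, rfl⟩
    have h0 : φ u = 0 := by
      by_contra h
      refine hx ((Submodule.smul_mem_iff _ h).1 ?_)
      have : φ u • x = (u + φ u • x) - u := by abel
      rw [this]
      exact Submodule.sub_mem _ (Submodule.mem_sup_left hv) (Submodule.mem_sup_right hu)
    rw [h0, zero_smul, add_zero] at hv ⊢
    exact ⟨⟨hv, hu⟩, h0⟩
  · rintro ⟨⟨h1, h2⟩, h3⟩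
    exact ⟨h1, v, h2, by simp [h3]⟩

theorem map_transvection_eq_self_of_mem {X : Submodule F V} {φ : Dual F V} {x : V}
    (hφ : φ x = 0) (hx : x ∈ X) :
    X.map (LinearEquiv.transvection hφ : V →ₗ[F] V) = X := by
  ext v
  simp only [Submodule.mem_map, LinearEquiv.coe_coe, LinearEquiv.transvection.apply]
  constructor
  · rintro ⟨u, hu, rfl⟩
    exact X.add_mem hu (X.smul_mem _ hx)
  · intro hv
    exact ⟨v - φ v • x, X.sub_mem hv (X.smul_mem _ hx), by simp [hφ]⟩

theorem map_transvection_eq_self_of_le_ker {Y : Submodule F V} {φ : Dual F V} {x : V}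
    (hφ : φ x = 0) (hY : Y ≤ LinearMap.ker φ) :
    Y.map (LinearEquiv.transvection hφ : V →ₗ[F] V) = Y := by
  ext v
  simp only [Submodule.mem_map, LinearEquiv.coe_coe, LinearEquiv.transvection.apply]
  constructor
  · rintro ⟨u, hu, rfl⟩
    simpa [LinearMap.mem_ker.1 (hY hu)] using hu
  · intro hv
    exact ⟨v, hv, by simp [LinearMap.mem_ker.1 (hY hv)]⟩

theorem finrank_inf_ker_add_one [FiniteDimensional F V] {T : Submodule F V} {φ : Dual F V} {p : V}
    (hp : p ∈ T)
    (hφ : φ p ≠ 0) : finrank F ↥(T ⊓ LinearMap.ker φ) + 1 = finrank F T := by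
  have hne : φ.domRestrict T ≠ 0 := fun h => hφ (by simpa using LinearMap.congr_fun h ⟨p, hp⟩)
  have h1 := Dual.finrank_ker_add_one_of_ne_zero hne
  have h2 : LinearMap.ker (φ.domRestrict T) = (T ⊓ LinearMap.ker φ).comap T.subtype := by
    ext v
    simp
  rwa [h2, (Submodule.comapSubtypeEquivOfLe inf_le_left).finrank_eq] at h1

/-- The stabilizer of the ordered pair `(X, Y)` moves `U₂` so as to lower `dim (U₁ ∩ U₂)` by one. -/
def Descends (X Y U₁ U₂ : Submodule F V) : Prop :=
  ∃ e : V ≃ₗ[F] V, X.map (e : V →ₗ[F] V) = X ∧ Y.map (e : V →ₗ[F] V) = Y ∧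
    finrank F ↥(U₁ ⊓ U₂.map (e : V →ₗ[F] V)) + 1 = finrank F ↥(U₁ ⊓ U₂)

theorem Descends.swap {X Y U₁ U₂ : Submodule F V} (h : Descends X Y U₁ U₂) :
    Descends Y X U₁ U₂ :=
  let ⟨e, hX, hY, he⟩ := h
  ⟨e, hY, hX, he⟩

variable [FiniteDimensional F V]

theorem descends_of_not_le {X Y U₁ U₂ : Submodule F V} (hXY : Disjoint X Y)
    (hX : 2 ≤ finrank F X) (hT : ¬ U₁ ⊓ U₂ ≤ Y) (hS : ¬ X ≤ U₁ ⊔ U₂) :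
    Descends X Y U₁ U₂ := by
  obtain ⟨p, hp, hpY⟩ := SetLike.not_le_iff_exists.1 hT
  obtain ⟨x, hx, hxS, φ, hY, hφx, hφp⟩ := exists_mem_notMem_and_functional hXY hX hpY hS
  refine ⟨LinearEquiv.transvection hφx, map_transvection_eq_self_of_mem hφx hx,
    map_transvection_eq_self_of_le_ker hφx hY, ?_⟩
  rw [inf_map_transvection hφx hxS]
  exact finrank_inf_ker_add_one hp hφp

theorem descends_of_inf_le_of_le_sup {X Y U₁ U₂ : Submodule F V} (hXY : IsCompl X Y)
    (hX : 2 ≤ finrank F X) (hY : 2 ≤ finrank F Y) (hT : U₁ ⊓ U₂ ≠ ⊥) (hS : U₁ ⊔ U₂ ≠ ⊤)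
    (hTY : U₁ ⊓ U₂ ≤ Y) (hYS : Y ≤ U₁ ⊔ U₂) (hY' : ¬ Y ≤ U₁ ⊓ Y ⊔ U₂ ⊓ Y) :
    Descends X Y U₁ U₂ := by
  have hXS : ¬ X ≤ U₁ ⊔ U₂ := fun h =>
    hS (top_le_iff.1 (hXY.sup_eq_top.symm.trans_le (sup_le h hYS)))
  obtain ⟨y, hy, hyn⟩ := SetLike.not_le_iff_exists.1 hY'
  obtain ⟨u₁, hu₁, u₂, hu₂, rfl⟩ := Submodule.mem_sup.1 (hYS hy)
  have hu₂Y : u₂ ∉ Y := fun h => hyn (Submodule.add_mem_sup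
    ⟨hu₁, by simpa using Y.sub_mem hy h⟩ ⟨hu₂, h⟩)
  obtain ⟨x, hx, hxS, φ, hYφ, hφx, hφu⟩ :=
    exists_mem_notMem_and_functional hXY.disjoint hX hu₂Y hXS
  set h := LinearEquiv.transvection hφx with hh
  have hinf : U₁ ⊓ U₂.map (h : V →ₗ[F] V) = U₁ ⊓ U₂ := by
    rw [inf_map_transvection hφx hxS, inf_eq_left]
    exact hTY.trans hYφ
  have hT' : ¬ U₁ ⊓ U₂.map (h : V →ₗ[F] V) ≤ X := by
    rw [hinf]
    exact fun hTX => hT (le_bot_iff.1 (hXY.disjoint hTX hTY))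
  have hS' : ¬ Y ≤ U₁ ⊔ U₂.map (h : V →ₗ[F] V) := by
    intro hle
    obtain ⟨v₁, hv₁, w, ⟨u, hu, rfl⟩, hw⟩ := Submodule.mem_sup.1 (hle hy)
    rw [LinearEquiv.coe_coe, LinearEquiv.transvection.apply] at hw
    have h0 : φ u = 0 := by
      by_contra hne
      refine hxS ((Submodule.smul_mem_iff _ hne).1 ?_)
      have : φ u • x = (u₁ - v₁) + (u₂ - u) := by
        rw [← sub_eq_zero]
        have := sub_eq_zero.2 hw
        rw [← this]
        abel
      rw [this]
      exact Submodule.add_mem_sup (U₁.sub_mem hu₁ hv₁) (U₂.sub_mem hu₂ hu)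
    rw [h0, zero_smul, add_zero] at hw
    have h1 : u₂ - u = v₁ - u₁ := by
      rw [sub_eq_sub_iff_add_eq_add, hw, add_comm]
    have h2 : u₂ - u ∈ U₁ ⊓ U₂ := ⟨h1 ▸ U₁.sub_mem hv₁ hu₁, U₂.sub_mem hu₂ hu⟩
    have h3 : φ (u₂ - u) = 0 := hYφ (hTY h2)
    rw [map_sub, h0, sub_zero] at h3
    exact hφu h3
  obtain ⟨e, heY, heX, he⟩ := descends_of_not_le hXY.disjoint.symm hY hT' hS'
  refine ⟨h ≪≫ₗ e, ?_, ?_, ?_⟩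
  · rw [LinearEquiv.coe_trans, Submodule.map_comp, map_transvection_eq_self_of_mem hφx hx, heX]
  · rw [LinearEquiv.coe_trans, Submodule.map_comp, map_transvection_eq_self_of_le_ker hφx hYφ, heY]
  · rw [LinearEquiv.coe_trans, Submodule.map_comp, he, hinf]

theorem descends_of_ne {X Y U₁ U₂ : Submodule F V} (hXY : IsCompl X Y)
    (hX : 2 ≤ finrank F X) (hY : 2 ≤ finrank F Y) (hT : U₁ ⊓ U₂ ≠ ⊥) (hS : U₁ ⊔ U₂ ≠ ⊤)
    (hX' : U₁ ⊓ U₂ ≤ X → ¬ X ≤ U₁ ⊓ X ⊔ U₂ ⊓ X) (hY' : U₁ ⊓ U₂ ≤ Y → ¬ Y ≤ U₁ ⊓ Y ⊔ U₂ ⊓ Y) :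
    Descends X Y U₁ U₂ := by
  by_cases hTY : U₁ ⊓ U₂ ≤ Y
  · by_cases hYS : Y ≤ U₁ ⊔ U₂
    · exact descends_of_inf_le_of_le_sup hXY hX hY hT hS hTY hYS (hY' hTY)
    · refine (descends_of_not_le hXY.disjoint.symm hY (fun hTX => hT ?_) hYS).swap
      exact le_bot_iff.1 (hXY.disjoint hTX hTY)
  by_cases hXS : X ≤ U₁ ⊔ U₂
  · by_cases hTX : U₁ ⊓ U₂ ≤ X
    · exact (descends_of_inf_le_of_le_sup hXY.symm hY hX hT hS hTX hXS (hX' hTX)).swap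
    · refine (descends_of_not_le hXY.disjoint.symm hY hTX fun hYS => hS ?_).swap
      exact top_le_iff.1 (hXY.sup_eq_top.symm.trans_le (sup_le hXS hYS))
  · exact descends_of_not_le hXY.disjoint hX hTY hXS

/-- Dimension types relative to a fixed decomposition are preserved while the dimension of the
intersection of the two subspaces is lowered down to the bound `t`. -/
theorem exists_pair_of_type {X Y U₁ U₂ : Submodule F V} (hXY : IsCompl X Y)
    (hX : 2 ≤ finrank F X) (hY : 2 ≤ finrank F Y) {t : ℕ}
    (hle : t ≤ finrank F ↥(U₁ ⊓ U₂))
    (hm : finrank F U₁ + finrank F U₂ ≤ finrank F V + t)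
    (htX : finrank F ↥(U₁ ⊓ X) + finrank F ↥(U₂ ⊓ X) ≤ finrank F X + t)
    (htY : finrank F ↥(U₁ ⊓ Y) + finrank F ↥(U₂ ⊓ Y) ≤ finrank F Y + t) :
    ∃ U : Submodule F V, finrank F U = finrank F U₂ ∧
      finrank F ↥(U ⊓ X) = finrank F ↥(U₂ ⊓ X) ∧ finrank F ↥(U ⊓ Y) = finrank F ↥(U₂ ⊓ Y) ∧
      finrank F ↥(U₁ ⊓ U) = t := by
  induction hs : finrank F ↥(U₁ ⊓ U₂) - t generalizing U₂ with
  | zero => exact ⟨U₂, rfl, rfl, rfl, by omega⟩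
  | succ n ih =>
    have hd : ∀ {Z : Submodule F V},
        finrank F ↥(U₁ ⊓ Z) + finrank F ↥(U₂ ⊓ Z) ≤ finrank F Z + t →
        U₁ ⊓ U₂ ≤ Z → ¬ Z ≤ U₁ ⊓ Z ⊔ U₂ ⊓ Z := by
      intro Z hZ hTZ hle'
      have h1 := Submodule.finrank_sup_add_finrank_inf_eq (U₁ ⊓ Z) (U₂ ⊓ Z)
      rw [le_antisymm (sup_le inf_le_right inf_le_right) hle', ← inf_inf_distrib_right,
        inf_eq_left.2 hTZ] at h1
      omega
    obtain ⟨e, heX, heY, he⟩ := descends_of_ne (U₁ := U₁) (U₂ := U₂) hXY hX hY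
      (fun h => by rw [h, finrank_bot] at hs; omega)
      (fun h => by
        have h1 := Submodule.finrank_sup_add_finrank_inf_eq U₁ U₂
        rw [h, finrank_top] at h1
        omega) (hd htX) (hd htY)
    have h2 : finrank F ↥(U₂.map (e : V →ₗ[F] V)) = finrank F U₂ := e.finrank_map_eq U₂
    have h2X := finrank_inf_map_equiv e U₂ X
    have h2Y := finrank_inf_map_equiv e U₂ Y
    rw [heX] at h2X
    rw [heY] at h2Y
    obtain ⟨U, hU, hUX, hUY, hUt⟩ := ih (U₂ := U₂.map (e : V →ₗ[F] V)) (by omega) (by omega)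
      (by omega) (by omega) (by omega)
    exact ⟨U, hU.trans h2, hUX.trans h2X, hUY.trans h2Y, hUt⟩

end Descent

section Model

variable (F : Type*) [Field F]

theorem finrank_pi_submodule {F : Type*} [Field F] {ι : Type*} [Fintype ι] {M : Type*}
    [AddCommGroup M] [Module F M] [FiniteDimensional F M] (L : ι → Submodule F M) :
    finrank F ↥(Submodule.pi Set.univ L) = ∑ i, finrank F (L i) := by
  rw [← finrank_pi_fintype F]
  refine LinearEquiv.finrank_eq
    { toFun := fun x i => ⟨x.1 i, x.2 i trivial⟩
      invFun := fun x => ⟨fun i => x i, fun i _ => (x i).2⟩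
      map_add' := fun _ _ => rfl
      map_smul' := fun _ _ => rfl
      left_inv := fun _ => rfl
      right_inv := fun _ => rfl }

theorem pi_inf_pi {F : Type*} [Field F] {ι : Type*} {M : Type*}
    [AddCommGroup M] [Module F M] (L L' : ι → Submodule F M) :
    Submodule.pi Set.univ L ⊓ Submodule.pi Set.univ L' =
      Submodule.pi Set.univ fun i => L i ⊓ L' i := by
  ext x
  simp [Submodule.mem_pi, forall_and]

theorem finrank_span_pair_fst : finrank F ↥(F ∙ ((1, 0) : F × F)) = 1 :=
  finrank_span_singleton (by simp)

theorem finrank_span_pair_snd : finrank F ↥(F ∙ ((0, 1) : F × F)) = 1 :=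
  finrank_span_singleton (by simp)

theorem finrank_span_pair_diag : finrank F ↥(F ∙ ((1, 1) : F × F)) = 1 :=
  finrank_span_singleton (by simp)

theorem span_inf_span_eq_bot {a b : F × F} (h : a.1 * b.2 - a.2 * b.1 ≠ 0) :
    (F ∙ a) ⊓ (F ∙ b) = ⊥ := by
  rw [eq_bot_iff]
  rintro x ⟨hx, hx'⟩
  obtain ⟨c, rfl⟩ := Submodule.mem_span_singleton.1 hx
  obtain ⟨d, hd⟩ := Submodule.mem_span_singleton.1 hx'
  have h1 : d * b.1 = c * a.1 := congrArg Prod.fst hd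
  have h2 : d * b.2 = c * a.2 := congrArg Prod.snd hd
  have h3 : c * (a.1 * b.2 - a.2 * b.1) = 0 := by linear_combination -b.2 * h1 + b.1 * h2
  rcases mul_eq_zero.1 h3 with rfl | h3
  · simp
  · exact absurd h3 h

theorem sum_fin_indicator {k : ℕ} (a b : ℕ) (hb : b ≤ k) :
    ∑ i : Fin k, (if a ≤ (i : ℕ) ∧ (i : ℕ) < b then 1 else 0) = b - a := by
  rw [Fin.sum_univ_eq_sum_range (fun i => if a ≤ i ∧ i < b then 1 else 0), Finset.sum_boole]
  have : (Finset.range k).filter (fun i => a ≤ i ∧ i < b) = Finset.Ico a b := by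
    ext i
    simp only [Finset.mem_filter, Finset.mem_range, Finset.mem_Ico]
    omega
  rw [this]
  simp

/-- The dimension of a product of subspaces that is constant on four consecutive blocks of indices,
with the zero subspace on the last block. -/
theorem finrank_pi_eq_of_blocks {F : Type*} [Field F] {M : Type*} [AddCommGroup M] [Module F M]
    [FiniteDimensional F M] {k a b c : ℕ} (hab : a ≤ b) (hbc : b ≤ c) (hck : c ≤ k)
    (G : Fin k → Submodule F M) (P Q R : Submodule F M)
    (h : ∀ i : Fin k, G i = if (i : ℕ) < a then P else if (i : ℕ) < b then Q else
      if (i : ℕ) < c then R else ⊥) :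
    finrank F ↥(Submodule.pi Set.univ G) =
      finrank F P * a + finrank F Q * (b - a) + finrank F R * (c - b) := by
  have hG : ∀ i : Fin k, finrank F (G i) =
      finrank F P * (if 0 ≤ (i : ℕ) ∧ (i : ℕ) < a then 1 else 0) +
      finrank F Q * (if a ≤ (i : ℕ) ∧ (i : ℕ) < b then 1 else 0) +
      finrank F R * (if b ≤ (i : ℕ) ∧ (i : ℕ) < c then 1 else 0) := by
    intro i
    by_cases h₁ : (i : ℕ) < a
    · rw [h i, if_pos h₁, if_pos (by omega), if_neg (by omega), if_neg (by omega)]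
      ring
    by_cases h₂ : (i : ℕ) < b
    · rw [h i, if_neg h₁, if_pos h₂, if_neg (by omega), if_pos (by omega), if_neg (by omega)]
      ring
    by_cases h₃ : (i : ℕ) < c
    · rw [h i, if_neg h₁, if_neg h₂, if_pos h₃, if_neg (by omega), if_neg (by omega),
        if_pos (by omega)]
      ring
    · rw [h i, if_neg h₁, if_neg h₂, if_neg h₃, if_neg (by omega), if_neg (by omega),
        if_neg (by omega), finrank_bot]
      simp
  rw [finrank_pi_submodule, Finset.sum_congr rfl fun i _ => hG i, Finset.sum_add_distrib,
    Finset.sum_add_distrib, ← Finset.mul_sum, ← Finset.mul_sum, ← Finset.mul_sum,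
    sum_fin_indicator 0 a (by omega), sum_fin_indicator a b (by omega), sum_fin_indicator b c hck,
    Nat.sub_zero]

/-- A pair of subspaces of types `(k₁, k₂)` and `(k₂, k₁)` with respect to a bisection whose
intersection is as large as possible. -/
theorem exists_opposite_pair {k m k₁ k₂ : ℕ} (h₁₂ : k₁ ≤ k₂) (hlow : k₁ + k₂ ≤ m)
    (hhigh : m ≤ k + k₁) :
    ∃ X Y U₁ U₂ : Submodule F (Fin k → F × F), IsCompl X Y ∧ finrank F X = k ∧ finrank F Y = k ∧
      finrank F U₁ = m ∧ finrank F U₂ = m ∧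
      finrank F ↥(U₁ ⊓ X) = k₁ ∧ finrank F ↥(U₁ ⊓ Y) = k₂ ∧
      finrank F ↥(U₂ ⊓ X) = k₂ ∧ finrank F ↥(U₂ ⊓ Y) = k₁ ∧
      finrank F ↥(U₁ ⊓ U₂) + k₂ = m + k₁ := by
  let E₁ : Submodule F (F × F) := F ∙ (1, 0)
  let E₂ : Submodule F (F × F) := F ∙ (0, 1)
  let D : Submodule F (F × F) := F ∙ (1, 1)
  have f₁ : finrank F E₁ = 1 := finrank_span_pair_fst F
  have f₂ : finrank F E₂ = 1 := finrank_span_pair_snd F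
  have fD : finrank F D = 1 := finrank_span_pair_diag F
  have i₁₂ : E₁ ⊓ E₂ = ⊥ := span_inf_span_eq_bot F (by simp)
  have i₂₁ : E₂ ⊓ E₁ = ⊥ := by rw [inf_comm, i₁₂]
  have iD₁ : D ⊓ E₁ = ⊥ := span_inf_span_eq_bot F (by simp)
  have iD₂ : D ⊓ E₂ = ⊥ := span_inf_span_eq_bot F (by simp)
  have fT : finrank F (F × F) = 2 := by simp
  let L : Submodule F (F × F) → Fin k → Submodule F (F × F) := fun E i =>
    if (i : ℕ) < k₁ then ⊤ else if (i : ℕ) < k₂ then E else if (i : ℕ) < m - k₁ then D else ⊥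
  have hX : finrank F ↥(Submodule.pi Set.univ fun _ : Fin k => E₁) = k := by
    simp [finrank_pi_submodule, f₁]
  have hY : finrank F ↥(Submodule.pi Set.univ fun _ : Fin k => E₂) = k := by
    simp [finrank_pi_submodule, f₂]
  have hinf : (Submodule.pi Set.univ fun _ : Fin k => E₁) ⊓
      (Submodule.pi Set.univ fun _ : Fin k => E₂) = ⊥ := by
    rw [pi_inf_pi, i₁₂, Submodule.pi_univ_bot]
  have key := finrank_pi_eq_of_blocks (F := F) (M := F × F) h₁₂ (c := m - k₁) (by omega)
    (show m - k₁ ≤ k by omega)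
  refine ⟨.pi Set.univ fun _ => E₁, .pi Set.univ fun _ => E₂, .pi Set.univ (L E₂),
    .pi Set.univ (L E₁), ?_, hX, hY, ?_, ?_, ?_, ?_, ?_, ?_, ?_⟩
  · refine ⟨disjoint_iff.2 hinf, codisjoint_iff.2 (Submodule.eq_top_of_finrank_eq ?_)⟩
    have := Submodule.finrank_sup_add_finrank_inf_eq
      (Submodule.pi Set.univ fun _ : Fin k => E₁) (Submodule.pi Set.univ fun _ : Fin k => E₂)
    rw [hinf, finrank_bot, hX, hY] at this
    simp [finrank_pi_fintype]
    omega
  · rw [key _ ⊤ E₂ D]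
    · rw [f₂, fD, finrank_top, fT]
      omega
    exact fun _ => rfl
  · rw [key _ ⊤ E₁ D]
    · rw [f₁, fD, finrank_top, fT]
      omega
    exact fun _ => rfl
  · rw [pi_inf_pi, key _ E₁ ⊥ ⊥]
    · rw [f₁, finrank_bot]
      omega
    intro i
    dsimp only [L]
    split_ifs <;> simp [*]
  · rw [pi_inf_pi, key _ E₂ E₂ ⊥]
    · rw [f₂, finrank_bot]
      omega
    intro i
    dsimp only [L]
    split_ifs <;> simp [*]
  · rw [pi_inf_pi, key _ E₁ E₁ ⊥]
    · rw [f₁, finrank_bot]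
      omega
    intro i
    dsimp only [L]
    split_ifs <;> simp [*]
  · rw [pi_inf_pi, key _ E₂ ⊥ ⊥]
    · rw [f₂, finrank_bot]
      omega
    intro i
    dsimp only [L]
    split_ifs <;> simp [*]
  · rw [pi_inf_pi, key _ ⊤ ⊥ D]
    · rw [fD, finrank_top, fT, finrank_bot]
      omega
    intro i
    dsimp only [L]
    split_ifs <;> simp [*]

end Model

section CollinearCompleteness

variable {F V : Type*} [Field F] [AddCommGroup V] [Module F V] [FiniteDimensional F V]

theorem exists_bisection_of_model {W : Type*} [AddCommGroup W] [Module F W] [FiniteDimensional F W]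
    {X Y A B : Submodule F W} {U₁ U₂ : Submodule F V} {k k₁ k₂ : ℕ}
    (hVW : finrank F W = finrank F V) (hXY : IsCompl X Y) (hX : finrank F X = k)
    (hY : finrank F Y = k) (hA : finrank F A = finrank F U₁) (hB : finrank F B = finrank F U₂)
    (hAB : finrank F ↥(A ⊓ B) = finrank F ↥(U₁ ⊓ U₂))
    (hAi : Incident k₁ k₂ A X Y) (hBi : Incident k₁ k₂ B X Y) :
    ∃ V₁ V₂ : Submodule F V, IsBisection k V₁ V₂ ∧
      Incident k₁ k₂ U₁ V₁ V₂ ∧ Incident k₁ k₂ U₂ V₁ V₂ := by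
  obtain ⟨e, rfl, rfl⟩ := exists_linearEquiv_map_pair_eq hVW hA hB hAB
  refine ⟨X.map (e : W →ₗ[F] V), Y.map (e : W →ₗ[F] V), ⟨?_, ?_, ?_, ?_⟩, ?_, ?_⟩
  · exact (e.finrank_map_eq X).trans hX
  · exact (e.finrank_map_eq Y).trans hY
  · rw [← Submodule.map_inf _ e.injective, hXY.inf_eq_bot, Submodule.map_bot]
  · rw [← Submodule.map_sup, hXY.sup_eq_top, Submodule.map_top, LinearEquiv.range]
  · simpa only [Incident, finrank_inf_map_equiv] using hAi
  · simpa only [Incident, finrank_inf_map_equiv] using hBi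

theorem exists_bisection_of_two_le {k m k₁ k₂ : ℕ} (hk : 2 ≤ k) (hV : finrank F V = 2 * k)
    (hk₁₂ : k₁ ≤ k₂) (hmlow : k₁ + k₂ ≤ m) (hmhigh : m ≤ k + k₁)
    (h : 3 * k₂ ≤ k + 1 + m + k₁) {U₁ U₂ : Submodule F V} (hU₁ : finrank F U₁ = m)
    (hU₂ : finrank F U₂ = m) :
    ∃ V₁ V₂ : Submodule F V, IsBisection k V₁ V₂ ∧
      Incident k₁ k₂ U₁ V₁ V₂ ∧ Incident k₁ k₂ U₂ V₁ V₂ := by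
  obtain ⟨X, Y, A, B, hXY, hX, hY, hA, hB, hAX, hAY, hBX, hBY, hAB⟩ :=
    exists_opposite_pair F hk₁₂ hmlow hmhigh
  have hW : finrank F (Fin k → F × F) = 2 * k := by
    simp [finrank_pi_fintype, mul_comm]
  have hsup := Submodule.finrank_sup_add_finrank_inf_eq U₁ U₂
  have hle := Submodule.finrank_le (U₁ ⊔ U₂)
  have hle' := Submodule.finrank_mono (inf_le_left : U₁ ⊓ U₂ ≤ U₁)
  by_cases ht : 2 * k₂ ≤ k + finrank F ↥(U₁ ⊓ U₂)
  · obtain ⟨U, hU, hUX, hUY, hUt⟩ := exists_pair_of_type (U₁ := A) (U₂ := A) hXY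
      (by omega) (by omega) (t := finrank F ↥(U₁ ⊓ U₂)) (by rw [inf_idem]; omega) (by omega)
      (by omega) (by omega)
    exact exists_bisection_of_model (by omega) hXY hX hY (by omega) (by omega) hUt
      (.inl ⟨hAX, hAY⟩) (.inl ⟨by omega, by omega⟩)
  · obtain ⟨U, hU, hUX, hUY, hUt⟩ := exists_pair_of_type (U₁ := A) (U₂ := B) hXY
      (by omega) (by omega) (t := finrank F ↥(U₁ ⊓ U₂)) (by omega) (by omega)
      (by omega) (by omega)
    exact exists_bisection_of_model (by omega) hXY hX hY (by omega) (by omega) hUt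
      (.inl ⟨hAX, hAY⟩) (.inr ⟨by omega, by omega⟩)

theorem finrank_inf_add_finrank_inf_le (U₁ U₂ Z : Submodule F V) :
    finrank F ↥(U₁ ⊓ Z) + finrank F ↥(U₂ ⊓ Z) ≤ finrank F Z + finrank F ↥(U₁ ⊓ U₂ ⊓ Z) := by
  rw [← Submodule.finrank_sup_add_finrank_inf_eq, ← inf_inf_distrib_right]
  gcongr
  exact Submodule.finrank_mono (sup_le inf_le_right inf_le_right)

theorem finrank_inf_add_finrank_inf_le' (U₁ U₂ Z : Submodule F V) :
    finrank F ↥(U₁ ⊓ U₂) + finrank F ↥(U₁ ⊓ Z) ≤ finrank F U₁ + finrank F ↥(U₂ ⊓ Z) := by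
  rw [← Submodule.finrank_sup_add_finrank_inf_eq]
  gcongr
  · exact Submodule.finrank_mono (sup_le inf_le_left inf_le_left)
  · exact Submodule.finrank_mono (le_inf (inf_le_left.trans inf_le_right)
      (inf_le_right.trans inf_le_right))

theorem le_of_collinearlyComplete {k m k₁ k₂ : ℕ} (hV : finrank F V = 2 * k)
    (hk₂ : k₂ ≤ k) (hmlow : k₁ + k₂ ≤ m) (hmhigh : m ≤ k + k₁)
    (h : CollinearlyComplete F V m k k₁ k₂) : 3 * k₂ ≤ k + 1 + m + k₁ := by
  by_contra hlt
  obtain ⟨U₁, U₂, hU₁, hU₂, ht⟩ := exists_pair_finrank_eq (F := F) (V := V) (m := m)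
    (t := m + k₁ + 1 - k₂) (by omega) (by omega)
  obtain ⟨V₁, V₂, ⟨hV₁, hV₂, -, -⟩, h₁, h₂⟩ := h U₁ U₂ hU₁ hU₂ (by
    rintro rfl
    rw [inf_idem] at ht
    omega)
  have a₁ := finrank_inf_add_finrank_inf_le U₁ U₂ V₁
  have a₂ := finrank_inf_add_finrank_inf_le U₁ U₂ V₂
  have b₁ := Submodule.finrank_mono (inf_le_left : U₁ ⊓ U₂ ⊓ V₁ ≤ U₁ ⊓ U₂)
  have b₂ := Submodule.finrank_mono (inf_le_left : U₁ ⊓ U₂ ⊓ V₂ ≤ U₁ ⊓ U₂)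
  have c₁ := finrank_inf_add_finrank_inf_le' U₁ U₂ V₁
  have c₂ := finrank_inf_add_finrank_inf_le' U₁ U₂ V₂
  rcases h₁ with h₁ | h₁ <;> rcases h₂ with h₂ | h₂ <;> omega

theorem isCompl_of_finrank_eq_one (hV : finrank F V = 2) {U₁ U₂ : Submodule F V}
    (h₁ : finrank F U₁ = 1) (h₂ : finrank F U₂ = 1) (hne : U₁ ≠ U₂) : IsCompl U₁ U₂ := by
  have h := Submodule.finrank_sup_add_finrank_inf_eq U₁ U₂
  have hle := Submodule.finrank_mono (inf_le_left : U₁ ⊓ U₂ ≤ U₁)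
  have h0 : finrank F ↥(U₁ ⊓ U₂) = 0 := by
    by_contra hpos
    have e₁ := Submodule.eq_of_le_of_finrank_eq (inf_le_left : U₁ ⊓ U₂ ≤ U₁) (by omega)
    have e₂ := Submodule.eq_of_le_of_finrank_eq (inf_le_right : U₁ ⊓ U₂ ≤ U₂) (by omega)
    exact hne (e₁.symm.trans e₂)
  exact ⟨disjoint_iff.2 (Submodule.finrank_eq_zero.1 h0),
    codisjoint_iff.2 (Submodule.eq_top_of_finrank_eq (by omega))⟩

theorem exists_generator_pair (hV : finrank F V = 2) {U₁ U₂ : Submodule F V}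
    (h₁ : finrank F U₁ = 1) (h₂ : finrank F U₂ = 1) (hne : U₁ ≠ U₂) :
    ∃ u w : V, U₁ = F ∙ u ∧ U₂ = F ∙ w ∧ (∀ a b : F, a • u + b • w = 0 → a = 0 ∧ b = 0) ∧
      ∀ v : V, ∃ a b : F, a • u + b • w = v := by
  have hc := isCompl_of_finrank_eq_one hV h₁ h₂ hne
  obtain ⟨u, hu, hU₁⟩ := finrank_eq_one_iff'.1 h₁
  obtain ⟨w, hw, hU₂⟩ := finrank_eq_one_iff'.1 h₂
  have hu0 : (u : V) ≠ 0 := by simpa using hu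
  have hw0 : (w : V) ≠ 0 := by simpa using hw
  refine ⟨u, w, ?_, ?_, ?_, ?_⟩
  · refine le_antisymm (fun x hx => ?_) ((Submodule.span_singleton_le_iff_mem _ _).2 u.2)
    obtain ⟨c, hc⟩ := hU₁ ⟨x, hx⟩
    exact Submodule.mem_span_singleton.2 ⟨c, congrArg Subtype.val hc⟩
  · refine le_antisymm (fun x hx => ?_) ((Submodule.span_singleton_le_iff_mem _ _).2 w.2)
    obtain ⟨c, hc⟩ := hU₂ ⟨x, hx⟩
    exact Submodule.mem_span_singleton.2 ⟨c, congrArg Subtype.val hc⟩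
  · intro a b hab
    have hau : a • (u : V) = 0 := by
      refine Submodule.disjoint_def.1 hc.disjoint _ (U₁.smul_mem _ u.2) ?_
      rw [eq_neg_of_add_eq_zero_left hab]
      exact U₂.neg_mem (U₂.smul_mem _ w.2)
    rw [hau, zero_add] at hab
    exact ⟨(smul_eq_zero.1 hau).resolve_right hu0, (smul_eq_zero.1 hab).resolve_right hw0⟩
  · intro v
    obtain ⟨x, hx, y, hy, rfl⟩ := Submodule.mem_sup.1 (hc.sup_eq_top ▸ Submodule.mem_top (x := v))
    obtain ⟨a, ha⟩ := hU₁ ⟨x, hx⟩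
    obtain ⟨b, hb⟩ := hU₂ ⟨y, hy⟩
    exact ⟨a, b, congrArg₂ (· + ·) (congrArg Subtype.val ha) (congrArg Subtype.val hb)⟩

theorem not_collinearlyComplete_of_card_eq_two [Fintype F] (hq : Fintype.card F = 2)
    (hV : finrank F V = 2) : ¬ CollinearlyComplete F V 1 1 0 0 := by
  intro h
  obtain ⟨U₁, U₂, h₁, h₂, h₁₂⟩ := exists_pair_finrank_eq (F := F) (V := V) (m := 1) (t := 0)
    (by omega) (by omega)
  have hne : U₁ ≠ U₂ := by
    rintro rfl
    rw [inf_idem] at h₁₂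
    omega
  have hF : ∀ a : F, a ≠ 0 → a = 1 := by
    intro a ha
    by_contra ha'
    classical
    have : ({0, 1, a} : Finset F).card = 3 := by
      rw [Finset.card_eq_three]
      exact ⟨0, 1, a, zero_ne_one, ha.symm, Ne.symm ha', rfl⟩
    have := Finset.card_le_univ ({0, 1, a} : Finset F)
    omega
  obtain ⟨u, w, rfl, rfl, -, hgen⟩ := exists_generator_pair hV h₁ h₂ hne
  obtain ⟨V₁, V₂, ⟨hV₁, hV₂, hinf, -⟩, hi₁, hi₂⟩ := h _ _ h₁ h₂ hne
  have key : ∀ Z : Submodule F V, finrank F Z = 1 → finrank F ↥((F ∙ u) ⊓ Z) = 0 →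
      finrank F ↥((F ∙ w) ⊓ Z) = 0 → u + w ∈ Z ∧ u + w ≠ 0 := by
    intro Z hZ hZ₁ hZ₂
    have d₁ := Submodule.finrank_eq_zero.1 hZ₁
    have d₂ := Submodule.finrank_eq_zero.1 hZ₂
    obtain ⟨z, hz, hz0⟩ := Z.exists_mem_ne_zero_of_ne_bot (by
      rintro rfl
      simp at hZ)
    obtain ⟨a, b, rfl⟩ := hgen z
    have ha : a ≠ 0 := by
      rintro rfl
      rw [zero_smul, zero_add] at hz hz0
      exact hz0 (Submodule.disjoint_def.1 (disjoint_iff.2 d₂) _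
        (Submodule.smul_mem _ _ (Submodule.mem_span_singleton_self w)) hz)
    have hb : b ≠ 0 := by
      rintro rfl
      rw [zero_smul, add_zero] at hz hz0
      exact hz0 (Submodule.disjoint_def.1 (disjoint_iff.2 d₁) _
        (Submodule.smul_mem _ _ (Submodule.mem_span_singleton_self u)) hz)
    rw [hF a ha, hF b hb, one_smul, one_smul] at hz hz0
    exact ⟨hz, hz0⟩
  simp only [Incident, or_self] at hi₁ hi₂
  obtain ⟨m₁, hn⟩ := key V₁ hV₁ hi₁.1 hi₂.1
  obtain ⟨m₂, -⟩ := key V₂ hV₂ hi₁.2 hi₂.2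
  exact hn (Submodule.disjoint_def.1 (disjoint_iff.2 hinf) _ m₁ m₂)

theorem collinearlyComplete_one_of_card_ne_two [Fintype F] (hq : Fintype.card F ≠ 2)
    (hV : finrank F V = 2) : CollinearlyComplete F V 1 1 0 0 := by
  intro U₁ U₂ h₁ h₂ hne
  obtain ⟨c, hc0, hc1⟩ : ∃ c : F, c ≠ 0 ∧ c ≠ 1 := by
    by_contra! hall
    classical
    apply hq
    have : (Finset.univ : Finset F) = {0, 1} := by
      ext x
      simpa using or_iff_not_imp_left.2 (hall x)
    rw [← Finset.card_univ, this, Finset.card_pair zero_ne_one]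
  obtain ⟨u, w, rfl, rfl, hind, -⟩ := exists_generator_pair hV h₁ h₂ hne
  have hdisj : ∀ a b a' b' : F, a * b' - b * a' ≠ 0 →
      (F ∙ (a • u + b • w)) ⊓ (F ∙ (a' • u + b' • w)) = ⊥ := by
    intro a b a' b' hdet
    rw [eq_bot_iff]
    rintro x ⟨hx, hx'⟩
    obtain ⟨r, rfl⟩ := Submodule.mem_span_singleton.1 hx
    obtain ⟨s, hs⟩ := Submodule.mem_span_singleton.1 hx'
    obtain ⟨e₁, e₂⟩ := hind (r * a - s * a') (r * b - s * b') (by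
      rw [← sub_eq_zero.2 hs.symm]
      module)
    have h3 : r * (a * b' - b * a') = 0 := by linear_combination b' * e₁ - a' * e₂
    simp [(mul_eq_zero.1 h3).resolve_right hdet]
  have hfin : ∀ b : F, finrank F ↥(F ∙ ((1 : F) • u + b • w)) = 1 := by
    intro b
    refine finrank_span_singleton fun h => ?_
    exact one_ne_zero (hind 1 b h).1
  have hu : ∀ b : F, b ≠ 0 → finrank F ↥((F ∙ u) ⊓ (F ∙ ((1 : F) • u + b • w))) = 0 := by
    intro b hb
    have := hdisj 1 0 1 b (by simpa using hb)
    rw [one_smul, zero_smul, add_zero] at this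
    rw [one_smul, this, finrank_bot]
  have hw : ∀ b : F, finrank F ↥((F ∙ w) ⊓ (F ∙ ((1 : F) • u + b • w))) = 0 := by
    intro b
    have := hdisj 0 1 1 b (by simp)
    rw [one_smul, zero_smul, zero_add, one_smul] at this
    rw [one_smul, this, finrank_bot]
  have h12 := hdisj 1 1 1 c (by simpa [sub_eq_zero] using hc1)
  have hcompl := isCompl_of_finrank_eq_one hV (hfin 1) (hfin c) (fun he => by
    rw [he, inf_idem] at h12
    have := hfin c
    rw [h12, finrank_bot] at this
    omega)
  exact ⟨_, _, ⟨hfin 1, hfin c, hcompl.inf_eq_bot, hcompl.sup_eq_top⟩,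
    .inl ⟨hu 1 one_ne_zero, hu c hc0⟩, .inl ⟨hw 1, hw c⟩⟩

theorem collinearlyComplete_one_zero_one (hV : finrank F V = 2) :
    CollinearlyComplete F V 1 1 0 1 := by
  intro U₁ U₂ h₁ h₂ hne
  have hc := isCompl_of_finrank_eq_one hV h₁ h₂ hne
  refine ⟨U₁, U₂, ⟨h₁, h₂, hc.inf_eq_bot, hc.sup_eq_top⟩, .inr ?_, .inl ?_⟩
  · rw [inf_idem, hc.inf_eq_bot, finrank_bot]
    exact ⟨h₁, rfl⟩
  · rw [inf_idem, inf_comm, hc.inf_eq_bot, finrank_bot]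
    exact ⟨rfl, h₂⟩

end CollinearCompleteness

theorem collinearlyComplete_subspace_bisection_iff
    (F V : Type*) [Field F] [Fintype F] [AddCommGroup V] [Module F V]
    [FiniteDimensional F V] (q k m k₁ k₂ : ℕ)
    (hq : Fintype.card F = q) (hk : 1 ≤ k) (hV : finrank F V = 2 * k)
    (hk₁₂ : k₁ ≤ k₂) (hk₂ : k₂ ≤ k) (hmlow : k₁ + k₂ ≤ m) (hmhigh : m ≤ k + k₁)
    (hm2k : m < 2 * k) :
    CollinearlyComplete F V m k k₁ k₂ ↔
      (3 * k₂ ≤ k + 1 + m + k₁ ∧ (q, m, k, k₁, k₂) ≠ (2, 1, 1, 0, 0)) := by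
  constructor
  · intro h
    refine ⟨le_of_collinearlyComplete hV hk₂ hmlow hmhigh h, fun he => ?_⟩
    simp only [Prod.mk.injEq] at he
    obtain ⟨rfl, rfl, rfl, rfl, rfl⟩ := he
    exact not_collinearlyComplete_of_card_eq_two hq hV h
  · rintro ⟨h, hne⟩
    rcases hk.lt_or_eq with hk2 | rfl
    · exact fun U₁ U₂ hU₁ hU₂ _ =>
        exists_bisection_of_two_le hk2 hV hk₁₂ hmlow hmhigh h hU₁ hU₂
    · rcases Nat.eq_zero_or_pos m with rfl | hm
      · intro U₁ U₂ hU₁ hU₂ hne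
        rw [Submodule.finrank_eq_zero] at hU₁ hU₂
        exact absurd (hU₁.trans hU₂.symm) hne
      obtain rfl : m = 1 := by omega
      obtain rfl : k₁ = 0 := by omega
      rcases Nat.eq_zero_or_pos k₂ with rfl | hk₂'
      · exact collinearlyComplete_one_of_card_ne_two (fun h2 => hne (by rw [← hq, h2])) hV
      · obtain rfl : k₂ = 1 := by omega
        exact collinearlyComplete_one_zero_one hV
end

section
/- Let F be a finite field with |F| = q, let k ≥ 1, let V be a 2k-dimensional F-vector space, and let m, k1, k2 be integers with 1 ≤ m ≤ k, 0 ≤ k1 ≤ k2 ≤ k, k1 + k2 ≤ m and 2·k2 > m. Then Proj^{m,k}_{(k1,k2)}(V) is concurrently complete if and only if q = 2 and k = 1. -/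
open Module

/-- Concurrent completeness of the geometry `Proj^{m,k}_{(k₁,k₂)}(V)`. -/
def ConcurrentlyComplete (F V : Type*) [Field F] [AddCommGroup V] [Module F V]
    (m k k₁ k₂ : ℕ) : Prop :=
  ∀ V₁ V₂ V₁' V₂' : Submodule F V, IsBisection k V₁ V₂ → IsBisection k V₁' V₂' →
    ({V₁, V₂} : Set (Submodule F V)) ≠ {V₁', V₂'} →
    ∃ U : Submodule F V, finrank F U = m ∧
      Incident k₁ k₂ U V₁ V₂ ∧ Incident k₁ k₂ U V₁' V₂'

/-- The image in `V` of the `K`-line spanned by `(a, b)` under an identification `K × K ≃ V`. -/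
def fieldLine {F V K : Type*} [Field F] [AddCommGroup V] [Module F V] [Field K] [Algebra F K]
    (e : (K × K) ≃ₗ[F] V) (a b : K) : Submodule F V :=
  LinearMap.range (e.toLinearMap ∘ₗ (LinearMap.mulLeft F a).prod (LinearMap.mulLeft F b))

theorem mem_fieldLine {F V K : Type*} [Field F] [AddCommGroup V] [Module F V] [Field K]
    [Algebra F K] (e : (K × K) ≃ₗ[F] V) (a b : K) (v : V) :
    v ∈ fieldLine e a b ↔ ∃ x, e (a * x, b * x) = v := by
  simp [fieldLine]

theorem finrank_fieldLine {F V K : Type*} [Field F] [AddCommGroup V] [Module F V] [Field K]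
    [Algebra F K] (e : (K × K) ≃ₗ[F] V) {a b : K} (h : a ≠ 0 ∨ b ≠ 0) :
    finrank F (fieldLine e a b) = finrank F K := by
  refine LinearMap.finrank_range_of_inj fun x y hxy => ?_
  have hxy' : a * x = a * y ∧ b * x = b * y := by simpa using hxy
  rcases h with h | h
  · exact mul_left_cancel₀ h hxy'.1
  · exact mul_left_cancel₀ h hxy'.2

theorem fieldLine_inf_eq_bot {F V K : Type*} [Field F] [AddCommGroup V] [Module F V] [Field K]
    [Algebra F K] (e : (K × K) ≃ₗ[F] V) {a b c d : K} (h : a * d - b * c ≠ 0) :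
    fieldLine e a b ⊓ fieldLine e c d = ⊥ := by
  refine (Submodule.eq_bot_iff _).2 fun v hv => ?_
  obtain ⟨hv₁, hv₂⟩ := Submodule.mem_inf.1 hv
  obtain ⟨x, rfl⟩ := (mem_fieldLine e a b _).1 hv₁
  obtain ⟨y, hy⟩ := (mem_fieldLine e c d _).1 hv₂
  have hy' : c * y = a * x ∧ d * y = b * x := by simpa using hy
  have hx : (a * d - b * c) * x = 0 := by linear_combination c * hy'.2 - d * hy'.1
  have : x = 0 := (mul_eq_zero.1 hx).resolve_left h
  simp [this]

theorem isBisection_of_finrank_of_inf_eq_bot {F V : Type*} [Field F] [AddCommGroup V] [Module F V]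
    [FiniteDimensional F V] {k : ℕ} (hV : finrank F V = 2 * k) {V₁ V₂ : Submodule F V}
    (h₁ : finrank F V₁ = k) (h₂ : finrank F V₂ = k) (h : V₁ ⊓ V₂ = ⊥) : IsBisection k V₁ V₂ :=
  ⟨h₁, h₂, h, Submodule.eq_top_of_disjoint V₁ V₂ (by lia) (disjoint_iff.2 h)⟩

theorem finrank_inf_add_finrank_inf_le_s3 {F V : Type*} [Field F] [AddCommGroup V] [Module F V]
    [FiniteDimensional F V] (U : Submodule F V) {W W' : Submodule F V} (h : W ⊓ W' = ⊥) :
    finrank F ↥(U ⊓ W) + finrank F ↥(U ⊓ W') ≤ finrank F U := by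
  have hbot : (U ⊓ W) ⊓ (U ⊓ W') = ⊥ :=
    le_bot_iff.1 (h ▸ inf_le_inf inf_le_right inf_le_right)
  have hsum := Submodule.finrank_sup_add_finrank_inf_eq (U ⊓ W) (U ⊓ W')
  rw [hbot, finrank_bot, add_zero] at hsum
  exact hsum ▸ Submodule.finrank_mono (sup_le inf_le_left inf_le_left)

theorem exists_field_extension_of_finrank (F : Type*) [Field F] [Finite F] {k : ℕ} (hk : 1 ≤ k) :
    ∃ (K : Type) (_ : Field K) (_ : Algebra F K), FiniteDimensional F K ∧ finrank F K = k := by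
  have := Fact.mk (CharP.char_is_prime F (ringChar F))
  have : NeZero k := ⟨by lia⟩
  exact ⟨FiniteField.Extension F (ringChar F) k, inferInstance, inferInstance, inferInstance,
    FiniteField.finrank_extension F (ringChar F) k⟩

theorem exists_ne_zero_ne_one_of_finrank {F K : Type*} [Field F] [Fintype F] [Field K] [Algebra F K]
    [FiniteDimensional F K] (h : ¬(Fintype.card F = 2 ∧ finrank F K = 1)) :
    ∃ t : K, t ≠ 0 ∧ t ≠ 1 := by
  classical
  have : Finite K := Module.finite_of_finite F
  have := Fintype.ofFinite K
  have hcard : Fintype.card K = Fintype.card F ^ finrank F K := Module.card_eq_pow_finrank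
  have hF : 2 ≤ Fintype.card F := Fintype.one_lt_card
  have hK : 1 ≤ finrank F K := Module.finrank_pos
  have hlt : 2 < Fintype.card K := by
    rw [hcard]
    rcases hF.lt_or_eq with hF | hF
    · exact hF.trans_le (Nat.le_self_pow (by lia) _)
    · have hK : 1 < finrank F K := by lia
      rw [← hF]
      exact lt_of_lt_of_le (by norm_num) (Nat.pow_le_pow_right two_pos hK)
  obtain ⟨t, ht⟩ : ∃ t, t ∉ ({0, 1} : Finset K) := by
    by_contra! hall
    have := (Finset.card_le_card fun t (_ : t ∈ Finset.univ) => hall t).trans Finset.card_le_two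
    rw [Finset.card_univ] at this
    lia
  exact ⟨t, by simpa using ht⟩

theorem Incident.exists_finrank_inf_eq {F V : Type*} [Field F] [AddCommGroup V] [Module F V]
    {k₁ k₂ : ℕ} {U V₁ V₂ : Submodule F V} (h : Incident k₁ k₂ U V₁ V₂) :
    finrank F ↥(U ⊓ V₁) = k₂ ∨ finrank F ↥(U ⊓ V₂) = k₂ :=
  h.elim (fun h => .inr h.2) fun h => .inl h.1

theorem not_concurrentlyComplete {F V : Type*} [Field F] [Fintype F] [AddCommGroup V] [Module F V]
    [FiniteDimensional F V] {k m k₁ k₂ : ℕ} (hk : 1 ≤ k) (hV : finrank F V = 2 * k)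
    (hbig : m < 2 * k₂) (h : ¬(Fintype.card F = 2 ∧ k = 1)) :
    ¬ConcurrentlyComplete F V m k k₁ k₂ := by
  intro hC
  obtain ⟨K, _, _, _, hK⟩ := exists_field_extension_of_finrank F hk
  obtain ⟨t, ht₀, ht₁⟩ := exists_ne_zero_ne_one_of_finrank (F := F) (K := K) (by rwa [hK])
  let e : (K × K) ≃ₗ[F] V := LinearEquiv.ofFinrankEq _ _ (by rw [finrank_prod, hV]; lia)
  have hdim (a b : K) (hab : a ≠ 0 ∨ b ≠ 0) : finrank F (fieldLine e a b) = k :=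
    (finrank_fieldLine e hab).trans hK
  have ht₁' : t - 1 ≠ 0 := sub_ne_zero.2 ht₁
  have h₁₃ : fieldLine e 1 0 ⊓ fieldLine e 1 1 = ⊥ := fieldLine_inf_eq_bot e (by simp)
  have h₁₄ : fieldLine e 1 0 ⊓ fieldLine e 1 t = ⊥ := fieldLine_inf_eq_bot e (by simpa)
  have h₂₃ : fieldLine e 0 1 ⊓ fieldLine e 1 1 = ⊥ := fieldLine_inf_eq_bot e (by simp)
  have h₂₄ : fieldLine e 0 1 ⊓ fieldLine e 1 t = ⊥ := fieldLine_inf_eq_bot e (by simp)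
  have hne : ({fieldLine e 1 0, fieldLine e 0 1} : Set (Submodule F V)) ≠
      {fieldLine e 1 1, fieldLine e 1 t} := by
    intro heq
    have hmem : fieldLine e 1 0 ∈ ({fieldLine e 1 1, fieldLine e 1 t} : Set (Submodule F V)) :=
      heq ▸ Set.mem_insert _ _
    have hbot : fieldLine e 1 0 = ⊥ := by
      rcases hmem with h' | h'
      · rwa [← h', inf_idem] at h₁₃
      · rwa [← Set.mem_singleton_iff.1 h', inf_idem] at h₁₄
    have := hdim 1 0 (by simp)
    rw [hbot, finrank_bot] at this
    lia
  obtain ⟨U, hU, hI, hI'⟩ := hC _ _ _ _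
    (isBisection_of_finrank_of_inf_eq_bot hV (hdim 1 0 (by simp)) (hdim 0 1 (by simp))
      (fieldLine_inf_eq_bot e (by simp)))
    (isBisection_of_finrank_of_inf_eq_bot hV (hdim 1 1 (by simp)) (hdim 1 t (by simp))
      (fieldLine_inf_eq_bot e (by simpa))) hne
  have i₁₃ := finrank_inf_add_finrank_inf_le_s3 U h₁₃
  have i₁₄ := finrank_inf_add_finrank_inf_le_s3 U h₁₄
  have i₂₃ := finrank_inf_add_finrank_inf_le_s3 U h₂₃
  have i₂₄ := finrank_inf_add_finrank_inf_le_s3 U h₂₄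
  rcases hI.exists_finrank_inf_eq with h₁ | h₁ <;>
    rcases hI'.exists_finrank_inf_eq with h₂ | h₂ <;> lia

theorem eq_of_finrank_eq_one_of_mem {F V : Type*} [Field F] [AddCommGroup V] [Module F V]
    {W W' : Submodule F V} (h : finrank F W = 1) (h' : finrank F W' = 1) {v : V} (hv : v ≠ 0)
    (hW : v ∈ W) (hW' : v ∈ W') : W = W' := by
  have key {X : Submodule F V} (hX : finrank F X = 1) (hvX : v ∈ X) : F ∙ v = X := by
    have := FiniteDimensional.of_finrank_pos (hX ▸ one_pos)
    refine Submodule.eq_of_le_of_finrank_eq ((Submodule.span_singleton_le_iff_mem v X).2 hvX) ?_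
    rw [hX, finrank_span_singleton hv]
  rw [← key h hW, key h' hW']

theorem exists_common_of_card_eq_two {F V : Type*} [Field F] [Fintype F] [AddCommGroup V]
    [Module F V] [FiniteDimensional F V] (hF : Fintype.card F = 2) (hV : finrank F V = 2)
    {V₁ V₂ V₁' V₂' : Submodule F V} (h : IsBisection 1 V₁ V₂) (h' : IsBisection 1 V₁' V₂') :
    ∃ U, (U = V₁ ∨ U = V₂) ∧ (U = V₁' ∨ U = V₂') := by
  classical
  have : Finite V := Module.finite_of_finite F
  have := Fintype.ofFinite V
  have hcard : Fintype.card V = 4 := by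
    rw [Module.card_eq_pow_finrank (K := F), hF, hV]
    norm_num
  have hex (W : Submodule F V) (hW : finrank F W = 1) : ∃ v ∈ W, v ≠ 0 :=
    Submodule.exists_mem_ne_zero_of_ne_bot (by rintro rfl; simp at hW)
  obtain ⟨d₁, d₂, hbot, -⟩ := h
  obtain ⟨d₁', d₂', hbot', -⟩ := h'
  obtain ⟨a, ha, ha₀⟩ := hex V₁ d₁
  obtain ⟨b, hb, hb₀⟩ := hex V₂ d₂
  obtain ⟨c, hc, hc₀⟩ := hex V₁' d₁'
  obtain ⟨d, hd, hd₀⟩ := hex V₂' d₂'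
  have hab : a ≠ b := by
    rintro rfl
    exact ha₀ (by simpa [hbot] using Submodule.mem_inf.2 ⟨ha, hb⟩)
  have hcd : c ≠ d := by
    rintro rfl
    exact hc₀ (by simpa [hbot'] using Submodule.mem_inf.2 ⟨hc, hd⟩)
  by_contra! hcon
  have hac : a ≠ c := by
    rintro rfl
    exact (hcon V₁ (.inl rfl)).1 (eq_of_finrank_eq_one_of_mem d₁ d₁' ha₀ ha hc)
  have had : a ≠ d := by
    rintro rfl
    exact (hcon V₁ (.inl rfl)).2 (eq_of_finrank_eq_one_of_mem d₁ d₂' ha₀ ha hd)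
  have hbc : b ≠ c := by
    rintro rfl
    exact (hcon V₂ (.inr rfl)).1 (eq_of_finrank_eq_one_of_mem d₂ d₁' hb₀ hb hc)
  have hbd : b ≠ d := by
    rintro rfl
    exact (hcon V₂ (.inr rfl)).2 (eq_of_finrank_eq_one_of_mem d₂ d₂' hb₀ hb hd)
  have hfive : ({0, a, b, c, d} : Finset V).card = 5 := by
    simp [Finset.card_insert_of_notMem, ha₀.symm, hb₀.symm, hc₀.symm, hd₀.symm, *]
  have := Finset.card_le_univ ({0, a, b, c, d} : Finset V)
  lia

theorem incident_zero_of_eq_or_eq {F V : Type*} [Field F] [AddCommGroup V] [Module F V] {k : ℕ}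
    {U V₁ V₂ : Submodule F V} (h : IsBisection k V₁ V₂) (hU : U = V₁ ∨ U = V₂) :
    Incident 0 k U V₁ V₂ := by
  obtain ⟨d₁, d₂, hbot, -⟩ := h
  rcases hU with rfl | rfl
  · exact .inr ⟨by rwa [inf_idem], by rw [hbot, finrank_bot]⟩
  · exact .inl ⟨by rw [inf_comm, hbot, finrank_bot], by rwa [inf_idem]⟩

theorem concurrentlyComplete_iff_of_large_k₂
    (F V : Type*) [Field F] [Fintype F] [AddCommGroup V] [Module F V]
    [FiniteDimensional F V] (q k m k₁ k₂ : ℕ)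
    (hq : Fintype.card F = q) (hk : 1 ≤ k) (hV : finrank F V = 2 * k)
    (hm1 : 1 ≤ m) (hmk : m ≤ k) (hk₁₂ : k₁ ≤ k₂) (hk₂ : k₂ ≤ k)
    (hmlow : k₁ + k₂ ≤ m) (hbig : m < 2 * k₂) :
    ConcurrentlyComplete F V m k k₁ k₂ ↔ (q = 2 ∧ k = 1) := by
  subst hq
  refine ⟨fun hC => by_contra fun h => not_concurrentlyComplete hk hV hbig h hC, ?_⟩
  rintro ⟨hF, rfl⟩ V₁ V₂ V₁' V₂' h h' -
  obtain rfl : k₁ = 0 := by lia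
  obtain rfl : k₂ = 1 := by lia
  obtain rfl : m = 1 := by lia
  obtain ⟨U, hU, hU'⟩ := exists_common_of_card_eq_two hF hV h h'
  refine ⟨U, ?_, incident_zero_of_eq_or_eq h hU, incident_zero_of_eq_or_eq h' hU'⟩
  rcases hU with rfl | rfl
  · exact h.1
  · exact h.2.1
end

section
/- Let n, m, k, j be integers with 1 ≤ m, 2m ≤ n, 1 ≤ k < n and max{0, m + k − n} ≤ j ≤ min{m, k}. Then the following are equivalent: (a) for every pair of distinct m-element subsets M₁, M₂ of {1, …, n} there exists a k-element subset K of {1, …, n} with |K ∩ M₁| = j and |K ∩ M₂| = j; (b) 2j ≤ k and k + 2m ≤ n + 2j. -/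
theorem subset_geometry_collinearly_complete_iff
    (n m k j : ℕ) (hm1 : 1 ≤ m) (hmn : 2 * m ≤ n)
    (hk1 : 1 ≤ k) (hkn : k < n) (hjl : m + k - n ≤ j) (hju : j ≤ min m k) :
    (∀ M₁ M₂ : Finset (Fin n), M₁.card = m → M₂.card = m → M₁ ≠ M₂ →
      ∃ K : Finset (Fin n), K.card = k ∧ (K ∩ M₁).card = j ∧ (K ∩ M₂).card = j) ↔
    (2 * j ≤ k ∧ k + 2 * m ≤ n + 2 * j) := by
  have hjm : j ≤ m := hju.trans (min_le_left _ _)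
  constructor
  · intro h
    obtain ⟨A, -, hA⟩ := Finset.exists_subset_card_eq
      (s := (Finset.univ : Finset (Fin n))) (n := m) (by simp; omega)
    obtain ⟨B, hBA, hB⟩ := Finset.exists_subset_card_eq
      (s := Aᶜ) (n := m) (by rw [Finset.card_compl, Fintype.card_fin]; omega)
    have hAB : Disjoint A B := (Finset.subset_compl_iff_disjoint_left).1 hBA
    have hne : A ≠ B := by
      rintro rfl
      rw [disjoint_self, Finset.bot_eq_empty] at hAB
      simp [hAB] at hA
      omega
    obtain ⟨K, hK, hKA, hKB⟩ := h A B hA hB hne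
    have hunion : (A ∪ B).card = 2 * m := by
      rw [Finset.card_union_of_disjoint hAB]; omega
    have hinter : (K ∩ (A ∪ B)).card = 2 * j := by
      rw [Finset.inter_union_distrib_left, Finset.card_union_of_disjoint
        (hAB.mono Finset.inter_subset_right Finset.inter_subset_right)]
      omega
    have hle : (K ∩ (A ∪ B)).card ≤ K.card := Finset.card_le_card Finset.inter_subset_left
    have hcard : (K ∪ (A ∪ B)).card ≤ n := by simpa using Finset.card_le_univ (K ∪ (A ∪ B))
    have := Finset.card_union_add_card_inter K (A ∪ B)
    omega
  · rintro ⟨h₁, h₂⟩ A B hA hB -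
    have hAd := Finset.card_sdiff_add_card_inter A B
    have hBd := Finset.card_sdiff_add_card_inter B A
    rw [Finset.inter_comm B A] at hBd
    have hu := Finset.card_union_add_card_inter A B
    have hc : (A ∪ B)ᶜ.card = n - (A ∪ B).card := by
      rw [Finset.card_compl, Fintype.card_fin]
    obtain ⟨I, hI, hIc⟩ := Finset.exists_subset_card_eq
      (s := A ∩ B) (n := min (A ∩ B).card j) (by omega)
    obtain ⟨P, hP, hPc⟩ := Finset.exists_subset_card_eq
      (s := A \ B) (n := j - min (A ∩ B).card j) (by omega)
    obtain ⟨Q, hQ, hQc⟩ := Finset.exists_subset_card_eq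
      (s := B \ A) (n := j - min (A ∩ B).card j) (by omega)
    obtain ⟨R, hR, hRc⟩ := Finset.exists_subset_card_eq
      (s := (A ∪ B)ᶜ) (n := k - 2 * j + min (A ∩ B).card j) (by omega)
    simp only [Finset.subset_iff, Finset.mem_inter, Finset.mem_sdiff, Finset.mem_compl,
      Finset.mem_union] at hI hP hQ hR
    have hIP : Disjoint I P := Finset.disjoint_left.2 (by grind)
    have hIQ : Disjoint I Q := Finset.disjoint_left.2 (by grind)
    have hIPQ : Disjoint (I ∪ P) Q := Finset.disjoint_left.2 (by grind)
    have hIPQR : Disjoint (I ∪ P ∪ Q) R := Finset.disjoint_left.2 (by grind)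
    have hKA : (I ∪ P ∪ Q ∪ R) ∩ A = I ∪ P := by grind
    have hKB : (I ∪ P ∪ Q ∪ R) ∩ B = I ∪ Q := by grind
    refine ⟨I ∪ P ∪ Q ∪ R, ?_, ?_, ?_⟩
    · rw [Finset.card_union_of_disjoint hIPQR, Finset.card_union_of_disjoint hIPQ,
        Finset.card_union_of_disjoint hIP]
      omega
    · rw [hKA, Finset.card_union_of_disjoint hIP]; omega
    · rw [hKB, Finset.card_union_of_disjoint hIQ]; omega
end

section
/- Let n, m, k, j be integers with 1 ≤ m, 2m ≤ n, 1 ≤ k < n, max{0, m + k − n} ≤ j ≤ min{m, k} and 2j ≤ k, and let M₁, M₂ be distinct m-element subsets of N = {1, …, n}. Then there exists a subset P of N with |P| = n − 2m + 2j, |P ∩ M₁| = j and |P ∩ M₂| = j, such that: (i) if k + 2m ≤ n + 2j, then there is a k-element subset K of P with |K ∩ M₁| = j and |K ∩ M₂| = j; and (ii) if k + 2m > n + 2j, then there is a partition of N \ P into exactly (k − 2j) − (n − 2m) pairwise disjoint nonempty subsets, each of size at least 2. -/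
/-- Given two sets of equal cardinality at least `j`, some subset of their union meets each of them
in exactly `j` elements, using as many common elements as possible. -/
theorem exists_subset_union_card_inter_eq {α : Type*} [DecidableEq α] {s t : Finset α} {j : ℕ}
    (hst : s.card = t.card) (hj : j ≤ s.card) :
    ∃ E ⊆ s ∪ t, (E ∩ s).card = j ∧ (E ∩ t).card = j ∧
      E.card + min j (s ∩ t).card = 2 * j := by
  have hs := Finset.card_sdiff_add_card_inter s t
  have ht := Finset.card_sdiff_add_card_inter t s
  rw [Finset.inter_comm t s] at ht
  obtain ⟨C, hC, hCc⟩ := Finset.exists_subset_card_eq (min_le_right j (s ∩ t).card)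
  obtain ⟨A, hA, hAc⟩ := Finset.exists_subset_card_eq
    (show j - min j (s ∩ t).card ≤ (s \ t).card by omega)
  obtain ⟨B, hB, hBc⟩ := Finset.exists_subset_card_eq
    (show j - min j (s ∩ t).card ≤ (t \ s).card by omega)
  have hA' : ∀ x ∈ A, x ∈ s ∧ x ∉ t := fun x hx => Finset.mem_sdiff.1 (hA hx)
  have hB' : ∀ x ∈ B, x ∈ t ∧ x ∉ s := fun x hx => Finset.mem_sdiff.1 (hB hx)
  have hC' : ∀ x ∈ C, x ∈ s ∧ x ∈ t := fun x hx => Finset.mem_inter.1 (hC hx)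
  have hAC : Disjoint A C := Finset.disjoint_left.2 (by grind)
  have hBC : Disjoint B C := Finset.disjoint_left.2 (by grind)
  have hABC : Disjoint A (B ∪ C) := Finset.disjoint_left.2 (by grind)
  have hEs : (A ∪ (B ∪ C)) ∩ s = A ∪ C := by grind
  have hEt : (A ∪ (B ∪ C)) ∩ t = B ∪ C := by grind
  refine ⟨A ∪ (B ∪ C), by grind, ?_, ?_, ?_⟩
  · rw [hEs, Finset.card_union_of_disjoint hAC]; omega
  · rw [hEt, Finset.card_union_of_disjoint hBC]; omega
  · rw [Finset.card_union_of_disjoint hABC, Finset.card_union_of_disjoint hBC]; omega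

/-- A finite set with at least `2 * r` elements, `r ≠ 0`, splits into `r` parts of size at
least two. -/
theorem exists_finpartition_card_eq_two_le {α : Type*} [DecidableEq α] (s : Finset α) {r : ℕ}
    (hr : r ≠ 0) (hs : 2 * r ≤ s.card) :
    ∃ Q : Finpartition s, Q.parts.card = r ∧ ∀ A ∈ Q.parts, 2 ≤ A.card := by
  obtain ⟨Q, hQ, hQr⟩ :=
    Finpartition.exists_equipartition_card_eq s hr (show r ≤ s.card by omega)
  refine ⟨Q, hQr, fun A hA => le_trans ?_ (hQ.average_le_card_part hA)⟩
  rw [hQr, Nat.le_div_iff_mul_le (Nat.pos_of_ne_zero hr)]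
  exact hs


theorem exists_subset_meeting_in_j
    (n m k j : ℕ) (hm1 : 1 ≤ m) (hmn : 2 * m ≤ n)
    (hk1 : 1 ≤ k) (hkn : k < n) (hjl : m + k - n ≤ j) (hju : j ≤ min m k)
    (hjk : 2 * j ≤ k)
    (M₁ M₂ : Finset (Fin n)) (hM₁ : M₁.card = m) (hM₂ : M₂.card = m)
    (hne : M₁ ≠ M₂) :
    ∃ P : Finset (Fin n), P.card = n - 2 * m + 2 * j ∧
      (P ∩ M₁).card = j ∧ (P ∩ M₂).card = j ∧
      (k + 2 * m ≤ n + 2 * j →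
        ∃ K ⊆ P, K.card = k ∧ (K ∩ M₁).card = j ∧ (K ∩ M₂).card = j) ∧
      (n + 2 * j < k + 2 * m →
        ∃ parts : Finset (Finset (Fin n)),
          parts.card = (k - 2 * j) - (n - 2 * m) ∧
          (∀ A ∈ parts, 2 ≤ A.card) ∧
          (parts : Set (Finset (Fin n))).PairwiseDisjoint id ∧
          parts.biUnion id = Finset.univ \ P) := by
  have hj : j ≤ M₁.card := by omega
  obtain ⟨E, hE, hE₁, hE₂, hEc⟩ := exists_subset_union_card_inter_eq (hM₁.trans hM₂.symm) hj
  have hU := Finset.card_union_add_card_inter M₁ M₂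
  have hUc := Finset.card_compl_add_card (M₁ ∪ M₂)
  rw [Fintype.card_fin] at hUc
  have hx₁ := min_le_left j (M₁ ∩ M₂).card
  have hx₂ := min_le_right j (M₁ ∩ M₂).card
  generalize min j (M₁ ∩ M₂).card = x at hEc hx₁ hx₂
  have key : ∀ D ⊆ (M₁ ∪ M₂)ᶜ,
      (E ∪ D).card = E.card + D.card ∧ ((E ∪ D) ∩ M₁).card = j ∧ ((E ∪ D) ∩ M₂).card = j := by
    intro D hD
    have hD' : ∀ y ∈ D, y ∉ M₁ ∧ y ∉ M₂ := fun y hy => by simpa using hD hy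
    have h₁ : (E ∪ D) ∩ M₁ = E ∩ M₁ := by grind
    have h₂ : (E ∪ D) ∩ M₂ = E ∩ M₂ := by grind
    refine ⟨Finset.card_union_of_disjoint (Finset.disjoint_left.2 ?_), h₁ ▸ hE₁, h₂ ▸ hE₂⟩
    grind
  obtain ⟨D, hD, hDc⟩ := Finset.exists_subset_card_eq
    (show n - 2 * m + x ≤ ((M₁ ∪ M₂)ᶜ).card by omega)
  obtain ⟨hP, hP₁, hP₂⟩ := key D hD
  have hPc : (E ∪ D).card = n - 2 * m + 2 * j := by omega
  refine ⟨E ∪ D, hPc, hP₁, hP₂, fun hk => ?_, fun hk => ?_⟩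
  · obtain ⟨F, hF, hFc⟩ := Finset.exists_subset_card_eq (show k - E.card ≤ D.card by omega)
    obtain ⟨hK, hK₁, hK₂⟩ := key F (hF.trans hD)
    exact ⟨E ∪ F, Finset.union_subset_union_right hF, by omega, hK₁, hK₂⟩
  · have hc : (Finset.univ \ (E ∪ D)).card = n - (E ∪ D).card := by
      rw [Finset.card_univ_sdiff, Fintype.card_fin]
    obtain ⟨Q, hQc, hQ⟩ := exists_finpartition_card_eq_two_le (Finset.univ \ (E ∪ D))
      (r := (k - 2 * j) - (n - 2 * m)) (by omega) (by omega)
    exact ⟨Q.parts, hQc, hQ, Q.disjoint, Q.biUnion_parts⟩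
end

section
/- Let F be a field, V an n-dimensional F-vector space, U an m-dimensional subspace of V, and W₁, W₂ two k-dimensional subspaces of V. Then there exists g ∈ GL(V) with g(U) = U and g(W₁) = W₂ if and only if dim(U ∩ W₁) = dim(U ∩ W₂). -/
open Module

/-- Linear equivalences between the summands of two direct sum decompositions glue. -/
theorem Submodule.exists_linearEquiv_of_isCompl {F M N : Type*} [Field F]
    [AddCommGroup M] [Module F M] [AddCommGroup N] [Module F N]
    {P Q : Submodule F M} {P' Q' : Submodule F N} (h : IsCompl P Q) (h' : IsCompl P' Q')
    (e : P ≃ₗ[F] P') (f : Q ≃ₗ[F] Q') :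
    ∃ g : M ≃ₗ[F] N, (∀ x : P, g x = e x) ∧ ∀ x : Q, g x = f x := by
  refine ⟨(P.prodEquivOfIsCompl Q h).symm ≪≫ₗ e.prodCongr f ≪≫ₗ
    P'.prodEquivOfIsCompl Q' h', fun x => ?_, fun x => ?_⟩ <;> simp

theorem Submodule.map_eq_map_of_forall_apply_eq {F M N : Type*} [Field F]
    [AddCommGroup M] [Module F M] [AddCommGroup N] [Module F N]
    {P : Submodule F M} {P' : Submodule F N} {g : M →ₗ[F] N} {e : P →ₗ[F] P'}
    (h : ∀ x : P, g x = e x) (A : Submodule F P) :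
    (A.map P.subtype).map g = (A.map e).map P'.subtype := by
  rw [← Submodule.map_comp, ← Submodule.map_comp]
  congr 1
  ext x
  exact h x

theorem Submodule.exists_linearEquiv_map_eq_s7 {F M N : Type*} [Field F]
    [AddCommGroup M] [Module F M] [FiniteDimensional F M]
    [AddCommGroup N] [Module F N] [FiniteDimensional F N]
    (hMN : finrank F M = finrank F N) (P : Submodule F M) (P' : Submodule F N)
    (hP : finrank F P = finrank F P') :
    ∃ g : M ≃ₗ[F] N, P.map (g : M →ₗ[F] N) = P' := by
  obtain ⟨Q, hQ⟩ := P.exists_isCompl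
  obtain ⟨Q', hQ'⟩ := P'.exists_isCompl
  have h₁ := Submodule.finrank_add_eq_of_isCompl hQ
  have h₂ := Submodule.finrank_add_eq_of_isCompl hQ'
  obtain ⟨g, hg, -⟩ := exists_linearEquiv_of_isCompl hQ hQ' (LinearEquiv.ofFinrankEq P P' hP)
    (LinearEquiv.ofFinrankEq Q Q' (by omega))
  refine ⟨g, ?_⟩
  simpa using map_eq_map_of_forall_apply_eq (g := (g : M →ₗ[F] N))
    (e := (LinearEquiv.ofFinrankEq P P' hP : P →ₗ[F] P')) hg ⊤

/-- Any subspace `W` splits as `(U ⊓ W) ⊔ D` with `D` contained in a complement of `U`. -/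
theorem Submodule.exists_isCompl_inf_sup_inf_eq {F V : Type*} [Field F] [AddCommGroup V]
    [Module F V] (U W : Submodule F V) :
    ∃ Q : Submodule F V, IsCompl U Q ∧ (U ⊓ W) ⊔ (Q ⊓ W) = W := by
  obtain ⟨D, hD, hDW⟩ :=
    IsModularLattice.exists_disjoint_and_sup_eq (inf_le_right : U ⊓ W ≤ W)
  have hle : D ≤ W := hDW ▸ le_sup_right
  have hUD : Disjoint D U := by
    rw [disjoint_iff_inf_le] at hD ⊢
    exact le_trans (le_inf (le_inf inf_le_right (inf_le_left.trans hle)) inf_le_left) hD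
  obtain ⟨Q, hDQ, hQ⟩ := hUD.exists_isCompl
  refine ⟨Q, hQ.symm, le_antisymm (sup_le inf_le_right inf_le_right) ?_⟩
  conv_lhs => rw [← hDW]
  exact sup_le_sup_left (le_inf hDQ hle) _

theorem exists_stabiliser_elt_mapping_iff
    {F V : Type*} [Field F] [AddCommGroup V] [Module F V] [FiniteDimensional F V]
    (n m k : ℕ) (hn : finrank F V = n)
    (U W₁ W₂ : Submodule F V) (hU : finrank F U = m)
    (hW₁ : finrank F W₁ = k) (hW₂ : finrank F W₂ = k) :
    (∃ g : V ≃ₗ[F] V, U.map (g : V →ₗ[F] V) = U ∧ W₁.map (g : V →ₗ[F] V) = W₂) ↔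
      finrank F ↥(U ⊓ W₁) = finrank F ↥(U ⊓ W₂) := by
  constructor
  · rintro ⟨g, hgU, hgW⟩
    rw [← LinearEquiv.finrank_map_eq g (U ⊓ W₁)]
    rw [Submodule.map_inf _ g.injective, hgU, hgW]
  · intro h
    obtain ⟨Q₁, hQ₁, hs₁⟩ := U.exists_isCompl_inf_sup_inf_eq W₁
    obtain ⟨Q₂, hQ₂, hs₂⟩ := U.exists_isCompl_inf_sup_inf_eq W₂
    have finrank_comap (P W : Submodule F V) :
        finrank F (W.comap P.subtype) = finrank F ↥(P ⊓ W) := by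
      rw [← Submodule.map_comap_subtype, Submodule.finrank_map_subtype_eq]
    have finrank_split (Q W : Submodule F V) (hQ : IsCompl U Q) (hs : (U ⊓ W) ⊔ (Q ⊓ W) = W) :
        finrank F W = finrank F ↥(U ⊓ W) + finrank F ↥(Q ⊓ W) := by
      have := Submodule.finrank_sup_add_finrank_inf_eq (U ⊓ W) (Q ⊓ W)
      rwa [hs, (hQ.disjoint.mono inf_le_left inf_le_left).eq_bot, finrank_bot, add_zero] at this
    have hd₁ := finrank_split Q₁ W₁ hQ₁ hs₁
    have hd₂ := finrank_split Q₂ W₂ hQ₂ hs₂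
    have hc₁ := Submodule.finrank_add_eq_of_isCompl hQ₁
    have hc₂ := Submodule.finrank_add_eq_of_isCompl hQ₂
    obtain ⟨e, he⟩ := Submodule.exists_linearEquiv_map_eq_s7 rfl
      (W₁.comap U.subtype) (W₂.comap U.subtype) (by rw [finrank_comap, finrank_comap, h])
    obtain ⟨f, hf⟩ := Submodule.exists_linearEquiv_map_eq_s7 (by omega)
      (W₁.comap Q₁.subtype) (W₂.comap Q₂.subtype)
      (by rw [finrank_comap, finrank_comap]; omega)
    obtain ⟨g, hgU, hgQ⟩ := Submodule.exists_linearEquiv_of_isCompl hQ₁ hQ₂ e f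
    have hmU := Submodule.map_eq_map_of_forall_apply_eq (g := (g : V →ₗ[F] V))
      (e := (e : U →ₗ[F] U)) hgU
    have hmQ := Submodule.map_eq_map_of_forall_apply_eq (g := (g : V →ₗ[F] V))
      (e := (f : Q₁ →ₗ[F] Q₂)) hgQ (W₁.comap Q₁.subtype)
    refine ⟨g, by simpa using hmU ⊤, ?_⟩
    have hmI := hmU (W₁.comap U.subtype)
    rw [he, Submodule.map_comap_subtype, Submodule.map_comap_subtype] at hmI
    rw [hf, Submodule.map_comap_subtype, Submodule.map_comap_subtype] at hmQ
    rw [← hs₁, Submodule.map_sup, hmI, hmQ, hs₂]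
end

section
/- Let F be a field and V a finite-dimensional F-vector space. Let U, U', W, W' be subspaces of V with dim U = dim U', dim W = dim W' and dim(U ∩ W) = dim(U' ∩ W'). Then there exists g ∈ GL(V) with g(U) = U' and g(W) = W'. -/
open Module

/-- Two linear maps can be prescribed independently on disjoint subspaces. -/
theorem Submodule.exists_linearMap_map_eq_of_disjoint
    {F V V' : Type*} [Field F] [AddCommGroup V] [Module F V] [AddCommGroup V'] [Module F V']
    {p q : Submodule F V} (h : Disjoint p q) (f g : V →ₗ[F] V') :
    ∃ k : V →ₗ[F] V', (∀ r ≤ p, r.map k = r.map f) ∧ ∀ r ≤ q, r.map k = r.map g := by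
  obtain ⟨p', hp, hc⟩ := h.exists_isCompl
  refine ⟨LinearMap.ofIsCompl hc (f ∘ₗ p'.subtype) (g ∘ₗ q.subtype),
    fun r hr => ?_, fun r hr => ?_⟩
  · refine SetLike.coe_injective (Set.image_congr fun x hx => ?_)
    exact LinearMap.ofIsCompl_apply_left hc ⟨x, hp (hr hx)⟩
  · refine SetLike.coe_injective (Set.image_congr fun x hx => ?_)
    exact LinearMap.ofIsCompl_apply_right hc ⟨x, hr hx⟩

theorem Submodule.exists_linearMap_map_eq_of_finrank_eq
    {F V V' : Type*} [Field F] [AddCommGroup V] [Module F V] [AddCommGroup V'] [Module F V']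
    [FiniteDimensional F V] [FiniteDimensional F V'] {p : Submodule F V} {p' : Submodule F V'}
    (h : finrank F p = finrank F p') :
    ∃ f : V →ₗ[F] V', p.map f = p' := by
  obtain ⟨f, hf⟩ := LinearMap.exists_extend
    (p'.subtype ∘ₗ (LinearEquiv.ofFinrankEq p p' h : p →ₗ[F] p'))
  refine ⟨f, ?_⟩
  rw [← p.range_subtype, ← LinearMap.range_comp, hf, LinearMap.range_comp, LinearEquiv.range,
    Submodule.map_top, Submodule.range_subtype]

/-- Two subspaces split the space into their intersection, relative complements of it in each of
them, and a complement of their sum. -/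
theorem Submodule.exists_adapted_decomposition
    {F V : Type*} [Field F] [AddCommGroup V] [Module F V] (U W : Submodule F V) :
    ∃ C D E : Submodule F V, Disjoint (U ⊓ W) C ∧ (U ⊓ W) ⊔ C = U ∧ Disjoint (U ⊓ W) D ∧
      (U ⊓ W) ⊔ D = W ∧ Disjoint U D ∧ IsCompl (U ⊔ D) E := by
  obtain ⟨C, hC, hC'⟩ := IsModularLattice.exists_disjoint_and_sup_eq (inf_le_left : U ⊓ W ≤ U)
  obtain ⟨D, hD, hD'⟩ := IsModularLattice.exists_disjoint_and_sup_eq (inf_le_right : U ⊓ W ≤ W)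
  obtain ⟨E, hE⟩ := (U ⊔ D).exists_isCompl
  refine ⟨C, D, E, hC, hC', hD, hD', ?_, hE⟩
  have hDW : D ≤ W := hD' ▸ le_sup_right
  rw [disjoint_iff_inf_le] at hD ⊢
  exact (le_inf (inf_le_inf_left U hDW) inf_le_right).trans hD

theorem Submodule.finrank_sup_of_disjoint_s8
    {F V : Type*} [Field F] [AddCommGroup V] [Module F V] [FiniteDimensional F V]
    {p q : Submodule F V} (h : Disjoint p q) :
    finrank F ↥(p ⊔ q) = finrank F p + finrank F q := by
  rw [← Submodule.finrank_sup_add_finrank_inf_eq, h.eq_bot, finrank_bot, add_zero]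

theorem flag_transitivity_of_GL
    {F V : Type*} [Field F] [AddCommGroup V] [Module F V] [FiniteDimensional F V]
    (U U' W W' : Submodule F V)
    (hU : finrank F U = finrank F U') (hW : finrank F W = finrank F W')
    (hUW : finrank F ↥(U ⊓ W) = finrank F ↥(U' ⊓ W')) :
    ∃ g : V ≃ₗ[F] V, U.map (g : V →ₗ[F] V) = U' ∧ W.map (g : V →ₗ[F] V) = W' := by
  obtain ⟨C, D, E, hC, hCU, hD, hDW, hUD, hE⟩ := U.exists_adapted_decomposition W
  obtain ⟨C', D', E', hC', hCU', hD', hDW', hUD', hE'⟩ := U'.exists_adapted_decomposition W'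
  have hCf := Submodule.finrank_sup_of_disjoint_s8 hC
  have hCf' := Submodule.finrank_sup_of_disjoint_s8 hC'
  have hDf := Submodule.finrank_sup_of_disjoint_s8 hD
  have hDf' := Submodule.finrank_sup_of_disjoint_s8 hD'
  have hUDf := Submodule.finrank_sup_of_disjoint_s8 hUD
  have hUDf' := Submodule.finrank_sup_of_disjoint_s8 hUD'
  have hEf := Submodule.finrank_add_eq_of_isCompl hE
  have hEf' := Submodule.finrank_add_eq_of_isCompl hE'
  rw [hCU] at hCf
  rw [hCU'] at hCf'
  rw [hDW] at hDf
  rw [hDW'] at hDf'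
  obtain ⟨fI, hfI⟩ := Submodule.exists_linearMap_map_eq_of_finrank_eq hUW
  obtain ⟨fC, hfC⟩ := Submodule.exists_linearMap_map_eq_of_finrank_eq
    (show finrank F C = finrank F C' by omega)
  obtain ⟨fD, hfD⟩ := Submodule.exists_linearMap_map_eq_of_finrank_eq
    (show finrank F D = finrank F D' by omega)
  obtain ⟨fE, hfE⟩ := Submodule.exists_linearMap_map_eq_of_finrank_eq
    (show finrank F E = finrank F E' by omega)
  obtain ⟨fU, hUI, hUC⟩ := Submodule.exists_linearMap_map_eq_of_disjoint hC fI fC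
  obtain ⟨fUD, hUDU, hUDD⟩ := Submodule.exists_linearMap_map_eq_of_disjoint hUD fU fD
  obtain ⟨f, hfUD, hfE'⟩ := Submodule.exists_linearMap_map_eq_of_disjoint hE.disjoint fUD fE
  have hI : (U ⊓ W).map f = U' ⊓ W' := by
    rw [hfUD _ (inf_le_left.trans le_sup_left), hUDU _ inf_le_left, hUI _ le_rfl, hfI]
  have hmC : C.map f = C' := by
    have hCle : C ≤ U := hCU ▸ le_sup_right
    rw [hfUD _ (hCle.trans le_sup_left), hUDU _ hCle, hUC _ le_rfl, hfC]
  have hmD : D.map f = D' := by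
    rw [hfUD _ le_sup_right, hUDD _ le_rfl, hfD]
  have hmE : E.map f = E' := by
    rw [hfE' _ le_rfl, hfE]
  have hmU : U.map f = U' := by
    rw [← hCU, Submodule.map_sup, hI, hmC, hCU']
  have hmW : W.map f = W' := by
    rw [← hDW, Submodule.map_sup, hI, hmD, hDW']
  have hsurj : LinearMap.range f = ⊤ := by
    rw [LinearMap.range_eq_map, ← hE.sup_eq_top, Submodule.map_sup, Submodule.map_sup, hmU, hmD,
      hmE, hE'.sup_eq_top, hE.sup_eq_top]
  exact ⟨LinearEquiv.ofBijective f
    ⟨LinearMap.injective_iff_surjective.2 (LinearMap.range_eq_top.1 hsurj),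
      LinearMap.range_eq_top.1 hsurj⟩, hmU, hmW⟩
end

section
/- Let F be a field, V an n-dimensional F-vector space, and let m, k, j be integers with 1 ≤ m < n, 1 ≤ k < n and max{0, m + k − n} ≤ j ≤ min{m, k}. Then the following are equivalent: (a) for every pair of distinct m-dimensional subspaces U₁, U₂ of V there exists a k-dimensional subspace W with dim(U₁ ∩ W) = dim(U₂ ∩ W) = j; (b) for every pair of distinct (n − m)-dimensional subspaces U₁, U₂ of V there exists an (n − k)-dimensional subspace W with dim(U₁ ∩ W) = dim(U₂ ∩ W) = n − m − k + j. -/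
open Module

/-- A finite-dimensional vector space admits an order-reversing bijection of its lattice of
subspaces which sends each subspace to one of complementary dimension. -/
theorem exists_orderIso_orderDual_finrank_add (F V : Type*) [Field F] [AddCommGroup V]
    [Module F V] [FiniteDimensional F V] :
    ∃ D : Submodule F V ≃o (Submodule F V)ᵒᵈ,
      ∀ U : Submodule F V, finrank F U + finrank F ↥(OrderDual.ofDual (D U)) = finrank F V := by
  obtain ⟨e⟩ : Nonempty (Dual F V ≃ₗ[F] V) :=
    ⟨LinearEquiv.ofFinrankEq _ _ Subspace.dual_finrank_eq⟩
  refine ⟨(Subspace.orderIsoFiniteDimensional (K := F) (V := V)).trans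
    (Submodule.orderIsoMapComap e).dual, fun U ↦ ?_⟩
  have h : finrank F (U.dualAnnihilator.map (e : Dual F V →ₗ[F] V)) =
      finrank F U.dualAnnihilator := LinearEquiv.finrank_map_eq e _
  rw [← Subspace.finrank_add_finrank_dualAnnihilator_eq U, ← h]
  rfl

/-- If any two distinct `m`-dimensional subspaces meet a common `k`-dimensional subspace in
dimension `j`, then the same holds for the complementary dimensions. -/
theorem exists_finrank_inf_eq_of_dual {F V : Type*} [Field F] [AddCommGroup V] [Module F V]
    [FiniteDimensional F V] {m k j m' k' j' : ℕ} (hm : m + m' = finrank F V)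
    (hk : k + k' = finrank F V) (hj : j' + (m + k) = finrank F V + j)
    (h : ∀ U₁ U₂ : Submodule F V, finrank F U₁ = m → finrank F U₂ = m → U₁ ≠ U₂ →
      ∃ W : Submodule F V, finrank F W = k ∧
        finrank F ↥(U₁ ⊓ W) = j ∧ finrank F ↥(U₂ ⊓ W) = j)
    (U₁ U₂ : Submodule F V) (h₁ : finrank F U₁ = m') (h₂ : finrank F U₂ = m')
    (hne : U₁ ≠ U₂) :
    ∃ W : Submodule F V, finrank F W = k' ∧
      finrank F ↥(U₁ ⊓ W) = j' ∧ finrank F ↥(U₂ ⊓ W) = j' := by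
  obtain ⟨D, hD⟩ := exists_orderIso_orderDual_finrank_add F V
  have finrank_D (U : Submodule F V) (hU : finrank F U = m') :
      finrank F ↥(OrderDual.ofDual (D U)) = m := by
    have := hD U
    omega
  obtain ⟨W, hW, hW₁, hW₂⟩ := h (OrderDual.ofDual (D U₁)) (OrderDual.ofDual (D U₂))
    (finrank_D U₁ h₁) (finrank_D U₂ h₂)
    fun heq ↦ hne (D.injective (OrderDual.ofDual.injective heq))
  have finrank_inf (U : Submodule F V) (hU : finrank F U = m')
      (hUW : finrank F ↥(OrderDual.ofDual (D U) ⊓ W) = j) :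
      finrank F ↥(U ⊓ D.symm (OrderDual.toDual W)) = j' := by
    have hsup : OrderDual.ofDual (D (U ⊓ D.symm (OrderDual.toDual W))) =
        OrderDual.ofDual (D U) ⊔ W := by
      rw [map_inf, D.apply_symm_apply]
      rfl
    have hinf := hD (U ⊓ D.symm (OrderDual.toDual W))
    rw [hsup] at hinf
    have := Submodule.finrank_sup_add_finrank_inf_eq (OrderDual.ofDual (D U)) W
    have := finrank_D U hU
    omega
  refine ⟨D.symm (OrderDual.toDual W), ?_, finrank_inf U₁ h₁ hW₁, finrank_inf U₂ h₂ hW₂⟩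
  have := hD (D.symm (OrderDual.toDual W))
  rw [D.apply_symm_apply, OrderDual.ofDual_toDual] at this
  omega

theorem collinearly_complete_iff_dual
    {F V : Type*} [Field F] [AddCommGroup V] [Module F V] [FiniteDimensional F V]
    (n m k j : ℕ) (hn : finrank F V = n)
    (hm1 : 1 ≤ m) (hmn : m < n) (hk1 : 1 ≤ k) (hkn : k < n)
    (hjl : m + k - n ≤ j) (hju : j ≤ min m k) :
    (∀ U₁ U₂ : Submodule F V, finrank F U₁ = m → finrank F U₂ = m → U₁ ≠ U₂ →
      ∃ W : Submodule F V, finrank F W = k ∧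
        finrank F ↥(U₁ ⊓ W) = j ∧ finrank F ↥(U₂ ⊓ W) = j) ↔
    (∀ U₁ U₂ : Submodule F V, finrank F U₁ = n - m → finrank F U₂ = n - m →
      U₁ ≠ U₂ →
      ∃ W : Submodule F V, finrank F W = n - k ∧
        finrank F ↥(U₁ ⊓ W) = n + j - (m + k) ∧
        finrank F ↥(U₂ ⊓ W) = n + j - (m + k)) := by
  subst hn
  constructor
  · exact exists_finrank_inf_eq_of_dual (by omega) (by omega) (by omega)
  · exact exists_finrank_inf_eq_of_dual (by omega) (by omega) (by omega)
end

section
/- Let F be a finite field with |F| = q, let k ≥ 1, let V be a 2k-dimensional F-vector space, and let m, k1, k2 be integers with 0 ≤ k1 ≤ k2 ≤ k, k1 + k2 ≤ m ≤ k + k1 and 1 ≤ m < 2k. Set m̄ = 2k − m, k̄1 = k − m + k1 and k̄2 = k − m + k2. Then Proj^{m,k}_{(k1,k2)}(V) is collinearly complete if and only if Proj^{m̄,k}_{(k̄1,k̄2)}(V) is collinearly complete, and Proj^{m,k}_{(k1,k2)}(V) is concurrently complete if and only if Proj^{m̄,k}_{(k̄1,k̄2)}(V) is concurrently complete. -/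
open Module

/-- An involutive, inclusion-reversing map on subspaces which complements dimensions. -/
structure IsPolarity {F V : Type*} [Field F] [AddCommGroup V] [Module F V]
    (D : Submodule F V → Submodule F V) : Prop where
  involutive : Function.Involutive D
  antitone : Antitone D
  finrank_add : ∀ U, finrank F (D U) + finrank F U = finrank F V

/-- Every finite-dimensional space has a polarity: orthogonality for the standard bilinear form
of a basis. -/
theorem exists_isPolarity (F V : Type*) [Field F] [AddCommGroup V] [Module F V]
    [FiniteDimensional F V] : ∃ D : Submodule F V → Submodule F V, IsPolarity D := by
  let b := finBasis F V
  let B : LinearMap.BilinForm F V := b.toDual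
  have hflip : B.flip = B := by
    refine b.ext fun i => b.ext fun j => ?_
    simp [B, Basis.toDual_apply, eq_comm]
  have hrefl : B.IsRefl := fun x y h => by
    rw [← hflip]
    exact h
  have hnd : B.Nondegenerate :=
    hrefl.nondegenerate_iff_separatingLeft.2
      (LinearMap.separatingLeft_iff_ker_eq_bot.2 b.toDual_ker)
  refine ⟨B.orthogonal, LinearMap.BilinForm.orthogonal_orthogonal hnd hrefl,
    fun _ _ h => LinearMap.BilinForm.orthogonal_le h, fun U => ?_⟩
  rw [LinearMap.BilinForm.finrank_orthogonal hnd]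
  exact Nat.sub_add_cancel U.finrank_le

namespace IsPolarity

variable {F V : Type*} [Field F] [AddCommGroup V] [Module F V]
  {D : Submodule F V → Submodule F V}

theorem map_sup (hD : IsPolarity D) (U W : Submodule F V) : D (U ⊔ W) = D U ⊓ D W := by
  refine le_antisymm (le_inf (hD.antitone le_sup_left) (hD.antitone le_sup_right)) ?_
  rw [← hD.involutive (D U ⊓ D W)]
  refine hD.antitone (sup_le ?_ ?_)
  · simpa only [hD.involutive U] using hD.antitone (inf_le_left : D U ⊓ D W ≤ D U)
  · simpa only [hD.involutive W] using hD.antitone (inf_le_right : D U ⊓ D W ≤ D W)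

theorem map_inf (hD : IsPolarity D) (U W : Submodule F V) : D (U ⊓ W) = D U ⊔ D W := by
  rw [← hD.involutive (D U ⊔ D W), hD.map_sup, hD.involutive, hD.involutive]

theorem map_top (hD : IsPolarity D) : D ⊤ = ⊥ := by
  rw [eq_bot_iff, ← hD.involutive ⊥]
  exact hD.antitone le_top

theorem map_bot (hD : IsPolarity D) : D ⊥ = ⊤ := by
  rw [← hD.map_top, hD.involutive]

theorem finrank_map (hD : IsPolarity D) {n : ℕ} {U : Submodule F V} (hU : finrank F U = n) :
    finrank F (D U) = finrank F V - n := by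
  have := hD.finrank_add U
  omega

theorem isBisection (hD : IsPolarity D) {k : ℕ} (hV : finrank F V = 2 * k)
    {V₁ V₂ : Submodule F V} (h : IsBisection k V₁ V₂) : IsBisection k (D V₁) (D V₂) := by
  obtain ⟨h₁, h₂, hinf, hsup⟩ := h
  refine ⟨?_, ?_, ?_, ?_⟩
  · rw [hD.finrank_map h₁]
    omega
  · rw [hD.finrank_map h₂]
    omega
  · rw [← hD.map_sup, hsup, hD.map_top]
  · rw [← hD.map_inf, hinf, hD.map_bot]

theorem finrank_map_inf_map [FiniteDimensional F V] (hD : IsPolarity D) {k m j : ℕ}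
    (hV : finrank F V = 2 * k) {U W : Submodule F V} (hU : finrank F U = m)
    (hW : finrank F W = k) (hj : finrank F ↥(U ⊓ W) = j) :
    finrank F ↥(D U ⊓ D W) = k + j - m := by
  have hsum := Submodule.finrank_sup_add_finrank_inf_eq U W
  have hle := (U ⊔ W).finrank_le
  rw [← hD.map_sup, hD.finrank_map rfl]
  omega

theorem incident [FiniteDimensional F V] (hD : IsPolarity D) {k m k₁ k₂ : ℕ}
    (hV : finrank F V = 2 * k) {U V₁ V₂ : Submodule F V} (hU : finrank F U = m)
    (hB : IsBisection k V₁ V₂) (h : Incident k₁ k₂ U V₁ V₂) :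
    Incident (k + k₁ - m) (k + k₂ - m) (D U) (D V₁) (D V₂) :=
  h.imp
    (fun h => ⟨hD.finrank_map_inf_map hV hU hB.1 h.1, hD.finrank_map_inf_map hV hU hB.2.1 h.2⟩)
    (fun h => ⟨hD.finrank_map_inf_map hV hU hB.1 h.1, hD.finrank_map_inf_map hV hU hB.2.1 h.2⟩)

end IsPolarity

theorem CollinearlyComplete.dual {F V : Type*} [Field F] [AddCommGroup V] [Module F V]
    [FiniteDimensional F V] {k m k₁ k₂ : ℕ} (hV : finrank F V = 2 * k) (hm : m ≤ 2 * k)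
    (h : CollinearlyComplete F V m k k₁ k₂) :
    CollinearlyComplete F V (2 * k - m) k (k + k₁ - m) (k + k₂ - m) := by
  obtain ⟨D, hD⟩ := exists_isPolarity F V
  intro U₁ U₂ h₁ h₂ hne
  have hd₁ : finrank F (D U₁) = m := by
    rw [hD.finrank_map h₁]
    omega
  have hd₂ : finrank F (D U₂) = m := by
    rw [hD.finrank_map h₂]
    omega
  obtain ⟨V₁, V₂, hB, hi₁, hi₂⟩ := h _ _ hd₁ hd₂ (hD.involutive.injective.ne hne)
  refine ⟨D V₁, D V₂, hD.isBisection hV hB, ?_, ?_⟩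
  · simpa only [hD.involutive U₁] using hD.incident hV hd₁ hB hi₁
  · simpa only [hD.involutive U₂] using hD.incident hV hd₂ hB hi₂

theorem ConcurrentlyComplete.dual {F V : Type*} [Field F] [AddCommGroup V] [Module F V]
    [FiniteDimensional F V] {k m k₁ k₂ : ℕ} (hV : finrank F V = 2 * k)
    (h : ConcurrentlyComplete F V m k k₁ k₂) :
    ConcurrentlyComplete F V (2 * k - m) k (k + k₁ - m) (k + k₂ - m) := by
  obtain ⟨D, hD⟩ := exists_isPolarity F V
  intro V₁ V₂ V₁' V₂' hB hB' hne
  have hne' : ({D V₁, D V₂} : Set (Submodule F V)) ≠ {D V₁', D V₂'} := by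
    rw [← Set.image_pair, ← Set.image_pair]
    exact hD.involutive.injective.image_injective.ne hne
  obtain ⟨U, hU, hi, hi'⟩ :=
    h _ _ _ _ (hD.isBisection hV hB) (hD.isBisection hV hB') hne'
  refine ⟨D U, by rw [hD.finrank_map hU, hV], ?_, ?_⟩
  · simpa only [hD.involutive V₁, hD.involutive V₂] using
      hD.incident hV hU (hD.isBisection hV hB) hi
  · simpa only [hD.involutive V₁', hD.involutive V₂'] using
      hD.incident hV hU (hD.isBisection hV hB') hi'

theorem subspace_bisection_duality
    (F V : Type*) [Field F] [Fintype F] [AddCommGroup V] [Module F V]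
    [FiniteDimensional F V] (q k m k₁ k₂ : ℕ)
    (hq : Fintype.card F = q) (hk : 1 ≤ k) (hV : finrank F V = 2 * k)
    (hk₁₂ : k₁ ≤ k₂) (hk₂ : k₂ ≤ k) (hmlow : k₁ + k₂ ≤ m) (hmhigh : m ≤ k + k₁)
    (hm1 : 1 ≤ m) (hm2k : m < 2 * k) :
    (CollinearlyComplete F V m k k₁ k₂ ↔
        CollinearlyComplete F V (2 * k - m) k (k + k₁ - m) (k + k₂ - m)) ∧
    (ConcurrentlyComplete F V m k k₁ k₂ ↔
        ConcurrentlyComplete F V (2 * k - m) k (k + k₁ - m) (k + k₂ - m)) := by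
  have hm : 2 * k - (2 * k - m) = m := by omega
  have e₁ : k + (k + k₁ - m) - (2 * k - m) = k₁ := by omega
  have e₂ : k + (k + k₂ - m) - (2 * k - m) = k₂ := by omega
  refine ⟨⟨fun h => h.dual hV hm2k.le, fun h => ?_⟩, ⟨fun h => h.dual hV, fun h => ?_⟩⟩
  · simpa only [hm, e₁, e₂] using h.dual hV (Nat.sub_le _ _)
  · simpa only [hm, e₁, e₂] using h.dual hV
end

section
/- Let F be a finite field with |F| = q, let Y be a finite-dimensional F-vector space, and let Y1, Y2 be subspaces of Y with Y1 ∩ Y2 = 0 and Y1 + Y2 = Y. Let r be an integer with 1 ≤ r ≤ min{dim Y1, dim Y2}. Then there exist subspaces Z1, Z2 of Y with dim Z1 = dim Z2 = r, Z1 ∩ Z2 = 0, and Z_i ∩ Y_j = 0 for all i, j ∈ {1, 2}, if and only if it is not the case that q = 2 and max{dim Y1, dim Y2} = 1. -/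
open Module

/-- A nontrivial finite-dimensional space over a finite field with more than two vectors has an
endomorphism `A` such that both `A` and `A - 1` are injective. -/
theorem exists_end_injective_and_sub_one_injective (F W : Type*) [Field F] [Finite F]
    [AddCommGroup W] [Module F W] [FiniteDimensional F W] [Nontrivial W]
    (hW : 2 < Nat.card F ^ finrank F W) :
    ∃ A : W →ₗ[F] W, (∀ w, A w = 0 → w = 0) ∧ ∀ w, A w = w → w = 0 := by
  obtain ⟨p, hp⟩ := CharP.exists F
  have : Fact p.Prime := ⟨CharP.char_is_prime F p⟩
  have : NeZero (finrank F W) := ⟨finrank_pos.ne'⟩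
  let K := FiniteField.Extension F p (finrank F W)
  let e : K ≃ₗ[F] W := LinearEquiv.ofFinrankEq K W (FiniteField.finrank_extension F p _)
  have : Fintype K := Fintype.ofFinite K
  have hK : 2 < Fintype.card K := by
    rwa [← Nat.card_eq_fintype_card, FiniteField.natCard_extension]
  obtain ⟨x, hx0, hx1⟩ : ∃ x : K, x ≠ 0 ∧ x ≠ 1 := by
    classical
    obtain ⟨x, -, hx⟩ := Finset.exists_mem_notMem_of_card_lt_card
      ((Finset.card_le_two (a := (0 : K)) (b := 1)).trans_lt hK)
    exact ⟨x, by simpa using hx⟩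
  refine ⟨e.toLinearMap ∘ₗ LinearMap.mulLeft F x ∘ₗ e.symm.toLinearMap, fun w hw => ?_,
    fun w hw => ?_⟩
  · simpa [hx0] using hw
  · have h : x * e.symm w = e.symm w := by
      apply e.injective
      simpa using hw
    have h' : (x - 1) * e.symm w = 0 := by rw [sub_mul, h, one_mul, sub_self]
    simpa [sub_eq_zero, hx1] using h'

/-- The image of a sum of two injective linear maps into independent subspaces has the dimension
of the source and meets both subspaces trivially. -/
theorem finrank_range_add_and_inf_eq_bot {F V Y : Type*} [Field F] [AddCommGroup V] [Module F V]
    [AddCommGroup Y] [Module F Y] {Y₁ Y₂ : Submodule F Y} (hdisj : Disjoint Y₁ Y₂)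
    (f : V →ₗ[F] Y₁) (h : V →ₗ[F] Y₂) (hf : ∀ v, f v = 0 → v = 0) (hh : ∀ v, h v = 0 → v = 0) :
    finrank F (LinearMap.range (Y₁.subtype ∘ₗ f + Y₂.subtype ∘ₗ h)) = finrank F V ∧
      LinearMap.range (Y₁.subtype ∘ₗ f + Y₂.subtype ∘ₗ h) ⊓ Y₁ = ⊥ ∧
      LinearMap.range (Y₁.subtype ∘ₗ f + Y₂.subtype ∘ₗ h) ⊓ Y₂ = ⊥ := by
  have h₁ : ∀ v, (f v : Y) + h v ∈ Y₁ → v = 0 := fun v hv => by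
    have := Submodule.disjoint_def.1 hdisj (h v) ((Y₁.add_mem_iff_right (f v).2).1 hv) (h v).2
    exact hh v (Subtype.ext this)
  have h₂ : ∀ v, (f v : Y) + h v ∈ Y₂ → v = 0 := fun v hv => by
    have := Submodule.disjoint_def.1 hdisj (f v) (f v).2 ((Y₂.add_mem_iff_left (h v).2).1 hv)
    exact hf v (Subtype.ext this)
  refine ⟨LinearMap.finrank_range_of_inj ?_, ?_, ?_⟩
  · refine (injective_iff_map_eq_zero _).2 fun v hv => h₁ v ?_
    simp only [LinearMap.add_apply, LinearMap.comp_apply, Submodule.subtype_apply] at hv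
    simp [hv]
  · rw [← disjoint_iff, Submodule.disjoint_def]
    rintro _ ⟨v, rfl⟩ hv
    rw [h₁ v hv, map_zero]
  · rw [← disjoint_iff, Submodule.disjoint_def]
    rintro _ ⟨v, rfl⟩ hv
    rw [h₂ v hv, map_zero]

/-- Two disjoint diagonal `r`-subspaces exist as soon as the first summand has more than two
vectors. -/
theorem exists_two_disjoint_diagonal_subspaces (F Y : Type*) [Field F] [Finite F]
    [AddCommGroup Y] [Module F Y] [FiniteDimensional F Y] {r : ℕ} {Y₁ Y₂ : Submodule F Y}
    (hdisj : Disjoint Y₁ Y₂) (hpos : 0 < finrank F Y₁) (hr₁ : r ≤ finrank F Y₁)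
    (hr₂ : r ≤ finrank F Y₂) (hcard : 2 < Nat.card F ^ finrank F Y₁) :
    ∃ Z₁ Z₂ : Submodule F Y, finrank F Z₁ = r ∧ finrank F Z₂ = r ∧
      Z₁ ⊓ Z₂ = ⊥ ∧ Z₁ ⊓ Y₁ = ⊥ ∧ Z₁ ⊓ Y₂ = ⊥ ∧ Z₂ ⊓ Y₁ = ⊥ ∧ Z₂ ⊓ Y₂ = ⊥ := by
  have : Nontrivial Y₁ := finrank_pos_iff.1 hpos
  obtain ⟨A, hA0, hA1⟩ := exists_end_injective_and_sub_one_injective F Y₁ hcard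
  obtain ⟨f, hf⟩ := finrank_le_iff_exists_linearMap.1
    ((finrank_fin_fun F).trans_le hr₁ : finrank F (Fin r → F) ≤ finrank F Y₁)
  obtain ⟨h, hh⟩ := finrank_le_iff_exists_linearMap.1
    ((finrank_fin_fun F).trans_le hr₂ : finrank F (Fin r → F) ≤ finrank F Y₂)
  have hf := (injective_iff_map_eq_zero f).1 hf
  have hh₀ := (injective_iff_map_eq_zero h).1 hh
  obtain ⟨a₁, a₂, a₃⟩ := finrank_range_add_and_inf_eq_bot hdisj f h hf hh₀
  obtain ⟨b₁, b₂, b₃⟩ := finrank_range_add_and_inf_eq_bot hdisj (A ∘ₗ f) h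
    (fun v hv => hf v (hA0 _ hv)) hh₀
  refine ⟨_, _, a₁.trans (finrank_fin_fun F), b₁.trans (finrank_fin_fun F), ?_, a₂, a₃, b₂, b₃⟩
  rw [← disjoint_iff, Submodule.disjoint_def]
  rintro _ ⟨v, rfl⟩ ⟨w, hw⟩
  simp only [LinearMap.add_apply, LinearMap.comp_apply, Submodule.subtype_apply] at hw
  have key : ((A (f w) - f v : Y₁) : Y) = ((h v - h w : Y₂) : Y) := by
    push_cast
    rw [sub_eq_sub_iff_add_eq_add, hw, add_comm]
  have hz : ((h v - h w : Y₂) : Y) = 0 :=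
    Submodule.disjoint_def.1 hdisj _ (key ▸ (A (f w) - f v).2) (h v - h w).2
  obtain rfl : v = w := hh (sub_eq_zero.1 (Subtype.ext hz))
  have hAf : A (f v) = f v := sub_eq_zero.1 (Subtype.ext (key.trans hz))
  rw [hf v (hA1 _ hAf), map_zero]

/-- Over a field with two elements, a line has a unique nonzero vector. -/
theorem eq_of_ne_zero_of_finrank_eq_one {F V : Type*} [Field F] [Fintype F] [AddCommGroup V]
    [Module F V] (hF : Fintype.card F = 2) (hV : finrank F V = 1) {v w : V} (hv : v ≠ 0)
    (hw : w ≠ 0) : v = w := by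
  obtain ⟨c, rfl⟩ := (finrank_eq_one_iff_of_nonzero' v hv).1 hV w
  have hc : c ≠ 0 := fun h => hw (by rw [h, zero_smul])
  have hc1 : c = 1 := by
    have := FiniteField.pow_card_sub_one_eq_one c hc
    simpa [hF] using this
  rw [hc1, one_smul]

theorem exists_two_disjoint_diagonal_subspaces_iff
    (F Y : Type*) [Field F] [Fintype F] [AddCommGroup Y] [Module F Y]
    [FiniteDimensional F Y] (q r : ℕ) (hq : Fintype.card F = q)
    (Y₁ Y₂ : Submodule F Y) (hdisj : Y₁ ⊓ Y₂ = ⊥) (hspan : Y₁ ⊔ Y₂ = ⊤)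
    (hr1 : 1 ≤ r) (hr : r ≤ min (finrank F Y₁) (finrank F Y₂)) :
    (∃ Z₁ Z₂ : Submodule F Y, finrank F Z₁ = r ∧ finrank F Z₂ = r ∧
        Z₁ ⊓ Z₂ = ⊥ ∧ Z₁ ⊓ Y₁ = ⊥ ∧ Z₁ ⊓ Y₂ = ⊥ ∧ Z₂ ⊓ Y₁ = ⊥ ∧ Z₂ ⊓ Y₂ = ⊥) ↔
      ¬(q = 2 ∧ max (finrank F Y₁) (finrank F Y₂) = 1) := by
  obtain ⟨hr₁, hr₂⟩ := le_min_iff.1 hr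
  constructor
  · rintro ⟨Z₁, Z₂, hZ₁, hZ₂, h₁₂, h₁₁', h₁₂', h₂₁', h₂₂'⟩ ⟨hq2, hmax⟩
    have hd₁ : finrank F Y₁ = 1 := by omega
    have hd₂ : finrank F Y₂ = 1 := by omega
    have decompose : ∀ Z : Submodule F Y, finrank F Z = r → Z ⊓ Y₁ = ⊥ → Z ⊓ Y₂ = ⊥ →
        ∃ a : Y₁, ∃ b : Y₂, a ≠ 0 ∧ b ≠ 0 ∧ (a + b : Y) ∈ Z := by
      intro Z hZ hZY₁ hZY₂
      have hZ0 : Z ≠ ⊥ := by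
        rintro rfl
        rw [finrank_bot] at hZ
        omega
      obtain ⟨z, hz, hz0⟩ := Z.exists_mem_ne_zero_of_ne_bot hZ0
      obtain ⟨a, ha, b, hb, rfl⟩ := Submodule.mem_sup.1 (hspan ▸ Submodule.mem_top : z ∈ Y₁ ⊔ Y₂)
      refine ⟨⟨a, ha⟩, ⟨b, hb⟩, fun h => hz0 ?_, fun h => hz0 ?_, hz⟩
      · obtain rfl : a = 0 := congrArg Subtype.val h
        exact Submodule.disjoint_def.1 (disjoint_iff.2 hZY₂) _ hz (by simpa using hb)
      · obtain rfl : b = 0 := congrArg Subtype.val h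
        exact Submodule.disjoint_def.1 (disjoint_iff.2 hZY₁) _ hz (by simpa using ha)
    obtain ⟨a, b, ha, hb, hab⟩ := decompose Z₁ hZ₁ h₁₁' h₁₂'
    obtain ⟨a', b', ha', hb', hab'⟩ := decompose Z₂ hZ₂ h₂₁' h₂₂'
    obtain rfl := eq_of_ne_zero_of_finrank_eq_one (hq.trans hq2) hd₁ ha ha'
    obtain rfl := eq_of_ne_zero_of_finrank_eq_one (hq.trans hq2) hd₂ hb hb'
    have h0 := Submodule.disjoint_def.1 (disjoint_iff.2 h₁₂) _ hab hab'
    have haY₂ : (a : Y) ∈ Y₂ := by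
      rw [eq_neg_of_add_eq_zero_left h0]
      exact Y₂.neg_mem b.2
    exact ha (Subtype.ext (Submodule.disjoint_def.1 (disjoint_iff.2 hdisj) _ a.2 haY₂))
  · intro hne
    have hq1 : 1 < q := hq ▸ Fintype.one_lt_card
    have hcardF : Nat.card F = q := Nat.card_eq_fintype_card.trans hq
    have two_lt : ∀ n, 1 ≤ n → ¬(q = 2 ∧ n = 1) → 2 < Nat.card F ^ n := by
      intro n hn hqn
      rw [hcardF]
      by_cases hn1 : n = 1
      · subst hn1
        rw [pow_one]
        omega
      · calc 2 < 2 ^ 2 := by norm_num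
          _ ≤ q ^ 2 := Nat.pow_le_pow_left hq1 2
          _ ≤ q ^ n := Nat.pow_le_pow_right (by omega) (by omega)
    rcases le_total (finrank F Y₂) (finrank F Y₁) with hle | hle
    · rw [max_eq_left hle] at hne
      exact exists_two_disjoint_diagonal_subspaces F Y (disjoint_iff.2 hdisj) (by omega) hr₁ hr₂
        (two_lt _ (by omega) hne)
    · rw [max_eq_right hle] at hne
      obtain ⟨Z₁, Z₂, h₁, h₂, h₁₂, h₁₁', h₁₂', h₂₁', h₂₂'⟩ :=
        exists_two_disjoint_diagonal_subspaces F Y (disjoint_iff.2 hdisj).symm (by omega) hr₂ hr₁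
          (two_lt _ (by omega) hne)
      exact ⟨Z₁, Z₂, h₁, h₂, h₁₂, h₁₂', h₁₁', h₂₂', h₂₁'⟩
end

section
/- Let F be a finite field with |F| = q, let m, k be integers with 1 ≤ m ≤ k, and let V be a 2k-dimensional F-vector space. Then the following are equivalent: (a) for every pair of distinct m-dimensional subspaces U1, U2 of V there exist k-dimensional subspaces V1, V2 of V with V1 ∩ V2 = 0, V1 + V2 = V, and U_i ∩ V_j = 0 for all i, j ∈ {1, 2}; (b) (q, m, k) ≠ (2, 1, 1). -/
open Module

namespace Submodule

variable {F V : Type*} [Field F] [AddCommGroup V] [Module F V]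

theorem exists_notMem_and_notMem_of_ne_top_s12 {U₁ U₂ : Submodule F V} (h₁ : U₁ ≠ ⊤) (h₂ : U₂ ≠ ⊤) :
    ∃ x, x ∉ U₁ ∧ x ∉ U₂ := by
  by_cases h₁₂ : U₁ ≤ U₂
  · obtain ⟨x, hx⟩ := SetLike.exists_not_mem_of_ne_top U₂ h₂ rfl
    exact ⟨x, fun h => hx (h₁₂ h), hx⟩
  by_cases h₂₁ : U₂ ≤ U₁
  · obtain ⟨x, hx⟩ := SetLike.exists_not_mem_of_ne_top U₁ h₁ rfl
    exact ⟨x, hx, fun h => hx (h₂₁ h)⟩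
  obtain ⟨a, ha₁, ha₂⟩ := SetLike.not_le_iff_exists.mp h₁₂
  obtain ⟨b, hb₂, hb₁⟩ := SetLike.not_le_iff_exists.mp h₂₁
  exact ⟨a + b, fun h => hb₁ ((U₁.add_mem_iff_right ha₁).mp h),
    fun h => ha₂ ((U₂.add_mem_iff_left hb₂).mp h)⟩

theorem isCompl_span_singleton_sup {U W : Submodule F V} {x : V} (hx : x ∉ U)
    (h : IsCompl (U ⊔ span F {x}) W) : IsCompl U (span F {x} ⊔ W) :=
  ⟨(disjoint_span_singleton_of_notMem hx).disjoint_sup_right_of_disjoint_sup_left h.disjoint,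
    codisjoint_iff.mpr (by rw [← sup_assoc, h.sup_eq_top])⟩

/-- In a plane over the field with two elements, only one line avoids two distinct given lines:
the span of the sum of their generators. -/
theorem add_mem_of_disjoint_span_singleton [Fintype F] (hF : Fintype.card F = 2)
    (b : Basis (Fin 2) F V) {W : Submodule F V} (hW : W ≠ ⊥) (h₀ : Disjoint (span F {b 0}) W)
    (h₁ : Disjoint (span F {b 1}) W) : b 0 + b 1 ∈ W := by
  have hF' (c : F) (hc : c ≠ 0) : c = 1 := by
    simpa [hF] using FiniteField.pow_card_sub_one_eq_one c hc
  obtain ⟨w, hw, hw0⟩ := W.exists_mem_ne_zero_of_ne_bot hW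
  have hrepr := b.sum_repr w
  rw [Fin.sum_univ_two] at hrepr
  have c₀ : b.repr w 0 ≠ 0 := fun h => hw0 <| disjoint_def.mp h₁ w
    (mem_span_singleton.mpr ⟨_, by simpa [h] using hrepr⟩) hw
  have c₁ : b.repr w 1 ≠ 0 := fun h => hw0 <| disjoint_def.mp h₀ w
    (mem_span_singleton.mpr ⟨_, by simpa [h] using hrepr⟩) hw
  rw [hF' _ c₀, hF' _ c₁, one_smul, one_smul] at hrepr
  rwa [hrepr]

variable [FiniteDimensional F V]

theorem exists_isCompl_and_isCompl_of_finrank_eq (U₁ U₂ : Submodule F V)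
    (h : finrank F U₁ = finrank F U₂) : ∃ W, IsCompl U₁ W ∧ IsCompl U₂ W := by
  induction hn : finrank F V - finrank F U₁ generalizing U₁ U₂ with
  | zero =>
    have h₁ : U₁ = ⊤ := eq_top_of_finrank_eq (by have := U₁.finrank_le; omega)
    have h₂ : U₂ = ⊤ := eq_top_of_finrank_eq (by have := U₁.finrank_le; omega)
    exact ⟨⊥, h₁ ▸ isCompl_top_bot, h₂ ▸ isCompl_top_bot⟩
  | succ n ih =>
    have h₁ : U₁ ≠ ⊤ := by rintro rfl; simp at hn
    have h₂ : U₂ ≠ ⊤ := by rintro rfl; simp [h] at hn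
    obtain ⟨x, hx₁, hx₂⟩ := exists_notMem_and_notMem_of_ne_top_s12 h₁ h₂
    have e₁ := finrank_sup_span_singleton (K := F) hx₁
    have e₂ := finrank_sup_span_singleton (K := F) hx₂
    obtain ⟨W, hW₁, hW₂⟩ := ih (U₁ ⊔ span F {x}) (U₂ ⊔ span F {x}) (by omega) (by omega)
    exact ⟨span F {x} ⊔ W, isCompl_span_singleton_sup hx₁ hW₁, isCompl_span_singleton_sup hx₂ hW₂⟩

theorem exists_le_finrank_eq_s12 (U : Submodule F V) {k : ℕ} (hU : finrank F U ≤ k)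
    (hk : k ≤ finrank F V) : ∃ W, U ≤ W ∧ finrank F W = k := by
  induction k, hU using Nat.le_induction with
  | base => exact ⟨U, le_rfl, rfl⟩
  | succ k _ ih =>
    obtain ⟨W, hUW, hW⟩ := ih (by omega)
    obtain ⟨x, hx⟩ := SetLike.exists_not_mem_of_ne_top W (by rintro rfl; simp at hW; omega) rfl
    exact ⟨W ⊔ span F {x}, hUW.trans le_sup_left, by rw [finrank_sup_span_singleton hx, hW]⟩

theorem isCompl_of_disjoint_of_finrank_add {U W : Submodule F V} (h : Disjoint U W)
    (hd : finrank F U + finrank F W = finrank F V) : IsCompl U W := by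
  refine ⟨h, codisjoint_iff.mpr (eq_top_of_finrank_eq ?_)⟩
  have := finrank_sup_add_finrank_inf_eq U W
  rw [h.eq_bot, finrank_bot] at this
  omega

end Submodule

namespace Matrix

variable {F : Type*} [Field F]

open Polynomial in
theorem exists_isUnit_and_isUnit_sub_one {n : ℕ} (h : 2 ≤ n ∨ ∃ c : F, c ≠ 0 ∧ c ≠ 1) :
    ∃ A : Matrix (Fin n) (Fin n) F, IsUnit A ∧ IsUnit (A - 1) := by
  rcases h with h | ⟨c, hc0, hc1⟩
  · -- multiplication by the root of `X ^ n - X - 1`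
    obtain ⟨p, hp⟩ : ∃ p : F[X], p = X ^ n - X - 1 := ⟨_, rfl⟩
    have hdeg : p.natDegree = n := by
      rw [hp]
      compute_degree!
      · rw [if_neg (by omega), if_neg (by omega)]; simp
      all_goals omega
    have hmonic : p.Monic := by
      rw [hp, sub_sub]
      refine monic_X_pow_sub ((degree_X_add_C (1 : F)).trans_lt ?_)
      exact_mod_cast h
    subst hdeg
    have hroot : AdjoinRoot.root p ^ p.natDegree - AdjoinRoot.root p - 1 = 0 := by
      have h0 : AdjoinRoot.mk p p = 0 := AdjoinRoot.mk_self
      conv at h0 => lhs; arg 2; rw [hp]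
      simpa using h0
    have u : IsUnit (AdjoinRoot.root p) := by
      refine IsUnit.of_mul_eq_one (AdjoinRoot.root p ^ (p.natDegree - 1) - 1) ?_
      rw [mul_sub, mul_pow_sub_one (by omega)]
      linear_combination hroot
    have u' : IsUnit (AdjoinRoot.root p - 1) := by
      obtain ⟨y, hy⟩ := sub_one_dvd_pow_sub_one (AdjoinRoot.root p) p.natDegree
      refine IsUnit.of_mul_eq_one (y - 1) ?_
      linear_combination hroot - hy
    let φ := Algebra.leftMulMatrix (AdjoinRoot.powerBasisAux' hmonic)
    exact ⟨φ (AdjoinRoot.root p), u.map φ, by simpa using u'.map φ⟩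
  · have hscalar {c : F} (hc : c ≠ 0) : IsUnit (scalar (Fin n) c) := hc.isUnit.map _
    exact ⟨scalar (Fin n) c, hscalar hc0, by
      simpa only [map_sub, map_one] using hscalar (sub_ne_zero.mpr hc1)⟩

open scoped Fin.CommRing in
theorem exists_isUnit_and_isUnit_sub_diagonal {n : ℕ} {d : Fin n → F} {i₀ : Fin n}
    (hd : d i₀ = 0) :
    ∃ A : Matrix (Fin n) (Fin n) F, IsUnit A ∧ IsUnit (A - diagonal d) := by
  have : NeZero n := ⟨by rintro rfl; exact i₀.elim0⟩
  let A : Matrix (Fin n) (Fin n) F := of fun i j => if j = i + 1 then 1 else 0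
  have hA (v : Fin n → F) (i : Fin n) : (A *ᵥ v) i = v (i + 1) := by
    simp [A, mulVec, dotProduct]
  refine ⟨A, ?_, ?_⟩
  · rw [← mulVec_injective_iff_isUnit]
    intro v w hvw
    ext i
    simpa [hA] using congr_fun hvw (i - 1)
  · rw [← mulVec_injective_iff_isUnit]
    refine (injective_iff_map_eq_zero (mulVecLin (A - diagonal d))).mpr fun v hv => ?_
    have hv (i : Fin n) : v (i + 1) = d i * v i := by
      simpa [sub_mulVec, hA, mulVec_diagonal, sub_eq_zero] using congr_fun hv i
    have hzero (j : ℕ) : v (i₀ + 1 + (j : Fin n)) = 0 := by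
      induction j with
      | zero => simp [hv, hd]
      | succ j ih => rw [Nat.cast_succ, ← add_assoc, hv, ih, mul_zero]
    ext i
    simpa using hzero (i - (i₀ + 1)).val

/-- Every `n × n` matrix over a field is a sum of two invertible ones, provided that `2 ≤ n` or
that the field has more than two elements. -/
theorem exists_isUnit_and_isUnit_sub {n : ℕ} (h : 2 ≤ n ∨ ∃ c : F, c ≠ 0 ∧ c ≠ 1)
    (M : Matrix (Fin n) (Fin n) F) : ∃ A : Matrix (Fin n) (Fin n) F, IsUnit A ∧ IsUnit (A - M) := by
  obtain ⟨L, L', d, hM⟩ := Pivot.exists_list_transvec_mul_diagonal_mul_list_transvec M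
  have hL (L : List (TransvectionStruct (Fin n) F)) :
      IsUnit (L.map TransvectionStruct.toMatrix).prod := by
    simp [isUnit_iff_isUnit_det]
  suffices ∃ A : Matrix (Fin n) (Fin n) F, IsUnit A ∧ IsUnit (A - diagonal d) by
    obtain ⟨A, hA, hAd⟩ := this
    refine ⟨_, ((hL L).mul hA).mul (hL L'), ?_⟩
    rw [hM, ← sub_mul, ← mul_sub]
    exact ((hL L).mul hAd).mul (hL L')
  by_cases hd : ∃ i, d i = 0
  · obtain ⟨i, hi⟩ := hd
    exact exists_isUnit_and_isUnit_sub_diagonal hi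
  · push Not at hd
    have hD : IsUnit (diagonal d) := by
      simpa [isUnit_iff_isUnit_det, Finset.prod_ne_zero_iff] using hd
    obtain ⟨A, hA, hA1⟩ := exists_isUnit_and_isUnit_sub_one (F := F) h
    exact ⟨diagonal d * A, hD.mul hA, by simpa [mul_sub] using hD.mul hA1⟩

end Matrix

theorem LinearMap.exists_injective_and_injective_sub {F E E' : Type*} [Field F]
    [AddCommGroup E] [Module F E] [FiniteDimensional F E]
    [AddCommGroup E'] [Module F E'] [FiniteDimensional F E'] {n : ℕ}
    (hE : finrank F E = n) (hE' : finrank F E' = n)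
    (h : 2 ≤ n ∨ ∃ c : F, c ≠ 0 ∧ c ≠ 1) (T : E →ₗ[F] E') :
    ∃ S : E →ₗ[F] E', Function.Injective S ∧ Function.Injective (S - T) := by
  let b := finBasisOfFinrankEq F E hE
  let b' := finBasisOfFinrankEq F E' hE'
  have key (f : E →ₗ[F] E') (hf : IsUnit (toMatrix b b' f)) : Function.Injective f := by
    intro x y hxy
    apply b.repr.injective
    apply DFunLike.coe_injective
    apply Matrix.mulVec_injective_of_isUnit hf
    rw [toMatrix_mulVec_repr, toMatrix_mulVec_repr, hxy]
  obtain ⟨A, hA, hAT⟩ := Matrix.exists_isUnit_and_isUnit_sub h (toMatrix b b' T)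
  refine ⟨Matrix.toLin b b' A, key _ (by simpa using hA), key _ (by simpa using hAT)⟩

namespace Submodule

variable {F V : Type*} [Field F] [AddCommGroup V] [Module F V] [FiniteDimensional F V]

theorem exists_isCompl_of_finrank_eq_half {k : ℕ} (hV : finrank F V = 2 * k)
    (h : 2 ≤ k ∨ ∃ c : F, c ≠ 0 ∧ c ≠ 1) {U₁ U₂ : Submodule F V}
    (h₁ : finrank F U₁ = k) (h₂ : finrank F U₂ = k) :
    ∃ V₁ V₂ : Submodule F V, finrank F V₁ = k ∧ finrank F V₂ = k ∧ IsCompl V₁ V₂ ∧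
      Disjoint U₁ V₁ ∧ Disjoint U₁ V₂ ∧ Disjoint U₂ V₁ ∧ Disjoint U₂ V₂ := by
  obtain ⟨W, hW₁, hW₂⟩ := exists_isCompl_and_isCompl_of_finrank_eq U₁ U₂ (h₁.trans h₂.symm)
  have hW : finrank F W = k := by have := finrank_add_eq_of_isCompl hW₁; omega
  -- `U₂` is the graph of a linear map `T : U₁ → W`
  obtain ⟨T, hT⟩ : ∃ T : U₁ →ₗ[F] W, ∀ u : U₁, (u : V) + T u ∈ U₂ := by
    refine ⟨-(W.projectionOnto U₂ hW₂.symm ∘ₗ U₁.subtype), fun u => ?_⟩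
    rw [← projectionOnto_apply_eq_zero_iff hW₂.symm]
    simp [-coe_projectionOnto_apply]
  obtain ⟨S, hS, hST⟩ := LinearMap.exists_injective_and_injective_sub h₁ hW h T
  let G : U₁ →ₗ[F] V := U₁.subtype + W.subtype ∘ₗ S
  have hG (u : U₁) : G u = u + S u := rfl
  have hdW : Disjoint W (LinearMap.range G) := by
    rw [disjoint_def]
    rintro _ hx ⟨u, rfl⟩
    have hu : (u : V) ∈ W := (W.add_mem_iff_left (S u).2).mp hx
    have : u = 0 := Subtype.ext (disjoint_def.mp hW₁.disjoint _ u.2 hu)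
    simp [this]
  have hGinj : Function.Injective G := by
    rw [injective_iff_map_eq_zero]
    intro u hu
    have hu : (u : V) ∈ W := (W.add_mem_iff_left (S u).2).mp (by rw [← hG, hu]; exact W.zero_mem)
    exact Subtype.ext (disjoint_def.mp hW₁.disjoint _ u.2 hu)
  have hGk : finrank F (LinearMap.range G) = k := by
    rw [LinearMap.finrank_range_of_inj hGinj, h₁]
  refine ⟨W, LinearMap.range G, hW, hGk, isCompl_of_disjoint_of_finrank_add hdW (by omega),
    hW₁.disjoint, ?_, hW₂.disjoint, ?_⟩
  · rw [disjoint_def]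
    rintro _ hx ⟨u, rfl⟩
    have hu : (S u : V) ∈ U₁ := (U₁.add_mem_iff_right u.2).mp hx
    have hSu : S u = 0 := Subtype.ext (disjoint_def.mp hW₁.disjoint _ hu (S u).2)
    have : u = 0 := hS (by rw [hSu, map_zero])
    simp [this]
  · rw [disjoint_def]
    rintro _ hx ⟨u, rfl⟩
    have hu : ((S - T) u : V) ∈ U₂ := by
      have := U₂.sub_mem hx (hT u)
      rwa [hG, add_sub_add_left_eq_sub] at this
    have hSu : (S - T) u = 0 := Subtype.ext (disjoint_def.mp hW₂.disjoint _ hu ((S - T) u).2)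
    have : u = 0 := hST (by rw [hSu, map_zero])
    simp [this]

end Submodule

theorem collinearlyComplete_zero_zero_iff
    (F V : Type*) [Field F] [Fintype F] [AddCommGroup V] [Module F V]
    [FiniteDimensional F V] (q m k : ℕ)
    (hq : Fintype.card F = q) (hm1 : 1 ≤ m) (hmk : m ≤ k)
    (hV : finrank F V = 2 * k) :
    (∀ U₁ U₂ : Submodule F V, finrank F U₁ = m → finrank F U₂ = m → U₁ ≠ U₂ →
      ∃ V₁ V₂ : Submodule F V, finrank F V₁ = k ∧ finrank F V₂ = k ∧
        V₁ ⊓ V₂ = ⊥ ∧ V₁ ⊔ V₂ = ⊤ ∧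
        U₁ ⊓ V₁ = ⊥ ∧ U₁ ⊓ V₂ = ⊥ ∧ U₂ ⊓ V₁ = ⊥ ∧ U₂ ⊓ V₂ = ⊥) ↔
      (q, m, k) ≠ (2, 1, 1) := by
  subst hq
  constructor
  · intro H hqmk
    obtain ⟨hF, rfl, rfl⟩ : Fintype.card F = 2 ∧ m = 1 ∧ k = 1 := by simpa using hqmk
    let b := finBasisOfFinrankEq F V hV
    have hb (i : Fin (2 * 1)) : finrank F (Submodule.span F {b i}) = 1 :=
      finrank_span_singleton (b.ne_zero i)
    obtain ⟨V₁, V₂, d₁, d₂, h₁₂, -, h₁₁, h₁₂', h₂₁, h₂₂⟩ :=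
      H (.span F {b 0}) (.span F {b 1}) (hb 0) (hb 1) (by
        intro h
        obtain ⟨c, hc⟩ := Submodule.mem_span_singleton.mp
          (h ▸ Submodule.mem_span_singleton_self (b 0))
        simpa using congr_arg (fun v => b.repr v 0) hc)
    have ne_bot {W : Submodule F V} (hW : finrank F W = 1) : W ≠ ⊥ := by
      rintro rfl; simp at hW
    have m₁ := Submodule.add_mem_of_disjoint_span_singleton hF b (ne_bot d₁)
      (disjoint_iff.mpr h₁₁) (disjoint_iff.mpr h₂₁)
    have m₂ := Submodule.add_mem_of_disjoint_span_singleton hF b (ne_bot d₂)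
      (disjoint_iff.mpr h₁₂') (disjoint_iff.mpr h₂₂)
    have h0 : b 0 + b 1 = 0 := Submodule.disjoint_def.mp (disjoint_iff.mpr h₁₂) _ m₁ m₂
    have := congr_arg (fun v => b.repr v 0) h0
    simp at this
  · intro hqmk U₁ U₂ h₁ h₂ _
    have h : 2 ≤ k ∨ ∃ c : F, c ≠ 0 ∧ c ≠ 1 := by
      by_contra! h
      obtain ⟨hk, hc⟩ := h
      obtain rfl : k = 1 := by omega
      obtain rfl : m = 1 := by omega
      classical
      have huniv : (Finset.univ : Finset F) = {0, 1} := by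
        ext c
        simpa [or_iff_not_imp_left] using hc c
      rw [← Finset.card_univ, huniv, Finset.card_pair zero_ne_one] at hqmk
      exact hqmk rfl
    obtain ⟨U₁', hU₁, h₁'⟩ := U₁.exists_le_finrank_eq_s12 (h₁.trans_le hmk) (by omega)
    obtain ⟨U₂', hU₂, h₂'⟩ := U₂.exists_le_finrank_eq_s12 (h₂.trans_le hmk) (by omega)
    obtain ⟨V₁, V₂, d₁, d₂, hc, h₁₁, h₁₂, h₂₁, h₂₂⟩ :=
      Submodule.exists_isCompl_of_finrank_eq_half hV h h₁' h₂'
    exact ⟨V₁, V₂, d₁, d₂, hc.inf_eq_bot, hc.sup_eq_top, (h₁₁.mono_left hU₁).eq_bot,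
      (h₁₂.mono_left hU₁).eq_bot, (h₂₁.mono_left hU₂).eq_bot, (h₂₂.mono_left hU₂).eq_bot⟩
end

section
/- Let F be the field with 2 elements, let k be an integer with 2 ≤ k ≤ 4, and let V be a 2k-dimensional F-vector space. Then for every pair of distinct k-dimensional subspaces U1, U2 of V there exist k-dimensional subspaces V1, V2 of V with V1 ∩ V2 = 0 and V1 + V2 = V such that for each i ∈ {1, 2} the unordered pair (dim(U_i ∩ V1), dim(U_i ∩ V2)) equals (0, k − 1). -/
open Module

section

variable {F V : Type*} [Field F] [AddCommGroup V] [Module F V]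

/-- Some bisection of `V` is incident with both `U₁` and `U₂` in the geometry of type
`(0, k - 1)`. -/
def HasCommonBisection (k : ℕ) (U₁ U₂ : Submodule F V) : Prop :=
  ∃ V₁ V₂ : Submodule F V, finrank F V₁ = k ∧ finrank F V₂ = k ∧
    V₁ ⊓ V₂ = ⊥ ∧ V₁ ⊔ V₂ = ⊤ ∧
    Incident 0 (k - 1) U₁ V₁ V₂ ∧ Incident 0 (k - 1) U₂ V₁ V₂

theorem disjoint_sup_span_singleton {A B : Submodule F V} {v : V} (hAB : Disjoint A B)
    (hv : v ∉ A ⊔ B) : Disjoint A (B ⊔ F ∙ v) :=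
  hAB.disjoint_sup_right_of_disjoint_sup_left
    (Submodule.disjoint_span_singleton.2 fun h => absurd h hv)

theorem smul_mem_imp_eq_zero {A : Submodule F V} {v : V} (hv : v ∉ A) {t : F}
    (h : t • v ∈ A) : t = 0 := by
  by_contra ht
  exact hv ((A.smul_mem_iff ht).1 h)

theorem finrank_inf_of_disjoint {A B : Submodule F V} (h : Disjoint A B) :
    finrank F ↥(A ⊓ B) = 0 := by
  rw [h.eq_bot, finrank_bot]

variable [FiniteDimensional F V] {k : ℕ} {U₁ U₂ : Submodule F V}

theorem finrank_sup_of_disjoint {A B : Submodule F V} (h : Disjoint A B) :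
    finrank F ↥(A ⊔ B) = finrank F A + finrank F B := by
  rw [← Submodule.finrank_sup_add_finrank_inf_eq, h.eq_bot, finrank_bot, add_zero]

theorem finrank_inf_eq_pred {U X H : Submodule F V} (hU : finrank F U = k)
    (hX : finrank F X = k) (hH : finrank F H + 1 = k) (hHU : H ≤ U) (hHX : H ≤ X)
    (hne : U ≠ X) : finrank F ↥(U ⊓ X) = k - 1 := by
  have h1 := Submodule.finrank_mono (le_inf hHU hHX)
  have h2 : U ⊓ X < U := by
    refine lt_of_le_of_ne inf_le_left fun h => hne ?_
    exact Submodule.eq_of_le_of_finrank_eq (inf_eq_left.1 h) (hU.trans hX.symm)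
  have h3 := Submodule.finrank_lt_finrank_of_lt h2
  omega

/-- A bisection `{H₁ + v₁, H₂ + v₂}` in which each part meets exactly one of `U₁`, `U₂`. -/
theorem hasCommonBisection_of_separate (hV : finrank F V = 2 * k)
    (hU₁ : finrank F U₁ = k) (hU₂ : finrank F U₂ = k) {H₁ H₂ : Submodule F V} {v₁ v₂ : V}
    (hH₁ : finrank F H₁ + 1 = k) (hH₂ : finrank F H₂ + 1 = k) (hHU₁ : H₁ ≤ U₁) (hHU₂ : H₂ ≤ U₂)
    (h₁₂ : Disjoint U₁ H₂) (h₂₁ : Disjoint U₂ H₁) (hv₁ : v₁ ∉ U₁) (hv₂ : v₂ ∉ U₂)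
    (hv₁' : v₁ ∉ U₂ ⊔ H₁) (hv₂' : v₂ ∉ U₁ ⊔ H₂) (hv : v₁ ∉ (H₂ ⊔ F ∙ v₂) ⊔ H₁) :
    HasCommonBisection k U₁ U₂ := by
  have e₁ : finrank F ↥(H₁ ⊔ F ∙ v₁) = k := by
    rw [Submodule.finrank_sup_span_singleton fun h => hv₁ (hHU₁ h), hH₁]
  have e₂ : finrank F ↥(H₂ ⊔ F ∙ v₂) = k := by
    rw [Submodule.finrank_sup_span_singleton fun h => hv₂ (hHU₂ h), hH₂]
  have d₁ : Disjoint U₁ (H₂ ⊔ F ∙ v₂) := disjoint_sup_span_singleton h₁₂ hv₂'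
  have d₂ : Disjoint U₂ (H₁ ⊔ F ∙ v₁) := disjoint_sup_span_singleton h₂₁ hv₁'
  have d : Disjoint (H₁ ⊔ F ∙ v₁) (H₂ ⊔ F ∙ v₂) :=
    (disjoint_sup_span_singleton (d₁.mono_left hHU₁).symm hv).symm
  have mem (H : Submodule F V) (v : V) : v ∈ H ⊔ F ∙ v :=
    Submodule.mem_sup_right (Submodule.mem_span_singleton_self v)
  refine ⟨_, _, e₁, e₂, d.eq_bot, Submodule.eq_top_of_disjoint _ _ (by omega) d,
    Or.inr ⟨?_, finrank_inf_of_disjoint d₁⟩, Or.inl ⟨finrank_inf_of_disjoint d₂, ?_⟩⟩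
  · exact finrank_inf_eq_pred hU₁ e₁ hH₁ hHU₁ le_sup_left fun h => hv₁ (h ▸ mem H₁ v₁)
  · exact finrank_inf_eq_pred hU₂ e₂ hH₂ hHU₂ le_sup_left fun h => hv₂ (h ▸ mem H₂ v₂)

/-- A bisection `{V₁, V₂}` in which `V₁` is a common complement of `U₁`, `U₂` and `V₂`. -/
theorem hasCommonBisection_of_common_complement (hV : finrank F V = 2 * k)
    (hU₁ : finrank F U₁ = k) (hU₂ : finrank F U₂ = k) {V₁ V₂ H₁ H₂ : Submodule F V}
    (hV₁ : finrank F V₁ = k) (hV₂ : finrank F V₂ = k)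
    (hH₁ : finrank F H₁ + 1 = k) (hH₂ : finrank F H₂ + 1 = k) (hHU₁ : H₁ ≤ U₁) (hHU₂ : H₂ ≤ U₂)
    (hHV₁ : H₁ ≤ V₂) (hHV₂ : H₂ ≤ V₂) (hne₁ : U₁ ≠ V₂) (hne₂ : U₂ ≠ V₂)
    (d₁ : Disjoint U₁ V₁) (d₂ : Disjoint U₂ V₁) (d : Disjoint V₂ V₁) :
    HasCommonBisection k U₁ U₂ :=
  ⟨V₁, V₂, hV₁, hV₂, d.symm.eq_bot, Submodule.eq_top_of_disjoint _ _ (by omega) d.symm,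
    Or.inl ⟨finrank_inf_of_disjoint d₁, finrank_inf_eq_pred hU₁ hV₂ hH₁ hHU₁ hHV₁ hne₁⟩,
    Or.inl ⟨finrank_inf_of_disjoint d₂, finrank_inf_eq_pred hU₂ hV₂ hH₂ hHU₂ hHV₂ hne₂⟩⟩

theorem exists_hyperplane_of_mem {U : Submodule F V} (hU : finrank F U = k) {a : V} (haU : a ∈ U)
    (ha : a ≠ 0) : ∃ H ≤ U, a ∉ H ∧ finrank F H + 1 = k := by
  obtain ⟨H, hd, hs⟩ := IsModularLattice.exists_disjoint_and_sup_eq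
    ((Submodule.span_singleton_le_iff_mem a U).2 haU)
  refine ⟨H, hs ▸ le_sup_right, fun h => ha ?_, ?_⟩
  · exact Submodule.disjoint_span_singleton.1 hd.symm h
  · have := finrank_sup_of_disjoint hd
    rw [hs, hU, finrank_span_singleton ha] at this
    omega

theorem hasCommonBisection_of_finrank_inf_eq_zero (hk : 2 ≤ k) (hV : finrank F V = 2 * k)
    (hU₁ : finrank F U₁ = k) (hU₂ : finrank F U₂ = k) (h : finrank F ↥(U₁ ⊓ U₂) = 0) :
    HasCommonBisection k U₁ U₂ := by
  have hd : Disjoint U₁ U₂ := disjoint_iff.2 (Submodule.finrank_eq_zero.1 h)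
  have hbot {U : Submodule F V} (hU : 0 < finrank F U) : U ≠ ⊥ := by
    rintro rfl
    simp at hU
  obtain ⟨a, haU, ha⟩ := Submodule.exists_mem_ne_zero_of_ne_bot (hbot (U := U₁) (by omega))
  obtain ⟨b, hbU, hb⟩ := Submodule.exists_mem_ne_zero_of_ne_bot (hbot (U := U₂) (by omega))
  obtain ⟨H₁, hHU₁, haH, hH₁⟩ := exists_hyperplane_of_mem hU₁ haU ha
  obtain ⟨H₂, hHU₂, hbH, hH₂⟩ := exists_hyperplane_of_mem hU₂ hbU hb
  obtain ⟨c, hcH, hc⟩ := Submodule.exists_mem_ne_zero_of_ne_bot (hbot (U := H₁) (by omega))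
  have key {x : V} (h1 : x ∈ U₁) (h2 : x ∈ U₂) : x = 0 := Submodule.disjoint_def.1 hd x h1 h2
  refine hasCommonBisection_of_separate (v₁ := a + b) (v₂ := b + c) hV hU₁ hU₂ hH₁ hH₂ hHU₁ hHU₂
    (hd.mono_right hHU₂) (hd.symm.mono_right hHU₁) ?_ ?_ ?_ ?_ ?_
  · rw [Submodule.add_mem_iff_right _ haU]
    exact fun h => hb (key h hbU)
  · rw [Submodule.add_mem_iff_right _ hbU]
    exact fun h => hc (key (hHU₁ hcH) h)
  · intro h
    obtain ⟨u, hu, x, hx, e⟩ := Submodule.mem_sup.1 h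
    have : a - x = 0 := key (sub_mem haU (hHU₁ hx)) (by
      rw [show a - x = u - b by
        linear_combination (norm := module) -e]
      exact sub_mem hu hbU)
    exact haH (sub_eq_zero.1 this ▸ hx)
  · intro h
    obtain ⟨u, hu, x, hx, e⟩ := Submodule.mem_sup.1 h
    have : b - x = 0 := key (by
      rw [show b - x = u - c by
        linear_combination (norm := module) -e]
      exact sub_mem hu (hHU₁ hcH)) (sub_mem hbU (hHU₂ hx))
    exact hbH (sub_eq_zero.1 this ▸ hx)
  · intro h
    obtain ⟨y, hy, x, hx, e⟩ := Submodule.mem_sup.1 h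
    obtain ⟨z, hz, w, hw, rfl⟩ := Submodule.mem_sup.1 hy
    obtain ⟨t, rfl⟩ := Submodule.mem_span_singleton.1 hw
    have hm : x + t • c ∈ H₁ := add_mem hx (H₁.smul_mem t hcH)
    have : a - (x + t • c) = 0 := key (sub_mem haU (hHU₁ hm)) (by
      rw [show a - (x + t • c) = z + t • b - b by
        linear_combination (norm := module) -e]
      exact sub_mem (add_mem (hHU₂ hz) (U₂.smul_mem t hbU)) hbU)
    exact haH (sub_eq_zero.1 this ▸ hm)

theorem exists_notMem_sup (hV : finrank F V = 2 * k) (hU₁ : finrank F U₁ = k)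
    (hU₂ : finrank F U₂ = k) (h : 0 < finrank F ↥(U₁ ⊓ U₂)) : ∃ c, c ∉ U₁ ⊔ U₂ := by
  by_contra! hc
  have := Submodule.finrank_sup_add_finrank_inf_eq U₁ U₂
  rw [Submodule.eq_top_iff'.2 hc, finrank_top] at this
  omega

theorem hasCommonBisection_of_finrank_inf_eq_one (hV : finrank F V = 2 * k)
    (hU₁ : finrank F U₁ = k) (hU₂ : finrank F U₂ = k) (h : finrank F ↥(U₁ ⊓ U₂) = 1) :
    HasCommonBisection k U₁ U₂ := by
  obtain ⟨c, hc⟩ := exists_notMem_sup hV hU₁ hU₂ (by omega)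
  obtain ⟨w, hw, hw0⟩ : ∃ w ∈ U₁ ⊓ U₂, w ≠ 0 := by
    refine Submodule.exists_mem_ne_zero_of_ne_bot fun hbot => ?_
    rw [hbot] at h
    simp at h
  obtain ⟨H₁, hd₁, hs₁⟩ :=
    IsModularLattice.exists_disjoint_and_sup_eq (inf_le_left : U₁ ⊓ U₂ ≤ U₁)
  obtain ⟨H₂, hd₂, hs₂⟩ :=
    IsModularLattice.exists_disjoint_and_sup_eq (inf_le_right : U₁ ⊓ U₂ ≤ U₂)
  have hHU₁ : H₁ ≤ U₁ := le_sup_right.trans hs₁.le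
  have hHU₂ : H₂ ≤ U₂ := le_sup_right.trans hs₂.le
  have e₁ := finrank_sup_of_disjoint hd₁
  have e₂ := finrank_sup_of_disjoint hd₂
  rw [hs₁, hU₁, h] at e₁
  rw [hs₂, hU₂, h] at e₂
  have key₁ {x : V} (h1 : x ∈ H₁) (h2 : x ∈ U₂) : x = 0 :=
    Submodule.disjoint_def.1 hd₁ x ⟨hHU₁ h1, h2⟩ h1
  have key₂ {x : V} (h1 : x ∈ U₁) (h2 : x ∈ H₂) : x = 0 :=
    Submodule.disjoint_def.1 hd₂ x ⟨h1, hHU₂ h2⟩ h2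
  have hwS : w ∈ U₁ ⊔ U₂ := Submodule.mem_sup_left hw.1
  have hcw : c + w ∉ U₁ ⊔ U₂ := by rwa [Submodule.add_mem_iff_left _ hwS]
  refine hasCommonBisection_of_separate (v₁ := c) (v₂ := c + w) hV hU₁ hU₂
    (by omega) (by omega) hHU₁ hHU₂ (Submodule.disjoint_def.2 fun x => key₂)
    (Submodule.disjoint_def.2 fun x h2 h1 => key₁ h1 h2)
    (fun h => hc (Submodule.mem_sup_left h)) (fun h => hcw (Submodule.mem_sup_right h))
    (fun h => hc (sup_le le_sup_right (hHU₁.trans le_sup_left) h))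
    (fun h => hcw (sup_le_sup_left hHU₂ _ h)) ?_
  intro h
  obtain ⟨y, hy, x, hx, e⟩ := Submodule.mem_sup.1 h
  obtain ⟨z, hz, u, hu, rfl⟩ := Submodule.mem_sup.1 hy
  obtain ⟨t, rfl⟩ := Submodule.mem_span_singleton.1 hu
  have ht : 1 - t = 0 := smul_mem_imp_eq_zero hc (by
    rw [show (1 - t) • c = x + z + t • w by
      linear_combination (norm := module) -e]
    exact add_mem (add_mem (Submodule.mem_sup_left (hHU₁ hx))
      (Submodule.mem_sup_right (hHU₂ hz))) (Submodule.smul_mem _ _ hwS))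
  obtain rfl : t = 1 := (sub_eq_zero.1 ht).symm
  rw [one_smul] at e
  have hz0 : z = 0 := key₂ (by
    rw [show z = -(w + x) by
      linear_combination (norm := module) e]
    exact neg_mem (add_mem hw.1 (hHU₁ hx))) hz
  have hx0 : x = 0 := key₁ hx (by
    rw [show x = -(z + w) by
      linear_combination (norm := module) e]
    exact neg_mem (add_mem (hHU₂ hz) hw.2))
  apply hw0
  rw [hz0, hx0] at e
  simpa using e

theorem exists_mem_notMem_of_finrank_lt {A B : Submodule F V} (h : finrank F A < finrank F B) :
    ∃ x ∈ B, x ∉ A :=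
  SetLike.not_le_iff_exists.1 fun hle => h.not_ge (Submodule.finrank_mono hle)

theorem hasCommonBisection_of_finrank_inf_add_one_eq (hk : 2 ≤ k) (hV : finrank F V = 2 * k)
    (hU₁ : finrank F U₁ = k) (hU₂ : finrank F U₂ = k) (h : finrank F ↥(U₁ ⊓ U₂) + 1 = k) :
    HasCommonBisection k U₁ U₂ := by
  obtain ⟨c, hc⟩ := exists_notMem_sup hV hU₁ hU₂ (by omega)
  obtain ⟨a, haU, haW⟩ := exists_mem_notMem_of_finrank_lt
    (show finrank F ↥(U₁ ⊓ U₂) < finrank F U₁ by omega)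
  obtain ⟨b, hbU, hbW⟩ := exists_mem_notMem_of_finrank_lt
    (show finrank F ↥(U₁ ⊓ U₂) < finrank F U₂ by omega)
  have hcW : c ∉ U₁ ⊓ U₂ := fun h => hc (Submodule.mem_sup_left h.1)
  have eq_sup {U : Submodule F V} {x : V} (hU : finrank F U = k) (hle : U₁ ⊓ U₂ ≤ U)
      (hx : x ∈ U) (hxW : x ∉ U₁ ⊓ U₂) : (U₁ ⊓ U₂) ⊔ F ∙ x = U := by
    refine Submodule.eq_of_le_of_finrank_eq
      (sup_le hle ((Submodule.span_singleton_le_iff_mem _ _).2 hx)) ?_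
    rw [Submodule.finrank_sup_span_singleton hxW, h, hU]
  have haM : a ∉ (U₁ ⊓ U₂) ⊔ Submodule.span F {a - b, a - c} := by
    intro hm
    obtain ⟨w, hw, u, hu, e⟩ := Submodule.mem_sup.1 hm
    obtain ⟨s, t, rfl⟩ := Submodule.mem_span_pair.1 hu
    obtain rfl : t = 0 := smul_mem_imp_eq_zero hc (by
      rw [show t • c = (w + s • a + t • a - a) - s • b by
        linear_combination (norm := module) -e]
      exact sub_mem (Submodule.mem_sup_left (sub_mem (add_mem (add_mem hw.1 (U₁.smul_mem _ haU))
        (U₁.smul_mem _ haU)) haU)) (Submodule.mem_sup_right (U₂.smul_mem _ hbU)))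
    obtain rfl : s = 0 := smul_mem_imp_eq_zero (fun hb => hbW ⟨hb, hbU⟩) (by
      rw [show s • b = w + s • a - a by
        linear_combination (norm := module) -e]
      exact sub_mem (add_mem hw.1 (U₁.smul_mem _ haU)) haU)
    refine haW ?_
    rw [← e]
    simpa using hw
  obtain ⟨f, hfa, hf⟩ := Submodule.exists_le_ker_of_notMem haM
  have hfW : U₁ ⊓ U₂ ≤ LinearMap.ker f := le_sup_left.trans hf
  have hfb : f b ≠ 0 := by
    have : f (a - b) = 0 := hf (Submodule.mem_sup_right (Submodule.subset_span (by simp)))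
    rwa [map_sub, sub_eq_zero, eq_comm] at this ▸ hfa
  have hfc : f c ≠ 0 := by
    have : f (a - c) = 0 := hf (Submodule.mem_sup_right (Submodule.subset_span (by simp)))
    rwa [map_sub, sub_eq_zero, eq_comm] at this ▸ hfa
  obtain ⟨V₁, hd, hs⟩ := IsModularLattice.exists_disjoint_and_sup_eq hfW
  have hV₁f : V₁ ≤ LinearMap.ker f := le_sup_right.trans hs.le
  have disj {x : V} (hx : f x ≠ 0) : Disjoint ((U₁ ⊓ U₂) ⊔ F ∙ x) V₁ := by
    refine (disjoint_sup_span_singleton hd.symm fun hm => hx ?_).symm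
    exact sup_le hV₁f hfW hm
  have hV₁ : finrank F V₁ = k := by
    have e₁ := finrank_sup_of_disjoint hd
    have e₂ := Module.Dual.finrank_ker_add_one_of_ne_zero (f := f) (by
      rintro rfl
      simp at hfa)
    rw [hs] at e₁
    omega
  have mem : c ∈ (U₁ ⊓ U₂) ⊔ F ∙ c :=
    Submodule.mem_sup_right (Submodule.mem_span_singleton_self c)
  refine hasCommonBisection_of_common_complement (V₂ := (U₁ ⊓ U₂) ⊔ F ∙ c) hV hU₁ hU₂ hV₁
    (by rw [Submodule.finrank_sup_span_singleton hcW, h]) h h inf_le_left inf_le_right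
    le_sup_left le_sup_left (fun h => hc (Submodule.mem_sup_left (h ▸ mem)))
    (fun h => hc (Submodule.mem_sup_right (h ▸ mem))) ?_ ?_ (disj hfc)
  · rw [← eq_sup hU₁ inf_le_left haU haW]
    exact disj hfa
  · rw [← eq_sup hU₂ inf_le_right hbU hbW]
    exact disj hfb

theorem exists_pair_independent_mod {W U : Submodule F V} (h : finrank F W + 2 = finrank F U) :
    ∃ a₁ ∈ U, ∃ a₂ ∈ U, ∀ s t : F, s • a₁ + t • a₂ ∈ W → s = 0 ∧ t = 0 := by
  obtain ⟨a₁, ha₁, h₁⟩ := exists_mem_notMem_of_finrank_lt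
    (show finrank F W < finrank F U by omega)
  obtain ⟨a₂, ha₂, h₂⟩ := exists_mem_notMem_of_finrank_lt
    (show finrank F ↥(W ⊔ F ∙ a₁) < finrank F U by
      rw [Submodule.finrank_sup_span_singleton h₁]
      omega)
  refine ⟨a₁, ha₁, a₂, ha₂, fun s t hst => ?_⟩
  obtain rfl : t = 0 := smul_mem_imp_eq_zero h₂ (by
    rw [show t • a₂ = (s • a₁ + t • a₂) + (-s) • a₁ by module]
    exact Submodule.add_mem_sup hst (Submodule.smul_mem _ _ (Submodule.mem_span_singleton_self _)))
  refine ⟨smul_mem_imp_eq_zero h₁ ?_, rfl⟩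
  simpa using hst

theorem hasCommonBisection_of_finrank_inf_add_two_eq (hV : finrank F V = 2 * k)
    (hU₁ : finrank F U₁ = k) (hU₂ : finrank F U₂ = k) (h : finrank F ↥(U₁ ⊓ U₂) + 2 = k) :
    HasCommonBisection k U₁ U₂ := by
  obtain ⟨a₁, ha₁, a₂, ha₂, ha⟩ := exists_pair_independent_mod (h.trans hU₁.symm)
  obtain ⟨b₁, hb₁, b₂, hb₂, hb⟩ := exists_pair_independent_mod (h.trans hU₂.symm)
  have ha₁W : a₁ ∉ U₁ ⊓ U₂ := fun hm => one_ne_zero (ha 1 0 (by simpa using hm)).1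
  have hb₁W : b₁ ∉ U₁ ⊓ U₂ := fun hm => one_ne_zero (hb 1 0 (by simpa using hm)).1
  have ha₁U : a₁ ∉ U₂ := fun hm => ha₁W ⟨ha₁, hm⟩
  have hb₁U : b₁ ∉ U₁ := fun hm => hb₁W ⟨hm, hb₁⟩
  have hH₁U : (U₁ ⊓ U₂) ⊔ F ∙ a₁ ≤ U₁ :=
    sup_le inf_le_left ((Submodule.span_singleton_le_iff_mem _ _).2 ha₁)
  have hH₂U : (U₁ ⊓ U₂) ⊔ F ∙ b₁ ≤ U₂ :=
    sup_le inf_le_right ((Submodule.span_singleton_le_iff_mem _ _).2 hb₁)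
  have hH₁ := Submodule.finrank_sup_span_singleton ha₁W
  have hH₂ := Submodule.finrank_sup_span_singleton hb₁W
  have hV₂ := Submodule.finrank_sup_span_singleton fun hm => hb₁U (hH₁U hm)
  have hb₁V : b₁ ∈ (U₁ ⊓ U₂) ⊔ F ∙ a₁ ⊔ F ∙ b₁ :=
    Submodule.mem_sup_right (Submodule.mem_span_singleton_self _)
  have ha₁V : a₁ ∈ (U₁ ⊓ U₂) ⊔ F ∙ a₁ ⊔ F ∙ b₁ :=
    Submodule.mem_sup_left (Submodule.mem_sup_right (Submodule.mem_span_singleton_self _))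
  have hV₂S : (U₁ ⊓ U₂) ⊔ F ∙ a₁ ⊔ F ∙ b₁ ≤ U₁ ⊔ U₂ :=
    sup_le_sup hH₁U ((Submodule.span_singleton_le_iff_mem _ _).2 hb₁)
  obtain ⟨C, hC⟩ := Submodule.exists_isCompl (U₁ ⊔ U₂)
  have hCrank := Submodule.finrank_add_eq_of_isCompl hC
  have hsup := Submodule.finrank_sup_add_finrank_inf_eq U₁ U₂
  have hPS : Submodule.span F {a₁ + b₂, a₂ + b₁} ≤ U₁ ⊔ U₂ := by
    rw [Submodule.span_le, Set.insert_subset_iff, Set.singleton_subset_iff]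
    exact ⟨Submodule.add_mem_sup ha₁ hb₂, Submodule.add_mem_sup ha₂ hb₁⟩
  have disj {X : Submodule F V} (hX : X ≤ U₁ ⊔ U₂)
      (hXP : ∀ s t : F, s • (a₁ + b₂) + t • (a₂ + b₁) ∈ X → s = 0 ∧ t = 0) :
      Disjoint X (Submodule.span F {a₁ + b₂, a₂ + b₁} ⊔ C) := by
    refine Disjoint.disjoint_sup_right_of_disjoint_sup_left ?_
      (hC.disjoint.mono_left (sup_le hX hPS))
    refine Submodule.disjoint_def.2 fun x hxX hxP => ?_
    obtain ⟨s, t, rfl⟩ := Submodule.mem_span_pair.1 hxP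
    obtain ⟨rfl, rfl⟩ := hXP s t hxX
    simp
  have hXU₁ (s t : F) (hm : s • (a₁ + b₂) + t • (a₂ + b₁) ∈ U₁) : s = 0 ∧ t = 0 := by
    refine (hb t s ⟨?_, add_mem (U₂.smul_mem _ hb₁) (U₂.smul_mem _ hb₂)⟩).symm
    rw [show t • b₁ + s • b₂ = s • (a₁ + b₂) + t • (a₂ + b₁) - (s • a₁ + t • a₂) by
      module]
    exact sub_mem hm (add_mem (U₁.smul_mem _ ha₁) (U₁.smul_mem _ ha₂))
  have hXU₂ (s t : F) (hm : s • (a₁ + b₂) + t • (a₂ + b₁) ∈ U₂) : s = 0 ∧ t = 0 := by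
    refine ha s t ⟨add_mem (U₁.smul_mem _ ha₁) (U₁.smul_mem _ ha₂), ?_⟩
    rw [show s • a₁ + t • a₂ = s • (a₁ + b₂) + t • (a₂ + b₁) - (t • b₁ + s • b₂) by
      module]
    exact sub_mem hm (add_mem (U₂.smul_mem _ hb₁) (U₂.smul_mem _ hb₂))
  have hXV₂ (s t : F) (hm : s • (a₁ + b₂) + t • (a₂ + b₁) ∈ (U₁ ⊓ U₂) ⊔ F ∙ a₁ ⊔ F ∙ b₁) :
      s = 0 ∧ t = 0 := by
    obtain ⟨y, hy, z, hz, e⟩ := Submodule.mem_sup.1 hm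
    obtain ⟨w, hw, u, hu, rfl⟩ := Submodule.mem_sup.1 hy
    obtain ⟨p, rfl⟩ := Submodule.mem_span_singleton.1 hu
    obtain ⟨q, rfl⟩ := Submodule.mem_span_singleton.1 hz
    have h₁ := ha (s - p) t ⟨add_mem (U₁.smul_mem _ ha₁) (U₁.smul_mem _ ha₂), by
      rw [show (s - p) • a₁ + t • a₂ = w + (q • b₁ - t • b₁ - s • b₂) by
        linear_combination (norm := module) -e]
      exact add_mem hw.2 (sub_mem (sub_mem (U₂.smul_mem _ hb₁) (U₂.smul_mem _ hb₁))
        (U₂.smul_mem _ hb₂))⟩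
    have h₂ := hb (t - q) s ⟨by
      rw [show (t - q) • b₁ + s • b₂ = w + (p • a₁ - s • a₁ - t • a₂) by
        linear_combination (norm := module) -e]
      exact add_mem hw.1 (sub_mem (sub_mem (U₁.smul_mem _ ha₁) (U₁.smul_mem _ ha₁))
        (U₁.smul_mem _ ha₂)), add_mem (U₂.smul_mem _ hb₁) (U₂.smul_mem _ hb₂)⟩
    exact ⟨h₂.2, h₁.2⟩
  have hP : finrank F ↥(Submodule.span F {a₁ + b₂, a₂ + b₁}) = 2 := by
    have hli : LinearIndependent F ![a₁ + b₂, a₂ + b₁] :=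
      LinearIndependent.pair_iff.2 fun s t hst => hXU₁ s t (hst ▸ U₁.zero_mem)
    rw [← Matrix.range_cons_cons_empty _ _ ![], finrank_span_eq_card hli, Fintype.card_fin]
  have hV₁ := finrank_sup_of_disjoint (hC.disjoint.mono_left hPS)
  exact hasCommonBisection_of_common_complement hV hU₁ hU₂ (by omega) (by omega)
    (hH₁.symm ▸ by omega) (hH₂.symm ▸ by omega) hH₁U hH₂U le_sup_left
    (sup_le_sup_right le_sup_left _) (fun e => hb₁U (e ▸ hb₁V)) (fun e => ha₁U (e ▸ ha₁V))
    (disj le_sup_left hXU₁) (disj le_sup_right hXU₂) (disj hV₂S hXV₂)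

end

theorem collinearlyComplete_kk_zero_kminusone_q2
    (F V : Type*) [Field F] [Fintype F] [AddCommGroup V] [Module F V]
    [FiniteDimensional F V] (k : ℕ)
    (hq : Fintype.card F = 2) (hk2 : 2 ≤ k) (hk4 : k ≤ 4)
    (hV : finrank F V = 2 * k) :
    ∀ U₁ U₂ : Submodule F V, finrank F U₁ = k → finrank F U₂ = k → U₁ ≠ U₂ →
      ∃ V₁ V₂ : Submodule F V, finrank F V₁ = k ∧ finrank F V₂ = k ∧
        V₁ ⊓ V₂ = ⊥ ∧ V₁ ⊔ V₂ = ⊤ ∧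
        Incident 0 (k - 1) U₁ V₁ V₂ ∧ Incident 0 (k - 1) U₂ V₁ V₂ := by
  intro U₁ U₂ hU₁ hU₂ hne
  have hlt : finrank F ↥(U₁ ⊓ U₂) < k := by
    rw [← hU₁]
    refine Submodule.finrank_lt_finrank_of_lt (lt_of_le_of_ne inf_le_left fun h => hne ?_)
    exact Submodule.eq_of_le_of_finrank_eq (inf_eq_left.1 h) (hU₁.trans hU₂.symm)
  obtain h | h | h | h : finrank F ↥(U₁ ⊓ U₂) = 0 ∨ finrank F ↥(U₁ ⊓ U₂) = 1 ∨
      finrank F ↥(U₁ ⊓ U₂) + 1 = k ∨ finrank F ↥(U₁ ⊓ U₂) + 2 = k := by omega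
  · exact hasCommonBisection_of_finrank_inf_eq_zero hk2 hV hU₁ hU₂ h
  · exact hasCommonBisection_of_finrank_inf_eq_one hV hU₁ hU₂ h
  · exact hasCommonBisection_of_finrank_inf_add_one_eq hk2 hV hU₁ hU₂ h
  · exact hasCommonBisection_of_finrank_inf_add_two_eq hV hU₁ hU₂ h
end
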